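/- Let (R, 𝔪) be a two-dimensional regular local ring with infinite residue field and let M be an extremal module of rank r with I(M) = I of order n. Suppose M decomposes as a direct sum P_1 ⊕ P_2 where P_i has rank r_i and I(P_i) = I_i has order n_i. Then: (1) n_1 = r_1, n_2 = r_2, and hence n = r; (2) P_1 and P_2 are extremal; (3) λ(R/I) = λ(R/I_1) + λ(R/I_2) + r_1 r_2; (4) 𝔪^{r-1} = 𝔪^{r_2 − 1} I_1 + 𝔪^{r_1 − 1} I_2. -/

import Mathlib

open IsLocalRing

section Defs

variable {R : Type*} [CommRing R]

/-- `R` is a two-dimensional regular local ring: Noetherian local of Krull dimension 2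
whose maximal ideal is generated by two elements. -/
def IsTwoDimRegularLocal (R : Type*) [CommRing R] [IsLocalRing R] : Prop :=
  IsNoetherianRing R ∧ ringKrullDim R = 2 ∧
    ∃ x y : R, maximalIdeal R = Ideal.span {x, y}

/-- `z` lies in the integral closure of the ideal `I`, i.e. it satisfies an equation
`z ^ n + c 1 * z ^ (n-1) + ⋯ + c n = 0` with `c i ∈ I ^ i`. -/
def MemIntClosure (I : Ideal R) (z : R) : Prop :=
  ∃ n : ℕ, 0 < n ∧ ∃ c : ℕ → R, (∀ i ∈ Finset.Icc 1 n, c i ∈ I ^ i) ∧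
    z ^ n + ∑ i ∈ Finset.Icc 1 n, c i * z ^ (n - i) = 0

/-- The ideal `I` is integrally closed. -/
def IdealIntClosed (I : Ideal R) : Prop := ∀ z, MemIntClosure I z → z ∈ I

/-- `I` is `𝔪`-primary. -/
def IsMPrimary [IsLocalRing R] (I : Ideal R) : Prop := I.radical = maximalIdeal R

/-- `ord I = n` : `n` is the largest power of the maximal ideal containing `I`. -/
def ordEQ [IsLocalRing R] (I : Ideal R) (n : ℕ) : Prop :=
  I ≤ maximalIdeal R ^ n ∧ ¬ I ≤ maximalIdeal R ^ (n + 1)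

/-- Determinant of the square matrix with columns `w 0, …, w (r-1)`. -/
def colDet {r : ℕ} (w : Fin r → Fin r → R) : R :=
  Matrix.det (Matrix.of fun i j => w j i)

/-- The ideal of maximal minors `I(M)` of a submodule `M ⊆ R^r`:  it is generated by all
determinants of `r × r` matrices whose columns lie in `M`. -/
def maxMinors {r : ℕ} (M : Submodule R (Fin r → R)) : Ideal R :=
  Ideal.span { d | ∃ w : Fin r → Fin r → R, (∀ j, w j ∈ M) ∧ d = colDet w }

/-- The ideal `I_k(M)` of `k × k` minors of a matrix whose columns generate `M ⊆ R^r`. -/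
def minorsIdeal (k : ℕ) {r : ℕ} (M : Submodule R (Fin r → R)) : Ideal R :=
  Ideal.span { d | ∃ (w : Fin k → Fin r → R) (ρ : Fin k → Fin r),
    Function.Injective ρ ∧ (∀ j, w j ∈ M) ∧
    d = Matrix.det (Matrix.of fun i j : Fin k => w j (ρ i)) }

/-- `v ∈ R^r` is integral over the submodule `M ⊆ R^r` : the determinant of every square
matrix with one column `v` and the remaining columns in `M` is integral over `I(M)`. -/
def IntegralOverMod {r : ℕ} (M : Submodule R (Fin r → R)) (v : Fin r → R) : Prop :=
  ∀ (w : Fin r → Fin r → R) (j₀ : Fin r), w j₀ = v → (∀ j, j ≠ j₀ → w j ∈ M) →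
    MemIntClosure (maxMinors M) (colDet w)

/-- The submodule `M ⊆ R^r` is integrally closed. -/
def ModIntClosed {r : ℕ} (M : Submodule R (Fin r → R)) : Prop :=
  ∀ v, IntegralOverMod M v → v ∈ M

/-- The length of an `R`-module, as the Krull dimension of its submodule lattice. -/
noncomputable def modLength (R : Type*) (M : Type*) [CommRing R] [AddCommGroup M]
    [Module R M] : WithBot ℕ∞ :=
  Order.krullDim (Submodule R M)

/-- `M ⊆ R^r` has finite colength; equivalently, `M` is a finitely generated torsion-free
module of rank `r` with double dual `M** = R^r`. -/
def FinColength {r : ℕ} (M : Submodule R (Fin r → R)) : Prop :=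
  IsFiniteLength R ((Fin r → R) ⧸ M)

/-- `M` has a nonzero free direct summand. -/
def HasFreeSummand {r : ℕ} (M : Submodule R (Fin r → R)) : Prop :=
  ∃ N P : Submodule R (Fin r → R), N ⊔ P = M ∧ N ⊓ P = ⊥ ∧ N ≠ ⊥ ∧ Module.Free R ↥N

/-- `M` is a direct sum of two nonzero submodules. -/
def DecomposableSub {r : ℕ} (M : Submodule R (Fin r → R)) : Prop :=
  ∃ N P : Submodule R (Fin r → R), N ⊔ P = M ∧ N ⊓ P = ⊥ ∧ N ≠ ⊥ ∧ P ≠ ⊥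

/-- `M` is nonzero and not a direct sum of two nonzero submodules. -/
def IndecomposableSub {r : ℕ} (M : Submodule R (Fin r → R)) : Prop :=
  M ≠ ⊥ ∧ ¬ DecomposableSub M

/-- `a` is a minimal generating set of the ideal `I`. -/
def MinGens {m : ℕ} (I : Ideal R) (a : Fin m → R) : Prop :=
  Ideal.span (Set.range a) = I ∧ ∀ j : Fin m, Ideal.span (a '' {j}ᶜ) ≠ I

/-- `a = c 0 * x^(r-1) + c 1 * x^(r-2) * y + ⋯ + c (r-1) * y^(r-1)`. -/
def Expresses (r : ℕ) (x y : R) (c : Fin r → R) (a : R) : Prop :=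
  a = ∑ i : Fin r, c i * x ^ (r - 1 - (i : ℕ)) * y ^ (i : ℕ)

/-- The `k`-th Koszul relation column between `x^(r-1), …, y^(r-1)`:
`y` in position `k` and `-x` in position `k+1`. -/
def stdRelCol (r : ℕ) (x y : R) (k : ℕ) : Fin r → R :=
  fun i => if (i : ℕ) = k then y else if (i : ℕ) = k + 1 then -x else 0

/-- The module generated by the coefficient columns `C j` together with the `r - 1`
Koszul relation columns between `x^(r-1), …, y^(r-1)`. -/
def MrSpan (r : ℕ) (x y : R) {m : ℕ} (C : Fin m → Fin r → R) :
    Submodule R (Fin r → R) :=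
  Submodule.span R (Set.range C ∪ { v | ∃ k, k < r - 1 ∧ v = stdRelCol r x y k })

/-- The data `(x, y, a, C)` presents the module `M_r(I)` : `𝔪 = (x,y)`, `a` is a minimal
generating set of `I` and column `C j` expresses `a j` in terms of `x^(r-1), …, y^(r-1)`. -/
def IsMrPresentation [IsLocalRing R] (r : ℕ) (I : Ideal R) {m : ℕ} (x y : R)
    (a : Fin m → R) (C : Fin m → Fin r → R) : Prop :=
  maximalIdeal R = Ideal.span {x, y} ∧ MinGens I a ∧ ∀ j, Expresses r x y (C j) (a j)

/-- `N` is a reduction of `M` : `N ≤ M` and every element of `M` is integral over `N`. -/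
def IsReductionMod {r : ℕ} (N M : Submodule R (Fin r → R)) : Prop :=
  N ≤ M ∧ ∀ v ∈ M, IntegralOverMod N v

/-- `N` is a minimal reduction of `M`. -/
def IsMinimalReductionMod {r : ℕ} (N M : Submodule R (Fin r → R)) : Prop :=
  IsReductionMod N M ∧ ∀ N' ≤ N, IsReductionMod N' M → N' = N

/-- The `j`-th signed maximal minor of an `r × (r+1)` matrix. -/
def signedMinor {r : ℕ} (A : Matrix (Fin r) (Fin (r + 1)) R) (j : Fin (r + 1)) : R :=
  (-1 : R) ^ (j : ℕ) * (A.submatrix id j.succAbove).det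

/-- `M ⊆ R^r` is extremal: integrally closed, without free direct summands, with
`λ(R/I(M)) = λ(R^r/M) + r(r-1)/2`. -/
def IsExtremal {r : ℕ} (M : Submodule R (Fin r → R)) : Prop :=
  FinColength M ∧ ModIntClosed M ∧ ¬ HasFreeSummand M ∧
    modLength R (R ⧸ maxMinors M) =
      modLength R ((Fin r → R) ⧸ M) + ((r * (r - 1) / 2 : ℕ) : WithBot ℕ∞)

/-- `a ∈ J`, `b ∈ K` is a joint reduction of the pair `(J, K)`. -/
def IsJointReduction (J K : Ideal R) (a b : R) : Prop :=
  a ∈ J ∧ b ∈ K ∧ ∃ n : ℕ,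
    (Ideal.span {a} * K + Ideal.span {b} * J) * (J * K) ^ n = (J * K) ^ (n + 1)

/-- `S` is the matrix `Sym^k(Q)` for `Q = [[a, c], [b, d]]` : with `X = aU + bV`,
`Y = cU + dV`, the `j`-th column of `S` records the coefficients of
`X^(k-j) Y^j` in terms of `U^k, U^(k-1)V, …, V^k`. -/
def IsSymOf (k : ℕ) (a b c d : R) (S : Matrix (Fin (k + 1)) (Fin (k + 1)) R) : Prop :=
  ∀ j : Fin (k + 1),
    ((MvPolynomial.C a * MvPolynomial.X 0 + MvPolynomial.C b * MvPolynomial.X 1) ^ (k - (j : ℕ)) *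
        (MvPolynomial.C c * MvPolynomial.X 0 + MvPolynomial.C d * MvPolynomial.X 1) ^ (j : ℕ)
      : MvPolynomial (Fin 2) R)
    = ∑ i : Fin (k + 1), MvPolynomial.C (S i j) *
        MvPolynomial.X 0 ^ (k - (i : ℕ)) * MvPolynomial.X 1 ^ (i : ℕ)

/-- The `r × s` bidiagonal matrix with `y` on the diagonal and `-x` directly below it. -/
def bidiag (r s : ℕ) (x y : R) : Matrix (Fin r) (Fin s) R :=
  Matrix.of fun i j =>
    if (i : ℕ) = (j : ℕ) then y else if (i : ℕ) = (j : ℕ) + 1 then -x else 0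

end Defs

section Icl

variable {K : Type*} [Field K]

/-- The elements of `K` lying in every valuation subring that contains `S`; equivalently the
integral closure in `K` of the subring generated by `S`. -/
def icl (S : Set K) : Subring K :=
  ⨅ V : {V : ValuationSubring K // S ⊆ V.toSubring}, V.1.toSubring

lemma mem_icl {S : Set K} {z : K} :
    z ∈ icl S ↔ ∀ V : ValuationSubring K, S ⊆ V.toSubring → z ∈ V := by
  simp [icl, Subring.mem_iInf]

lemma subset_icl (S : Set K) : S ⊆ icl S := fun _ hz => mem_icl.2 fun _ hV => hV hz

lemma icl_mono {S T : Set K} (h : S ⊆ T) : icl S ≤ icl T := fun _ hz =>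
  mem_icl.2 fun V hV => mem_icl.1 hz V (h.trans hV)

lemma icl_le_icl {S T : Set K} (h : S ⊆ icl T) : icl S ≤ icl T := fun _ hz =>
  mem_icl.2 fun V hV => mem_icl.1 hz V fun _ hs => mem_icl.1 (h hs) V hV

lemma mem_icl_iff_isIntegral {S : Set K} {z : K} :
    z ∈ icl S ↔ IsIntegral (Subring.closure S) z := by
  rw [icl, iInf_valuationSubring_superset]
  rfl

lemma exists_mul_mem_closure {S T : Set K} (M : Submonoid K)
    (hM : (M : Set K) ⊆ Subring.closure S)
    (hden : ∀ c ∈ T, ∃ m ∈ M, m * c ∈ Subring.closure S) {c : K}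
    (hc : c ∈ Subring.closure T) : ∃ m ∈ M, m * c ∈ Subring.closure S := by
  induction hc using Subring.closure_induction with
  | mem c hc => exact hden c hc
  | zero => exact ⟨1, M.one_mem, by simp⟩
  | one => exact ⟨1, M.one_mem, by simp⟩
  | add a b _ _ ha hb =>
    obtain ⟨m, hm, ha⟩ := ha
    obtain ⟨k, hk, hb⟩ := hb
    refine ⟨m * k, M.mul_mem hm hk, ?_⟩
    have : m * k * (a + b) = k * (m * a) + m * (k * b) := by ring
    rw [this]
    exact add_mem (mul_mem (hM hk) ha) (mul_mem (hM hm) hb)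
  | neg a _ ha =>
    obtain ⟨m, hm, ha⟩ := ha
    exact ⟨m, hm, by simpa using ha⟩
  | mul a b _ _ ha hb =>
    obtain ⟨m, hm, ha⟩ := ha
    obtain ⟨k, hk, hb⟩ := hb
    refine ⟨m * k, M.mul_mem hm hk, ?_⟩
    have : m * k * (a * b) = (m * a) * (k * b) := by ring
    rw [this]
    exact mul_mem ha hb

lemma exists_common_mul_mem (A : Subring K) (C : Set K) (M : Submonoid K) (hM : (M : Set K) ⊆ A)
    (hden : ∀ c ∈ C, ∃ m ∈ M, m * c ∈ A) (s : Finset K) (hs : (s : Set K) ⊆ C) :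
    ∃ m ∈ M, ∀ c ∈ s, m * c ∈ A := by
  classical
  induction s using Finset.induction_on with
  | empty => exact ⟨1, M.one_mem, by simp⟩
  | insert a s _ ih =>
    obtain ⟨m, hm, h⟩ := ih (fun x hx => hs (by simp [Finset.mem_coe.1 hx]))
    obtain ⟨k, hk, h'⟩ := hden a (hs (by simp))
    refine ⟨m * k, M.mul_mem hm hk, fun c hc => ?_⟩
    rcases Finset.mem_insert.1 hc with rfl | hc
    · rw [mul_assoc]; exact mul_mem (hM hm) h'
    · rw [mul_right_comm, mul_comm]; exact mul_mem (hM hk) (h c hc)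

/-- Clearing denominators in an equation of integral dependence. -/
lemma exists_mul_mem_icl {S T : Set K} (M : Submonoid K)
    (hM : (M : Set K) ⊆ Subring.closure S)
    (hden : ∀ c ∈ T, ∃ m ∈ M, m * c ∈ Subring.closure S) {f : K}
    (hf : f ∈ icl T) : ∃ m ∈ M, m * f ∈ icl S := by
  classical
  rw [mem_icl_iff_isIntegral] at hf
  obtain ⟨p, hp, hpf⟩ := hf
  set q := p.map (Subring.closure T).subtype with hq
  have hqm : q.Monic := hp.map _
  obtain ⟨m, hm, hmc⟩ := exists_common_mul_mem (Subring.closure S) (Subring.closure T) M hM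
    (fun c hc => exists_mul_mem_closure M hM hden hc)
    (Finset.image (fun i => q.coeff i) (Finset.range (q.natDegree + 1))) (by
      intro c hc
      simp only [Finset.coe_image, Set.mem_image] at hc
      obtain ⟨i, -, rfl⟩ := hc
      simp [hq])
  refine ⟨m, hm, mem_icl_iff_isIntegral.2 ?_⟩
  have hcoef : ∀ i, (q.scaleRoots m).coeff i ∈ Subring.closure S := by
    intro i
    rw [Polynomial.coeff_scaleRoots]
    rcases lt_trichotomy i q.natDegree with h | h | h
    · obtain ⟨j, hj⟩ := Nat.exists_eq_add_of_lt h
      have : q.coeff i * m ^ (q.natDegree - i) = (m * q.coeff i) * m ^ j := by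
        rw [show q.natDegree - i = j + 1 by omega]; ring
      rw [this]
      refine mul_mem (hmc _ ?_) (pow_mem (hM hm) _)
      exact Finset.mem_image.2 ⟨i, by simp; omega, rfl⟩
    · subst h
      simp [hqm.coeff_natDegree]
    · simp [Polynomial.coeff_eq_zero_of_natDegree_lt h]
  have hlift : q.scaleRoots m ∈ Polynomial.lifts (Subring.closure S).subtype := by
    rw [Polynomial.lifts_iff_coeff_lifts]
    intro i
    exact ⟨⟨_, hcoef i⟩, rfl⟩
  obtain ⟨u, hu, -, hum⟩ := Polynomial.lifts_and_natDegree_eq_and_monic hlift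
    ((Polynomial.monic_scaleRoots_iff m).2 hqm)
  refine ⟨u, hum, ?_⟩
  have h1 : Polynomial.eval (m * f) (u.map (Subring.closure S).subtype) = 0 := by
    rw [hu]
    have := Polynomial.scaleRoots_eval₂_mul (p := q) (RingHom.id K) m (r := f)
    have h2 : Polynomial.eval₂ (RingHom.id K) f q = 0 := by
      rw [hq, Polynomial.eval₂_map]
      exact hpf
    rw [h2, mul_zero] at this
    exact this
  rw [Polynomial.eval_map] at h1
  exact h1

lemma mem_icl_of_mem_insert {S : Set K} {t z : K} (h₁ : z ∈ icl (insert t S))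
    (h₂ : z ∈ icl (insert t⁻¹ S)) : z ∈ icl S := by
  refine mem_icl.2 fun V hV => ?_
  rcases V.mem_or_inv_mem t with h | h
  · exact mem_icl.1 h₁ V (Set.insert_subset h hV)
  · exact mem_icl.1 h₂ V (Set.insert_subset h hV)

end Icl

section Reg2

open Polynomial

variable {K : Type*} [Field K]

lemma mem_icl_coe {A : Subring K} {z : K} : z ∈ icl (A : Set K) ↔ IsIntegral A z := by
  have := mem_icl_iff_isIntegral (S := (A : Set K)) (z := z)
  rwa [Subring.closure_eq] at this

/-- `A` is a normal local subring of `K` whose maximal ideal is generated by the regular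
sequence `x, y`. -/
structure Reg2 (A : Subring K) (x y : K) : Prop where
  x_mem : x ∈ A
  y_mem : y ∈ A
  x_ne : x ≠ 0
  y_ne : y ≠ 0
  unit : ∀ a ∈ A, a⁻¹ ∈ A ∨ ∃ b ∈ A, ∃ c ∈ A, a = x * b + y * c
  one_ne : ∀ b ∈ A, ∀ c ∈ A, x * b + y * c ≠ 1
  reg : ∀ u ∈ A, ∀ v ∈ A, x * u = y * v → ∃ w ∈ A, u = y * w ∧ v = x * w
  normal : icl (A : Set K) ≤ A

/-- The subring `A[z]` of `K`. -/
noncomputable def adj (A : Subring K) (z : K) : Subring K := (eval₂RingHom A.subtype z).range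

lemma le_adj (A : Subring K) (z : K) : A ≤ adj A z := fun a ha => ⟨C ⟨a, ha⟩, by simp⟩

lemma self_mem_adj (A : Subring K) (z : K) : z ∈ adj A z := ⟨X, by simp⟩

lemma adj_le {A B : Subring K} {z : K} (h : A ≤ B) (hz : z ∈ B) : adj A z ≤ B := by
  rintro _ ⟨P, rfl⟩
  simp only [coe_eval₂RingHom, eval₂_eq_sum_range]
  exact sum_mem fun i _ => mul_mem (h (P.coeff i).2) (pow_mem hz i)

namespace Reg2

variable {A : Subring K} {x y : K}

lemma symm (h : Reg2 A x y) : Reg2 A y x where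
  x_mem := h.y_mem
  y_mem := h.x_mem
  x_ne := h.y_ne
  y_ne := h.x_ne
  unit a ha := (h.unit a ha).imp id fun ⟨b, hb, c, hc, e⟩ => ⟨c, hc, b, hb, by rw [e]; ring⟩
  one_ne b hb c hc e := h.one_ne c hc b hb (by rw [← e]; ring)
  reg u hu v hv e := by
    obtain ⟨w, hw, h1, h2⟩ := h.reg v hv u hu e.symm
    exact ⟨w, hw, h2, h1⟩
  normal := h.normal

/-- The maximal ideal. -/
def maxIdeal (h : Reg2 A x y) : Ideal A := Ideal.span {⟨x, h.x_mem⟩, ⟨y, h.y_mem⟩}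

lemma mem_maxIdeal (h : Reg2 A x y) {a : A} :
    a ∈ h.maxIdeal ↔ ∃ b ∈ A, ∃ c ∈ A, (a : K) = x * b + y * c := by
  rw [maxIdeal, Ideal.mem_span_pair]
  constructor
  · rintro ⟨b, c, rfl⟩
    exact ⟨b, b.2, c, c.2, by push_cast; ring⟩
  · rintro ⟨b, hb, c, hc, e⟩
    exact ⟨⟨b, hb⟩, ⟨c, hc⟩, Subtype.ext (by push_cast; rw [e]; ring)⟩

lemma isUnit_of_notMem (h : Reg2 A x y) {a : A} (ha : a ∉ h.maxIdeal) : IsUnit a := by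
  rcases h.unit a a.2 with hu | hu
  · refine IsUnit.of_mul_eq_one ⟨_, hu⟩ (Subtype.ext ?_)
    have : (a : K) ≠ 0 := fun h0 => ha (by
      rw [show a = 0 from Subtype.ext h0]; exact zero_mem _)
    simp [this]
  · exact absurd (h.mem_maxIdeal.2 hu) ha

instance isMaximal_maxIdeal (h : Reg2 A x y) : h.maxIdeal.IsMaximal := by
  rw [Ideal.isMaximal_iff]
  refine ⟨fun h1 => ?_, fun J a hJ ha haJ => ?_⟩
  · obtain ⟨b, hb, c, hc, e⟩ := h.mem_maxIdeal.1 h1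
    exact h.one_ne b hb c hc (by simpa using e.symm)
  · exact (Ideal.eq_top_iff_one J).1 (Ideal.eq_top_of_isUnit_mem J haJ (h.isUnit_of_notMem ha))

lemma dvd_of_mul_eq_pow_mul (h : Reg2 A x y) {u v : K} (hu : u ∈ A) (hv : v ∈ A) (k : ℕ)
    (e : x * u = y ^ k * v) : ∃ w ∈ A, v = x * w := by
  induction k generalizing u with
  | zero => exact ⟨u, hu, by simpa using e.symm⟩
  | succ k ih =>
    obtain ⟨w, hw, h1, h2⟩ := h.reg u hu (y ^ k * v) (mul_mem (pow_mem h.y_mem k) hv)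
      (by rw [e]; ring)
    exact ih hw h2.symm

lemma pow_mul_eval_mem (h : Reg2 A x y) {n : ℕ} {P : A[X]} (hP : P.natDegree ≤ n) :
    x ^ n * P.eval₂ A.subtype (y / x) ∈ A := by
  rw [eval₂_eq_sum_range, Finset.mul_sum]
  refine sum_mem fun i hi => ?_
  have hi : i ≤ n := by simp at hi; omega
  obtain ⟨j, rfl⟩ := Nat.exists_eq_add_of_le hi
  have : x ^ (i + j) * (A.subtype (P.coeff i) * (y / x) ^ i) = P.coeff i * (x ^ j * y ^ i) := by
    have := h.x_ne
    rw [div_pow, pow_add]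
    field_simp
    simp [mul_comm]
  rw [this]
  exact mul_mem (P.coeff i).2 (mul_mem (pow_mem h.x_mem _) (pow_mem h.y_mem _))

lemma coeff_mem_of_eval_eq_zero (h : Reg2 A x y) (d : ℕ) (P : A[X]) (hP : P.natDegree ≤ d)
    (h0 : P.eval₂ A.subtype (y / x) = 0) (i : ℕ) : P.coeff i ∈ h.maxIdeal := by
  induction d generalizing P i with
  | zero =>
    obtain ⟨p, rfl⟩ := natDegree_eq_zero.1 (Nat.le_zero.1 hP)
    have : p = 0 := by simpa using h0
    simp [this]
  | succ d ih =>
    have hx := h.x_ne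
    set p := P.coeff (d + 1) with hp
    set Q := P.erase (d + 1) with hQ
    have hPQ : P = Q + monomial (d + 1) p := by rw [add_comm]; exact (monomial_add_erase P _).symm
    have hQd : Q.natDegree ≤ d := by
      refine natDegree_le_iff_coeff_eq_zero.2 fun N hN => ?_
      rw [hQ, coeff_erase]
      split_ifs with hN'
      · rfl
      · exact coeff_eq_zero_of_natDegree_lt (by omega)
    have ha := h.pow_mul_eval_mem hQd
    have e0 : Q.eval₂ A.subtype (y / x) + p * (y / x) ^ (d + 1) = 0 := by
      rw [← h0]
      conv_rhs => rw [hPQ]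
      simp [eval₂_add]
    have e1 : x * (-(x ^ d * Q.eval₂ A.subtype (y / x))) = y ^ (d + 1) * p := by
      have e2 : Q.eval₂ A.subtype (y / x) = -(p * (y / x) ^ (d + 1)) := by linear_combination e0
      rw [e2, div_pow]
      field_simp
      ring
    obtain ⟨w, hw, hpw⟩ := h.dvd_of_mul_eq_pow_mul (neg_mem ha) p.2 _ e1
    have hyw : (⟨y * w, mul_mem h.y_mem hw⟩ : A) ∈ h.maxIdeal :=
      h.mem_maxIdeal.2 ⟨0, zero_mem _, w, hw, by simp⟩
    have hpm : p ∈ h.maxIdeal :=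
      h.mem_maxIdeal.2 ⟨w, hw, 0, zero_mem _, by rw [hpw]; simp⟩
    have key := ih (Q + monomial d ⟨y * w, mul_mem h.y_mem hw⟩)
      (natDegree_add_le_of_degree_le hQd (natDegree_monomial_le _)) (by
        have : y * w * (y / x) ^ d = p * (y / x) ^ (d + 1) := by
          rw [hpw]; field_simp; rw [div_pow, div_pow]; field_simp; ring
        simp only [eval₂_add, eval₂_monomial]
        simp only [Subring.subtype_apply]
        rw [this, e0])
    have key' := key i
    rw [hPQ, coeff_add]
    rw [coeff_add] at key'
    refine add_mem ?_ ?_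
    · refine (Submodule.add_mem_iff_left _ ?_).1 key'
      rw [coeff_monomial]
      split_ifs
      · exact hyw
      · exact zero_mem _
    · rw [coeff_monomial]
      split_ifs
      · exact hpm
      · exact zero_mem _

/-- `S = A[y/x]`. -/
lemma coeff_mem_of_eval_eq (h : Reg2 A x y) {P : A[X]} {s : K} (hs : s ∈ adj A (y / x))
    (e : P.eval₂ A.subtype (y / x) = x * s) (i : ℕ) : P.coeff i ∈ h.maxIdeal := by
  obtain ⟨Q, rfl⟩ := hs
  have := h.coeff_mem_of_eval_eq_zero _ (P - C ⟨x, h.x_mem⟩ * Q) le_rfl (by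
    simp only [coe_eval₂RingHom] at e
    rw [eval₂_sub, eval₂_mul, e]; simp) i
  rw [coeff_sub, coeff_C_mul] at this
  refine (Submodule.sub_mem_iff_left _ ?_).1 this
  exact Ideal.mul_mem_right _ _ (Ideal.subset_span (by simp))

lemma x_mem_adj (h : Reg2 A x y) : x ∈ adj A (y / x) := le_adj _ _ h.x_mem

lemma exists_eval_eq_of_coeff_mem (h : Reg2 A x y) {P : A[X]}
    (hP : ∀ i, P.coeff i ∈ h.maxIdeal) :
    ∃ s ∈ adj A (y / x), P.eval₂ A.subtype (y / x) = x * s := by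
  have hx := h.x_ne
  refine ⟨x⁻¹ * P.eval₂ A.subtype (y / x), ?_, by field_simp⟩
  rw [eval₂_eq_sum_range, Finset.mul_sum]
  refine sum_mem fun i _ => ?_
  obtain ⟨b, hb, c, hc, e⟩ := h.mem_maxIdeal.1 (hP i)
  have : x⁻¹ * (A.subtype (P.coeff i) * (y / x) ^ i) = (b + c * (y / x)) * (y / x) ^ i := by
    simp only [Subring.subtype_apply, e]
    field_simp
  rw [this]
  have hz := self_mem_adj A (y / x)
  exact mul_mem (add_mem (le_adj _ _ hb) (mul_mem (le_adj _ _ hc) hz)) (pow_mem hz _)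

/-- Reduction of polynomials modulo the maximal ideal. -/
noncomputable abbrev red (h : Reg2 A x y) : A[X] →+* (A ⧸ h.maxIdeal)[X] :=
  mapRingHom (Ideal.Quotient.mk h.maxIdeal)

lemma red_eq_zero_iff (h : Reg2 A x y) {P : A[X]} :
    h.red P = 0 ↔ ∃ s ∈ adj A (y / x), P.eval₂ A.subtype (y / x) = x * s := by
  have h1 : h.red P = 0 ↔ ∀ i, P.coeff i ∈ h.maxIdeal := by
    rw [Polynomial.ext_iff]
    simp [Ideal.Quotient.eq_zero_iff_mem]
  rw [h1]
  exact ⟨h.exists_eval_eq_of_coeff_mem, fun ⟨s, hs, e⟩ => h.coeff_mem_of_eval_eq hs e⟩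

lemma not_mul_eq_one (h : Reg2 A x y) {s : K} (hs : s ∈ adj A (y / x)) : x * s ≠ 1 := by
  intro e
  have h1 := (h.red_eq_zero_iff (P := 1)).2 ⟨s, hs, by simp [e]⟩
  rw [map_one] at h1
  exact one_ne_zero h1

lemma dvd_or_dvd (h : Reg2 A x y) {s t u : K} (hs : s ∈ adj A (y / x))
    (ht : t ∈ adj A (y / x)) (hu : u ∈ adj A (y / x)) (e : s * t = x * u) :
    (∃ w ∈ adj A (y / x), s = x * w) ∨ (∃ w ∈ adj A (y / x), t = x * w) := by
  obtain ⟨P, rfl⟩ := hs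
  obtain ⟨Q, rfl⟩ := ht
  have := (h.red_eq_zero_iff (P := P * Q)).2 ⟨u, hu, by rw [eval₂_mul]; exact e⟩
  rw [map_mul, mul_eq_zero] at this
  exact this.imp h.red_eq_zero_iff.1 h.red_eq_zero_iff.1

lemma normal_adj (h : Reg2 A x y) : icl (adj A (y / x) : Set K) ≤ adj A (y / x) := by
  have hx := h.x_ne
  set S := adj A (y / x) with hS
  have hxS : x ∈ S := h.x_mem_adj
  have step : ∀ f ∈ icl (S : Set K), x * f ∈ S → f ∈ S := by
    intro f hf hxf
    obtain ⟨p, hp, hpf⟩ := mem_icl_coe.1 hf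
    obtain ⟨⟨w, hw⟩, e⟩ := dvd_pow_natDegree_of_aeval_eq_zero (A := K) hp ⟨x, hxS⟩ ⟨x * f, hxf⟩ f
      hpf (by rw [mul_comm]; rfl)
    have hprime : ∀ n, (∃ w ∈ S, (x * f) ^ n = x * w) → ∃ w ∈ S, x * f = x * w := by
      intro n
      induction n with
      | zero =>
        rintro ⟨w, hw, e⟩
        exact absurd (by simpa using e.symm) (h.not_mul_eq_one hw)
      | succ n ih =>
        rintro ⟨w, hw, e⟩
        rcases h.dvd_or_dvd (pow_mem hxf n) hxf hw (by rw [← e]; ring) with h1 | h1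
        · exact ih h1
        · exact h1
    obtain ⟨w', hw', e'⟩ := hprime _ ⟨w, hw, by simpa using congrArg Subtype.val e⟩
    rwa [mul_left_cancel₀ hx e']
  intro f hf
  obtain ⟨m, ⟨n, rfl⟩, hm⟩ := exists_mul_mem_icl (S := (A : Set K)) (T := S) (Submonoid.powers x)
    (by
      rintro _ ⟨n, rfl⟩
      exact pow_mem (Subring.subset_closure h.x_mem) n)
    (by
      rintro _ ⟨P, rfl⟩
      exact ⟨_, ⟨_, rfl⟩, Subring.subset_closure (h.pow_mul_eval_mem le_rfl)⟩) hf
  have hm : x ^ n * f ∈ S := le_adj _ _ (h.normal hm)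
  clear * - hm step hf hxS
  induction n with
  | zero => simpa using hm
  | succ n ih =>
    refine ih (step _ (mul_mem (pow_mem (subset_icl _ hxS) n) hf) ?_)
    convert hm using 1
    ring

end Reg2

end Reg2

section Split

open Polynomial

variable {K : Type*} [Field K]

/-- The localization `Aₚ` as a subring of `K`. -/
noncomputable def loc (A : Subring K) (p : Ideal A) [p.IsPrime] : Subring K :=
  (LocalSubring.ofPrime A p).toSubring

lemma mem_loc {A : Subring K} {p : Ideal A} [p.IsPrime] {z : K} :
    z ∈ loc A p ↔ ∃ s t : A, t ∉ p ∧ z = s / t := by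
  constructor
  · intro hz
    obtain ⟨⟨s, t⟩, e⟩ := IsLocalization.mk'_surjective p.primeCompl
      (⟨z, hz⟩ : (LocalSubring.ofPrime A p).toSubring)
    refine ⟨s, t, t.2, ?_⟩
    have ht : ((t : A) : K) ≠ 0 := fun h0 => t.2 (by
      rw [show (t : A) = 0 from Subtype.ext h0]; exact zero_mem _)
    have := congrArg Subtype.val ((IsLocalization.mk'_eq_iff_eq_mul).1 e)
    rw [eq_div_iff ht]
    exact this.symm
  · rintro ⟨s, t, ht, rfl⟩
    have ht0 : (t : K) ≠ 0 := fun h0 => ht (by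
      rw [show t = 0 from Subtype.ext h0]; exact zero_mem _)
    have : (s : K) / t = (IsLocalization.mk' (LocalSubring.ofPrime A p).toSubring s
        (⟨t, ht⟩ : p.primeCompl) : (LocalSubring.ofPrime A p).toSubring) := by
      rw [div_eq_iff ht0]
      exact (congrArg Subtype.val (IsLocalization.mk'_spec (LocalSubring.ofPrime A p).toSubring s
        (⟨t, ht⟩ : p.primeCompl))).symm
    rw [this]
    exact Subtype.property _

lemma le_loc (A : Subring K) (p : Ideal A) [p.IsPrime] : A ≤ loc A p :=
  LocalSubring.le_ofPrime A p

/-- The complement of `p` as a submonoid of `K`. -/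
def primeComplMap (A : Subring K) (p : Ideal A) [p.IsPrime] : Submonoid K :=
  p.primeCompl.map A.subtype

lemma exists_mul_mem_of_mem_loc {A : Subring K} {p : Ideal A} [p.IsPrime] {z : K}
    (hz : z ∈ loc A p) : ∃ m ∈ primeComplMap A p, m * z ∈ A := by
  obtain ⟨s, t, ht, rfl⟩ := mem_loc.1 hz
  have ht0 : (t : K) ≠ 0 := fun h0 => ht (by
    rw [show t = 0 from Subtype.ext h0]; exact zero_mem _)
  exact ⟨t, ⟨t, ht, rfl⟩, by rw [mul_div_cancel₀ _ ht0]; exact s.2⟩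

/-- Clearing denominators in an integral equation over `Aₚ[T]`. -/
lemma exists_mul_mem_icl_of_loc {A : Subring K} {p : Ideal A} [p.IsPrime] (T : Set K) {f : K}
    (hf : f ∈ icl (T ∪ loc A p)) : ∃ m ∈ primeComplMap A p, m * f ∈ icl (T ∪ A) := by
  refine exists_mul_mem_icl (T := T ∪ loc A p) (primeComplMap A p) ?_ ?_ hf
  · rintro _ ⟨t, -, rfl⟩
    exact Subring.subset_closure (Or.inr t.2)
  · rintro c (hc | hc)
    · exact ⟨1, Submonoid.one_mem _, by
        rw [one_mul]; exact Subring.subset_closure (Or.inl hc)⟩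
    · obtain ⟨m, hm, h⟩ := exists_mul_mem_of_mem_loc hc
      exact ⟨m, hm, Subring.subset_closure (Or.inr h)⟩

/-- Every element integral over `A[t, t⁻¹]` is a sum of an element integral over `A[t]` and an
element integral over `A[t⁻¹]`. -/
def Split (A : Subring K) (t : K) : Prop :=
  ∀ f ∈ icl ({t, t⁻¹} ∪ A : Set K), ∃ g ∈ icl ({t} ∪ A : Set K), ∃ h ∈ icl ({t⁻¹} ∪ A : Set K),
    f = g + h

lemma Split.inv {A : Subring K} {t : K} (h : Split A t) : Split A t⁻¹ := by
  intro f hf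
  rw [inv_inv, Set.pair_comm] at hf
  obtain ⟨g, hg, k, hk, e⟩ := h f hf
  exact ⟨k, hk, g, by rwa [inv_inv], by rw [e, add_comm]⟩

lemma Split.of_mem {A : Subring K} {t : K} (ht : t ∈ A) : Split A t := by
  intro f hf
  refine ⟨0, zero_mem _, f, icl_le_icl ?_ hf, by simp⟩
  rintro z ((rfl | rfl) | hz)
  · exact subset_icl _ (Or.inr ht)
  · exact subset_icl _ (Or.inl rfl)
  · exact subset_icl _ (Or.inr hz)

lemma Split.of_loc {A : Subring K} {t : K}
    (h : ∀ (p : Ideal A) [p.IsMaximal], Split (loc A p) t) : Split A t := by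
  intro f hf
  let D : Ideal A :=
    { carrier := {s | ∃ g ∈ icl ({t} ∪ A : Set K), ∃ h ∈ icl ({t⁻¹} ∪ A : Set K), s * f = g + h}
      add_mem' := by
        rintro a b ⟨g, hg, k, hk, e⟩ ⟨g', hg', k', hk', e'⟩
        exact ⟨g + g', add_mem hg hg', k + k', add_mem hk hk', by
          push_cast; rw [add_mul, e, e']; ring⟩
      zero_mem' := ⟨0, zero_mem _, 0, zero_mem _, by simp⟩
      smul_mem' := by
        rintro c a ⟨g, hg, k, hk, e⟩
        refine ⟨c * g, mul_mem (subset_icl _ (Or.inr c.2)) hg, c * k,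
          mul_mem (subset_icl _ (Or.inr c.2)) hk, ?_⟩
        simp only [smul_eq_mul, Subring.coe_mul]
        rw [mul_assoc, e]; ring }
  by_cases hD : D = ⊤
  · obtain ⟨g, hg, k, hk, e⟩ := (Ideal.eq_top_iff_one D).1 hD
    exact ⟨g, hg, k, hk, by simpa using e⟩
  · obtain ⟨p, hp, hDp⟩ := Ideal.exists_le_maximal D hD
    obtain ⟨g, hg, k, hk, e⟩ := h p f
      (icl_mono (Set.union_subset_union_right _ (le_loc A p)) hf)
    obtain ⟨_, ⟨m, hm, rfl⟩, hmg⟩ := exists_mul_mem_icl_of_loc _ hg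
    obtain ⟨_, ⟨n, hn, rfl⟩, hnk⟩ := exists_mul_mem_icl_of_loc _ hk
    refine absurd (hDp (?_ : m * n ∈ D)) (p.primeCompl.mul_mem hm hn)
    refine ⟨n * (m * g), mul_mem (subset_icl _ (Or.inr n.2)) hmg, m * (n * k),
      mul_mem (subset_icl _ (Or.inr m.2)) hnk, ?_⟩
    push_cast
    rw [e]; ring

namespace Reg2

variable {A : Subring K} {x y : K}

/-- The maximal ideals of `A[y/x]` over the exceptional divisor give regular local rings. -/
lemma exists_reg2_loc (h : Reg2 A x y) (p : Ideal (adj A (y / x))) [p.IsMaximal]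
    (hxp : (⟨x, h.x_mem_adj⟩ : adj A (y / x)) ∈ p) : ∃ f, Reg2 (loc (adj A (y / x)) p) x f := by
  have hx := h.x_ne
  let _ : Field (A ⧸ h.maxIdeal) := Ideal.Quotient.field _
  let ev : A[X] →+* (adj A (y / x)) := (eval₂RingHom A.subtype (y / x)).rangeRestrict
  have hev : ∀ P, ((ev P : (adj A (y / x))) : K) = P.eval₂ A.subtype (y / x) := fun P => rfl
  have hsurj : Function.Surjective h.red := map_surjective _ Ideal.Quotient.mk_surjective
  obtain ⟨g, hg⟩ := (IsPrincipalIdealRing.principal (Ideal.map h.red (p.comap ev))).principal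
  have hgm : g ∈ Ideal.map h.red (p.comap ev) := by
    rw [hg]; exact Submodule.mem_span_singleton_self g
  obtain ⟨F, hF, rfl⟩ := (Ideal.mem_map_iff_of_surjective _ hsurj).1 hgm
  have hFp : ev F ∈ p := hF
  have hgen : ∀ s : (adj A (y / x)), s ∈ p → ∃ u ∈ (adj A (y / x)), ∃ v ∈ (adj A (y / x)),
      (s : K) = x * u + ev F * v := by
    rintro ⟨_, P, rfl⟩ hs
    have : h.red P ∈ Ideal.map h.red (p.comap ev) := Ideal.mem_map_of_mem _ hs
    rw [hg] at this
    obtain ⟨c, hc⟩ := Submodule.mem_span_singleton.1 this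
    obtain ⟨G, rfl⟩ := hsurj c
    obtain ⟨u, hu, e⟩ := (h.red_eq_zero_iff (P := P - G * F)).1 (by
      rw [map_sub, map_mul, ← hc, smul_eq_mul, sub_self])
    refine ⟨u, hu, _, (ev G).2, ?_⟩
    rw [eval₂_sub, eval₂_mul] at e
    simp only [coe_eval₂RingHom, hev]
    linear_combination e
  have hndvd : ¬ ∃ u ∈ (adj A (y / x)), (ev F : K) = x * u := by
    intro hu
    have hpx : ∀ s : (adj A (y / x)), s ∈ p → ∃ u ∈ (adj A (y / x)), (s : K) = x * u := by
      intro s hs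
      obtain ⟨u, hu', v, hv, e⟩ := hgen s hs
      obtain ⟨w, hw, e'⟩ := hu
      exact ⟨u + w * v, add_mem hu' (mul_mem hw hv), by rw [e, e']; ring⟩
    have hXp : ev X ∉ p := by
      intro hX
      obtain ⟨u, hu', e⟩ := hpx _ hX
      have := h.red_eq_zero_iff.2 ⟨u, hu', e⟩
      simp at this
    obtain ⟨⟨_, Q, rfl⟩, hQ⟩ := Ideal.IsMaximal.exists_inv (I := p) inferInstance hXp
    obtain ⟨i, hi, hQ⟩ := hQ
    obtain ⟨u, hu', e⟩ := hpx _ hi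
    have hr := (h.red_eq_zero_iff (P := 1 - Q * X)).2 ⟨u, hu', by
      have := congrArg Subtype.val hQ
      rw [← e, eval₂_sub, eval₂_mul]
      simp only [Subring.coe_add, Subring.coe_mul, coe_eval₂RingHom, hev, Subring.coe_one] at this
      rw [eval₂_one]
      linear_combination -this⟩
    have := congrArg (fun q => q.coeff 0) hr
    simp at this
  refine ⟨ev F, ?_⟩
  have hp1 : (1 : (adj A (y / x))) ∉ p :=
    (Ideal.ne_top_iff_one p).1 (Ideal.IsMaximal.ne_top inferInstance)
  have hne : ∀ t : (adj A (y / x)), t ∉ p → (t : K) ≠ 0 := fun t ht h0 => ht (by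
    rw [show t = 0 from Subtype.ext h0]; exact zero_mem _)
  have hFne : (ev F : K) ≠ 0 := fun h0 => hndvd ⟨0, zero_mem _, by rw [h0]; simp⟩
  refine ⟨le_loc _ _ h.x_mem_adj, le_loc _ _ (ev F).2, hx, hFne, ?_, ?_, ?_, ?_⟩
  · intro a ha
    obtain ⟨s, t, ht, rfl⟩ := mem_loc.1 ha
    have ht0 := hne t ht
    by_cases hs : s ∈ p
    · right
      obtain ⟨u, hu, v, hv, e⟩ := hgen s hs
      exact ⟨u / t, mem_loc.2 ⟨⟨u, hu⟩, t, ht, rfl⟩, v / t, mem_loc.2 ⟨⟨v, hv⟩, t, ht, rfl⟩, by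
        rw [e]; field_simp⟩
    · left
      exact mem_loc.2 ⟨t, s, hs, by simp⟩
  · intro b hb c hc e
    obtain ⟨s, t, ht, rfl⟩ := mem_loc.1 hb
    obtain ⟨s', t', ht', rfl⟩ := mem_loc.1 hc
    have ht0 := hne t ht
    have ht0' := hne t' ht'
    refine p.primeCompl.mul_mem ht ht' ?_
    have : t * t' = ⟨x, h.x_mem_adj⟩ * (s * t') + ev F * (s' * t) := by
      refine Subtype.ext ?_
      push_cast
      field_simp at e
      linear_combination -e
    rw [this]
    exact add_mem (Ideal.mul_mem_right _ _ hxp) (Ideal.mul_mem_right _ _ hFp)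
  · intro u hu v hv e
    obtain ⟨s, t, ht, rfl⟩ := mem_loc.1 hu
    obtain ⟨s', t', ht', rfl⟩ := mem_loc.1 hv
    have ht0 := hne t ht
    have ht0' := hne t' ht'
    have e1 : (ev F : K) * (s' * t) = x * (s * t') := by
      field_simp at e
      linear_combination -e
    rcases h.dvd_or_dvd (ev F).2 (mul_mem s'.2 t.2) (mul_mem s.2 t'.2) e1 with h1 | h1
    · exact absurd h1 hndvd
    · obtain ⟨w, hw, e2⟩ := h1
      rcases h.dvd_or_dvd s'.2 t.2 hw e2 with ⟨w, hw, e3⟩ | ⟨w, hw, e3⟩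
      · refine ⟨w / t', mem_loc.2 ⟨⟨w, hw⟩, t', ht', rfl⟩, ?_, by rw [e3]; ring⟩
        rw [e3] at e1
        have e4 : (ev F : K) * (w * t) = s * t' := by
          refine mul_left_cancel₀ hx ?_
          linear_combination e1
        field_simp
        linear_combination -e4
      · refine absurd ?_ ht
        have : t = ⟨x, h.x_mem_adj⟩ * ⟨w, hw⟩ := Subtype.ext e3
        rw [this]
        exact Ideal.mul_mem_right _ _ hxp
  · intro f hf
    obtain ⟨_, ⟨m, hm, rfl⟩, hmf⟩ := exists_mul_mem_icl_of_loc (A := (adj A (y / x))) (p := p) ∅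
      (by simpa using hf)
    have := h.normal_adj (by simpa using hmf)
    refine mem_loc.2 ⟨⟨_, this⟩, m, hm, ?_⟩
    have := hne m hm
    field_simp

end Reg2

end Split

section ChainLT

/-- Every strict chain of ideals containing `I` has fewer than `N` steps. -/
def ChainLT {A : Type*} [CommRing A] (I : Ideal A) (N : ℕ) : Prop :=
  ∀ p : LTSeries (Set.Ici I), p.length < N

lemma ChainLT.exists_pow_mem {A : Type*} [CommRing A] {I : Ideal A} {N : ℕ} (h : ChainLT I N)
    {x : A} (hx : ∀ a, IsUnit (1 - x * a)) : x ^ N ∈ I := by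
  by_contra hN
  have hmono : ∀ k < N, I ⊔ Ideal.span {x ^ (k + 1)} < I ⊔ Ideal.span {x ^ k} := by
    intro k hk
    refine lt_of_le_not_ge (sup_le_sup_left ?_ _) fun hle => hN ?_
    · rw [Ideal.span_singleton_le_span_singleton]
      exact pow_dvd_pow x (Nat.le_succ k)
    · have : x ^ k ∈ I ⊔ Ideal.span {x ^ (k + 1)} :=
        hle (Ideal.mem_sup_right (Ideal.mem_span_singleton_self _))
      obtain ⟨i, hi, j, hj, e⟩ := Submodule.mem_sup.1 this
      obtain ⟨a, rfl⟩ := Ideal.mem_span_singleton.1 hj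
      have : x ^ k * (1 - x * a) ∈ I := by
        have : x ^ k * (1 - x * a) = i := by
          rw [← sub_eq_zero] at e ⊢
          rw [← neg_eq_zero, ← e]; ring
        rwa [this]
      have := (Ideal.mul_unit_mem_iff_mem I (hx a)).1 this
      exact Ideal.pow_mem_of_pow_mem _ this hk.le
  let s : LTSeries (Set.Ici I) :=
    { length := N
      toFun := fun i => ⟨I ⊔ Ideal.span {x ^ (N - i : ℕ)}, Set.mem_Ici.2 le_sup_left⟩
      step := by
        intro i
        have := hmono (N - (i + 1)) (by omega)
        rw [show N - (i + 1) + 1 = N - i by omega] at this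
        exact this }
  exact lt_irrefl _ (h s)

lemma ChainLT.of_strictMono {A B : Type*} [CommRing A] [CommRing B] {I : Ideal A} {J : Ideal B}
    {N : ℕ} (h : ChainLT I (N + 1)) (F : Set.Ici J → Set.Ici I) (hF : StrictMono F)
    (hlt : ∀ L, (F L : Ideal A) ≠ ⊤) : ChainLT J N := by
  intro p
  have := h ((p.map F hF).snoc ⟨⊤, Set.mem_Ici.2 le_top⟩ (lt_top_iff_ne_top.2 (hlt _)))
  simp at this
  omega

end ChainLT

section Split

open Polynomial

variable {K : Type*} [Field K]

namespace Reg2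

variable {A : Subring K} {x y : K}

lemma exists_eval_eq_of_coeff_mem_natDegree (h : Reg2 A x y) {P : A[X]} {n : ℕ}
    (hn : P.natDegree ≤ n) (hP : ∀ i, P.coeff i ∈ h.maxIdeal) :
    ∃ Q : A[X], Q.natDegree ≤ n + 1 ∧
      P.eval₂ A.subtype (y / x) = x * Q.eval₂ A.subtype (y / x) := by
  have hx := h.x_ne
  choose b hb c hc e using fun i => h.mem_maxIdeal.1 (hP i)
  refine ⟨∑ i ∈ Finset.range (P.natDegree + 1),
    (C ⟨b i, hb i⟩ + C ⟨c i, hc i⟩ * X) * X ^ i, ?_, ?_⟩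
  · refine natDegree_sum_le_of_forall_le _ _ fun i hi => ?_
    have : i ≤ n := by simp at hi; omega
    have h1 : (C (⟨b i, hb i⟩ : A) + C (⟨c i, hc i⟩ : A) * X).natDegree ≤ 1 := by compute_degree
    have h2 : (X ^ i : A[X]).natDegree ≤ i := natDegree_X_pow_le i
    have := natDegree_mul_le_of_le h1 h2
    omega
  · rw [eval₂_eq_sum_range, eval₂_finsetSum, Finset.mul_sum]
    refine Finset.sum_congr rfl fun i _ => ?_
    simp only [eval₂_mul, eval₂_add, eval₂_C, eval₂_X_pow, eval₂_X, Subring.subtype_apply, e]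
    field_simp

lemma isUnit_one_sub_x_mul (h : Reg2 A x y) (a : A) : IsUnit (1 - ⟨x, h.x_mem⟩ * a) := by
  refine h.isUnit_of_notMem fun hm => ?_
  obtain ⟨b, hb, c, hc, e⟩ := h.mem_maxIdeal.1 hm
  refine h.one_ne (b + a) (add_mem hb a.2) c hc ?_
  push_cast at e
  linear_combination -e

/-- The content of `a, b` along the exceptional divisor of the quadratic transform. -/
lemma exists_strict_transform (h : Reg2 A x y) {a b : A} {M : ℕ}
    (hM : (⟨x, h.x_mem⟩ : A) ^ M ∈ Ideal.span {a, b}) (hab : Ideal.span {a, b} ≠ ⊤) :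
    ∃ (n : ℕ) (P Q : A[X]), P.natDegree ≤ n + 1 ∧ Q.natDegree ≤ n + 1 ∧
      (a : K) = x ^ (n + 1) * P.eval₂ A.subtype (y / x) ∧
      (b : K) = x ^ (n + 1) * Q.eval₂ A.subtype (y / x) ∧ (h.red P ≠ 0 ∨ h.red Q ≠ 0) := by
  classical
  have hx := h.x_ne
  let T : ℕ → Prop := fun n => ∃ P Q : A[X], P.natDegree ≤ n ∧ Q.natDegree ≤ n ∧
      (a : K) = x ^ n * P.eval₂ A.subtype (y / x) ∧ (b : K) = x ^ n * Q.eval₂ A.subtype (y / x)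
  have hstep : ∀ n, ∀ P Q : A[X], P.natDegree ≤ n → Q.natDegree ≤ n →
      (a : K) = x ^ n * P.eval₂ A.subtype (y / x) → (b : K) = x ^ n * Q.eval₂ A.subtype (y / x) →
      (∀ i, P.coeff i ∈ h.maxIdeal) → (∀ i, Q.coeff i ∈ h.maxIdeal) → T (n + 1) := by
    intro n P Q hP hQ ea eb h1 h2
    obtain ⟨P', hP', e1⟩ := h.exists_eval_eq_of_coeff_mem_natDegree hP h1
    obtain ⟨Q', hQ', e2⟩ := h.exists_eval_eq_of_coeff_mem_natDegree hQ h2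
    exact ⟨P', Q', hP', hQ', by rw [ea, e1]; ring, by rw [eb, e2]; ring⟩
  have hle : Ideal.span {a, b} ≤ h.maxIdeal := by
    intro c hc
    by_contra hcm
    exact hab (Ideal.eq_top_of_isUnit_mem _ hc (h.isUnit_of_notMem hcm))
  have hT1 : T 1 := by
    refine hstep 0 (C a) (C b) (by simp) (by simp) (by simp) (by simp) (fun i => ?_) (fun i => ?_)
    · rw [coeff_C]
      split_ifs
      · exact hle (Ideal.subset_span (by simp))
      · exact zero_mem _
    · rw [coeff_C]
      split_ifs
      · exact hle (Ideal.subset_span (by simp))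
      · exact zero_mem _
  have hbound : ∀ n, T n → n ≤ M := by
    rintro n ⟨P, Q, -, -, ea, eb⟩
    by_contra hn
    obtain ⟨k, hk⟩ := Nat.exists_eq_add_of_lt (not_le.1 hn)
    obtain ⟨u, v, e⟩ := Ideal.mem_span_pair.1 hM
    have e := congrArg Subtype.val e
    push_cast at e
    refine h.not_mul_eq_one (s := x ^ k * (u * P.eval₂ A.subtype (y / x) +
      v * Q.eval₂ A.subtype (y / x))) ?_ (mul_left_cancel₀ (pow_ne_zero M hx) ?_)
    · exact mul_mem (pow_mem h.x_mem_adj k) (add_mem (mul_mem (le_adj _ _ u.2) ⟨P, rfl⟩)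
        (mul_mem (le_adj _ _ v.2) ⟨Q, rfl⟩))
    · rw [ea, eb, hk] at e
      linear_combination e
  have hM1 : 1 ≤ M := hbound 1 hT1
  have hmax := Nat.findGreatest_spec (P := T) hM1 hT1
  have hnext : ¬ T (Nat.findGreatest T M + 1) := fun hT => by
    have h1 := hbound _ hT
    have := Nat.le_findGreatest h1 hT
    omega
  have hpos : 1 ≤ Nat.findGreatest T M := Nat.le_findGreatest hM1 hT1
  obtain ⟨n, hn⟩ := Nat.exists_eq_add_of_le' hpos
  rw [hn] at hmax hnext
  obtain ⟨P, Q, hP, hQ, ea, eb⟩ := hmax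
  refine ⟨n, P, Q, hP, hQ, ea, eb, ?_⟩
  by_contra hcon
  push Not at hcon
  refine hnext (hstep _ P Q hP hQ ea eb (fun i => ?_) (fun i => ?_))
  · have := congrArg (fun q => q.coeff i) hcon.1
    simpa [Ideal.Quotient.eq_zero_iff_mem] using this
  · have := congrArg (fun q => q.coeff i) hcon.2
    simpa [Ideal.Quotient.eq_zero_iff_mem] using this

lemma exists_division (h : Reg2 A x y) {n : ℕ} {P : A[X]} (hP : P.natDegree ≤ n)
    (hP0 : h.red P ≠ 0) {s : K} (hs : s ∈ adj A (y / x)) :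
    ∃ u ∈ adj A (y / x), ∃ W : A[X], W.natDegree ≤ n ∧ ∃ s' ∈ adj A (y / x),
      s = u * P.eval₂ A.subtype (y / x) + W.eval₂ A.subtype (y / x) + x * s' := by
  let _ : Field (A ⧸ h.maxIdeal) := Ideal.Quotient.field _
  obtain ⟨G, rfl⟩ := hs
  have hsurj : Function.Surjective h.red := map_surjective _ Ideal.Quotient.mk_surjective
  obtain ⟨q, hq⟩ := hsurj (h.red G / h.red P)
  obtain ⟨W, hW, hWd⟩ := exists_natDegree_eq_of_mem_lifts
    (mem_lifts_of_surjective Ideal.Quotient.mk_surjective (h.red G % h.red P))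
  have hWd' : W.natDegree ≤ n := by
    rw [hWd]
    exact (natDegree_le_natDegree (degree_mod_lt _ hP0).le).trans (natDegree_map_le.trans hP)
  obtain ⟨s', hs', e⟩ := (h.red_eq_zero_iff (P := G - q * P - W)).1 (by
    rw [map_sub, map_sub, map_mul, hq]
    have : h.red W = h.red G % h.red P := hW
    rw [this]
    have := EuclideanDomain.div_add_mod (h.red G) (h.red P)
    linear_combination -this)
  refine ⟨_, ⟨q, rfl⟩, W, hWd', s', hs', ?_⟩
  rw [eval₂_sub, eval₂_sub, eval₂_mul] at e
  simp only [coe_eval₂RingHom]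
  linear_combination e

lemma exists_remainder (h : Reg2 A x y) {n M : ℕ} {P Q : A[X]} (hP : P.natDegree ≤ n)
    (hQ : Q.natDegree ≤ n) (hPQ : h.red P ≠ 0 ∨ h.red Q ≠ 0)
    (hM : ∃ u ∈ adj A (y / x), ∃ v ∈ adj A (y / x), x ^ M =
      u * P.eval₂ A.subtype (y / x) + v * Q.eval₂ A.subtype (y / x))
    {s : K} (hs : s ∈ adj A (y / x)) :
    ∃ u ∈ adj A (y / x), ∃ v ∈ adj A (y / x), ∃ W : A[X], W.natDegree ≤ n ∧
      s = u * P.eval₂ A.subtype (y / x) + v * Q.eval₂ A.subtype (y / x) +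
        W.eval₂ A.subtype (y / x) := by
  have key : ∀ k, ∃ u ∈ adj A (y / x), ∃ v ∈ adj A (y / x), ∃ W : A[X], W.natDegree ≤ n ∧
      ∃ s' ∈ adj A (y / x), s = u * P.eval₂ A.subtype (y / x) + v * Q.eval₂ A.subtype (y / x) +
        W.eval₂ A.subtype (y / x) + x ^ k * s' := by
    intro k
    induction k with
    | zero =>
      exact ⟨0, zero_mem _, 0, zero_mem _, 0, by simp, s, hs, by simp⟩
    | succ k ih =>
      obtain ⟨u, hu, v, hv, W, hW, s', hs', e⟩ := ih
      have hxk : x ^ k ∈ adj A (y / x) := pow_mem h.x_mem_adj k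
      have hdeg : ∀ W' : A[X], W'.natDegree ≤ n →
          (W + C (⟨x ^ k, pow_mem h.x_mem k⟩ : A) * W').natDegree ≤ n := fun W' hW' =>
        natDegree_add_le_of_degree_le hW ((natDegree_C_mul_le _ _).trans hW')
      rcases hPQ with h0 | h0
      · obtain ⟨u', hu', W', hW', s'', hs'', e'⟩ := h.exists_division hP h0 hs'
        refine ⟨u + x ^ k * u', add_mem hu (mul_mem hxk hu'), v, hv, _, hdeg W' hW', s'', hs'', ?_⟩
        rw [e, e']
        simp only [eval₂_add, eval₂_mul, eval₂_C, Subring.subtype_apply]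
        ring
      · obtain ⟨u', hu', W', hW', s'', hs'', e'⟩ := h.exists_division hQ h0 hs'
        refine ⟨u, hu, v + x ^ k * u', add_mem hv (mul_mem hxk hu'), _, hdeg W' hW', s'', hs'', ?_⟩
        rw [e, e']
        simp only [eval₂_add, eval₂_mul, eval₂_C, Subring.subtype_apply]
        ring
  obtain ⟨u, hu, v, hv, W, hW, s', hs', e⟩ := key M
  obtain ⟨u', hu', v', hv', e'⟩ := hM
  refine ⟨u + u' * s', add_mem hu (mul_mem hu' hs'), v + v' * s', add_mem hv (mul_mem hv' hs'),
    W, hW, ?_⟩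
  rw [e, e']
  ring

end Reg2

lemma Split.of_div_mem {A : Subring K} {a b : K} (h : b / a ∈ A ∨ a / b ∈ A) :
    Split A (b / a) := by
  rcases h with h | h
  · exact Split.of_mem h
  · rw [← inv_div]; exact (Split.of_mem h).inv

namespace Reg2

variable {A : Subring K} {x y : K}

/-- Passing to a point of the exceptional divisor shortens chains of ideals. -/
lemma chainLT_loc (h : Reg2 A x y) {a b : A} {n N M : ℕ} (hN : ChainLT (Ideal.span {a, b}) (N + 1))
    {P Q : A[X]} (hP : P.natDegree ≤ n + 1) (hQ : Q.natDegree ≤ n + 1)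
    (ea : (a : K) = x ^ (n + 1) * P.eval₂ A.subtype (y / x))
    (eb : (b : K) = x ^ (n + 1) * Q.eval₂ A.subtype (y / x))
    (hPQ : h.red P ≠ 0 ∨ h.red Q ≠ 0)
    (hM : ∃ u ∈ adj A (y / x), ∃ v ∈ adj A (y / x), x ^ M =
      u * P.eval₂ A.subtype (y / x) + v * Q.eval₂ A.subtype (y / x))
    (p : Ideal (adj A (y / x))) [p.IsPrime]
    (hxp : (⟨x, h.x_mem_adj⟩ : adj A (y / x)) ∈ p) (a' b' : loc (adj A (y / x)) p)
    (ea' : (a' : K) = P.eval₂ A.subtype (y / x)) (eb' : (b' : K) = Q.eval₂ A.subtype (y / x)) :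
    ChainLT (Ideal.span {a', b'}) N := by
  have hx := h.x_ne
  have hxn : x ^ (n + 1) ≠ 0 := pow_ne_zero _ hx
  let G : Ideal (loc (adj A (y / x)) p) → Ideal A := fun L =>
    { carrier := {f | ∃ l ∈ L, (f : K) = x ^ (n + 1) * l}
      add_mem' := by
        rintro f g ⟨l, hl, e⟩ ⟨m, hm, e'⟩
        exact ⟨l + m, add_mem hl hm, by push_cast; rw [e, e']; ring⟩
      zero_mem' := ⟨0, zero_mem _, by simp⟩
      smul_mem' := by
        rintro c f ⟨l, hl, e⟩
        refine ⟨⟨c, le_loc _ _ (le_adj _ _ c.2)⟩ * l, Ideal.mul_mem_left _ _ hl, ?_⟩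
        simp only [smul_eq_mul, Subring.coe_mul]
        rw [e]; ring }
  have hG : ∀ L : Set.Ici (Ideal.span {a', b'}), Ideal.span {a, b} ≤ G L := by
    intro L
    rw [Ideal.span_le]
    rintro z (rfl | rfl)
    · exact ⟨a', L.2 (Ideal.subset_span (by simp)), by rw [ea, ea']⟩
    · exact ⟨b', L.2 (Ideal.subset_span (by simp)), by rw [eb, eb']⟩
  refine hN.of_strictMono (fun L => ⟨G L, hG L⟩) ?_ ?_
  · intro L L' hlt
    have hle : (L : Ideal (loc (adj A (y / x)) p)) ≤ L' := hlt.le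
    obtain ⟨l, hl', hl⟩ := SetLike.exists_of_lt
      (show (L : Ideal (loc (adj A (y / x)) p)) < L' from hlt)
    have hGle : G L ≤ G L' := fun f ⟨l, hl, e⟩ => ⟨l, hle hl, e⟩
    refine lt_of_le_not_ge hGle fun hge => hl ?_
    obtain ⟨s, t, ht, e⟩ := mem_loc.1 l.2
    have ht0 : (t : K) ≠ 0 := fun h0 => ht (by
      rw [show t = 0 from Subtype.ext h0]; exact zero_mem _)
    obtain ⟨u, hu, v, hv, W, hW, es⟩ := h.exists_remainder hP hQ hPQ hM s.2
    have hWS : W.eval₂ A.subtype (y / x) ∈ loc (adj A (y / x)) p := le_loc _ _ ⟨W, rfl⟩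
    have hsp : (⟨u, le_loc _ _ hu⟩ * a' + ⟨v, le_loc _ _ hv⟩ * b' : loc (adj A (y / x)) p) ∈
        (L : Ideal (loc (adj A (y / x)) p)) :=
      L.2 (Ideal.mem_span_pair.2 ⟨_, _, rfl⟩)
    have htl : (⟨t, le_loc _ _ t.2⟩ * l : loc (adj A (y / x)) p) =
        (⟨u, le_loc _ _ hu⟩ * a' + ⟨v, le_loc _ _ hv⟩ * b') + ⟨_, hWS⟩ := by
      refine Subtype.ext ?_
      push_cast
      rw [e, mul_div_cancel₀ _ ht0, es, ea', eb']
    have hWL' : (⟨_, hWS⟩ : loc (adj A (y / x)) p) ∈ (L' : Ideal (loc (adj A (y / x)) p)) := by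
      rw [← Submodule.add_mem_iff_right _ (hle hsp), ← htl]
      exact Ideal.mul_mem_left _ _ hl'
    obtain ⟨w, hw, ew⟩ := hge (show (⟨_, h.pow_mul_eval_mem hW⟩ : A) ∈ G L' from ⟨_, hWL', rfl⟩)
    have hWL : (⟨_, hWS⟩ : loc (adj A (y / x)) p) ∈ (L : Ideal (loc (adj A (y / x)) p)) := by
      rwa [show (⟨_, hWS⟩ : loc (adj A (y / x)) p) = w from
        Subtype.ext (mul_left_cancel₀ hxn ew)]
    have htL := (Submodule.add_mem _ hsp hWL)
    rw [← htl] at htL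
    have : l = ⟨1 / t, mem_loc.2 ⟨1, t, ht, by simp⟩⟩ * (⟨t, le_loc _ _ t.2⟩ * l) := by
      refine Subtype.ext ?_
      push_cast
      field_simp
    rw [this]
    exact Ideal.mul_mem_left _ _ htL
  · intro L htop
    obtain ⟨l, -, e⟩ := (Ideal.eq_top_iff_one _).1 htop
    obtain ⟨s, t, ht, e'⟩ := mem_loc.1 l.2
    have ht0 : (t : K) ≠ 0 := fun h0 => ht (by
      rw [show t = 0 from Subtype.ext h0]; exact zero_mem _)
    refine ht ?_
    have : t = ⟨x, h.x_mem_adj⟩ * (⟨x, h.x_mem_adj⟩ ^ n * s) := by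
      refine Subtype.ext ?_
      push_cast at e ⊢
      rw [e'] at e
      field_simp at e
      linear_combination e
    rw [this]
    exact Ideal.mul_mem_right _ _ hxp

lemma split_adj (h : Reg2 A x y) {N : ℕ}
    (ih : ∀ (B : Subring K) (u v : K), Reg2 B u v → ∀ a b : B, a ≠ 0 → b ≠ 0 →
      ChainLT (Ideal.span {a, b}) N → Split B (b / a))
    {a b : A} (ha : a ≠ 0) (hb : b ≠ 0) (hN : ChainLT (Ideal.span {a, b}) (N + 1))
    (hab : Ideal.span {a, b} ≠ ⊤) : Split (adj A (y / x)) (b / a) := by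
  have hx := h.x_ne
  have hM := hN.exists_pow_mem h.isUnit_one_sub_x_mul
  obtain ⟨n, P, Q, hP, hQ, ea, eb, hPQ⟩ := h.exists_strict_transform hM hab
  set α := P.eval₂ A.subtype (y / x) with hα
  set β := Q.eval₂ A.subtype (y / x) with hβ
  have hα0 : α ≠ 0 := fun h0 => ha (Subtype.ext (by rw [ea, h0]; simp))
  have hβ0 : β ≠ 0 := fun h0 => hb (Subtype.ext (by rw [eb, h0]; simp))
  have hba : (b : K) / a = β / α := by
    rw [ea, eb, mul_div_mul_left _ _ (pow_ne_zero _ hx)]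
  have hM' : ∃ u ∈ adj A (y / x), ∃ v ∈ adj A (y / x), x ^ (N + 1) = u * α + v * β := by
    obtain ⟨u, v, e⟩ := Ideal.mem_span_pair.1 hM
    refine ⟨u * x ^ (n + 1), mul_mem (le_adj _ _ u.2) (pow_mem h.x_mem_adj _), v * x ^ (n + 1),
      mul_mem (le_adj _ _ v.2) (pow_mem h.x_mem_adj _), ?_⟩
    have e := congrArg Subtype.val e
    push_cast at e
    rw [← e, ea, eb]
    ring
  rw [hba]
  refine Split.of_loc fun p hp => ?_
  have hαS : α ∈ adj A (y / x) := ⟨P, rfl⟩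
  have hβS : β ∈ adj A (y / x) := ⟨Q, rfl⟩
  by_cases hxp : (⟨x, h.x_mem_adj⟩ : adj A (y / x)) ∈ p
  · obtain ⟨f, hf⟩ := h.exists_reg2_loc p hxp
    exact ih _ _ _ hf ⟨α, le_loc _ _ hαS⟩ ⟨β, le_loc _ _ hβS⟩
      (fun h0 => hα0 (congrArg Subtype.val h0)) (fun h0 => hβ0 (congrArg Subtype.val h0))
      (h.chainLT_loc hN hP hQ ea eb hPQ hM' p hxp _ _ rfl rfl)
  · refine Split.of_div_mem ?_
    by_cases hαp : (⟨α, hαS⟩ : adj A (y / x)) ∈ p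
    · right
      refine mem_loc.2 ⟨⟨α, hαS⟩, ⟨β, hβS⟩, fun hβp => ?_, rfl⟩
      obtain ⟨u, hu, v, hv, e⟩ := hM'
      refine hxp (hp.isPrime.mem_of_pow_mem (N + 1) ?_)
      have : (⟨x, h.x_mem_adj⟩ : adj A (y / x)) ^ (N + 1) =
          ⟨u, hu⟩ * ⟨α, hαS⟩ + ⟨v, hv⟩ * ⟨β, hβS⟩ := Subtype.ext (by push_cast; exact e)
      rw [this]
      exact add_mem (Ideal.mul_mem_left _ _ hαp) (Ideal.mul_mem_left _ _ hβp)
    · left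
      exact mem_loc.2 ⟨⟨β, hβS⟩, ⟨α, hαS⟩, hαp, rfl⟩

/-- An element integral over both charts of the quadratic transform is a sum of elements of the
charts. -/
lemma exists_add_of_mem_icl (h : Reg2 A x y) {u : K}
    (hu : u ∈ icl ((adj A (y / x) : Set K) ∪ adj A (x / y))) :
    ∃ u₁ ∈ adj A (y / x), ∃ u₂ ∈ adj A (x / y), u = u₁ + u₂ := by
  have hx := h.x_ne
  have hy := h.y_ne
  set z := y / x with hz
  have hz0 : z ≠ 0 := div_ne_zero hy hx
  have hzinv : x / y = z⁻¹ := by rw [hz, inv_div]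
  have hzS := self_mem_adj A z
  obtain ⟨_, ⟨m, rfl⟩, hm⟩ := exists_mul_mem_icl (S := (adj A z : Set K)) (Submonoid.powers z)
    (by
      rintro _ ⟨n, rfl⟩
      exact pow_mem (Subring.subset_closure hzS) n)
    (by
      rintro c (hc | ⟨P, rfl⟩)
      · exact ⟨1, Submonoid.one_mem _, by rw [one_mul]; exact Subring.subset_closure hc⟩
      · refine ⟨_, ⟨P.natDegree, rfl⟩, Subring.subset_closure ?_⟩
        simp only [coe_eval₂RingHom]
        rw [eval₂_eq_sum_range, Finset.mul_sum]
        refine sum_mem fun i hi => ?_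
        obtain ⟨j, hj⟩ := Nat.exists_eq_add_of_le (show i ≤ P.natDegree by simp at hi; omega)
        have : z ^ P.natDegree * (A.subtype (P.coeff i) * (x / y) ^ i) = P.coeff i * z ^ j := by
          rw [hj, hzinv, inv_pow, pow_add]
          simp only [Subring.subtype_apply]
          field_simp
        rw [this]
        exact mul_mem (le_adj _ _ (P.coeff i).2) (pow_mem hzS j)) hu
  obtain ⟨P, hP⟩ := h.normal_adj hm
  simp only [coe_eval₂RingHom] at hP
  have hsum : u = ∑ i ∈ Finset.range (P.natDegree + 1), (P.coeff i : K) * (z ^ i * (z⁻¹) ^ m) := by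
    have : u = (z⁻¹) ^ m * P.eval₂ A.subtype z := by
      rw [hP, inv_pow]
      field_simp
    rw [this, eval₂_eq_sum_range, Finset.mul_sum]
    refine Finset.sum_congr rfl fun i _ => ?_
    simp only [Subring.subtype_apply]
    ring
  have hterm : ∀ i, (z ^ i * (z⁻¹) ^ m ∈ adj A z) ∨ (z ^ i * (z⁻¹) ^ m ∈ adj A (x / y)) := by
    intro i
    rcases le_total m i with hi | hi
    · left
      obtain ⟨j, rfl⟩ := Nat.exists_eq_add_of_le hi
      have : z ^ (m + j) * z⁻¹ ^ m = z ^ j := by rw [pow_add, inv_pow]; field_simp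
      rw [this]
      exact pow_mem hzS _
    · right
      obtain ⟨j, rfl⟩ := Nat.exists_eq_add_of_le hi
      have : z ^ i * z⁻¹ ^ (i + j) = (x / y) ^ j := by
        rw [hzinv, pow_add, inv_pow, inv_pow]; field_simp
      rw [this]
      exact pow_mem (self_mem_adj A _) _
  rw [hsum]
  generalize Finset.range (P.natDegree + 1) = s
  induction s using Finset.cons_induction with
  | empty => exact ⟨0, zero_mem _, 0, zero_mem _, by simp⟩
  | cons i s hi ih =>
    obtain ⟨u₁, h₁, u₂, h₂, e⟩ := ih
    rw [Finset.sum_cons, e]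
    rcases hterm i with hi | hi
    · exact ⟨_, add_mem (mul_mem (le_adj _ _ (P.coeff i).2) hi) h₁, u₂, h₂, by ring⟩
    · exact ⟨u₁, h₁, _, add_mem (mul_mem (le_adj _ _ (P.coeff i).2) hi) h₂, by ring⟩

lemma mem_icl_of_mem_icl_adj {T : Set K} {g : K} (h₁ : g ∈ icl (T ∪ adj A (y / x)))
    (h₂ : g ∈ icl (T ∪ adj A (x / y))) : g ∈ icl (T ∪ A) := by
  refine mem_icl.2 fun V hV => ?_
  have hT : T ⊆ V.toSubring := Set.subset_union_left.trans hV
  have hA : A ≤ V.toSubring := Set.subset_union_right.trans hV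
  rcases V.mem_or_inv_mem (y / x) with h | h
  · exact mem_icl.1 h₁ V (Set.union_subset hT (adj_le hA h))
  · rw [inv_div] at h
    exact mem_icl.1 h₂ V (Set.union_subset hT (adj_le hA h))

lemma split_of_adj (h : Reg2 A x y) {t : K} (h₁ : Split (adj A (y / x)) t)
    (h₂ : Split (adj A (x / y)) t) : Split A t := by
  intro f hf
  obtain ⟨g₁, hg₁, k₁, hk₁, e₁⟩ :=
    h₁ f (icl_mono (Set.union_subset_union_right _ (le_adj A (y / x))) hf)
  obtain ⟨g₂, hg₂, k₂, hk₂, e₂⟩ :=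
    h₂ f (icl_mono (Set.union_subset_union_right _ (le_adj A (x / y))) hf)
  set S₁ := adj A (y / x) with hS₁
  set S₂ := adj A (x / y) with hS₂
  have hu : g₁ - g₂ ∈ icl ((S₁ : Set K) ∪ S₂) := by
    refine mem_icl_of_mem_insert (t := t) (sub_mem (icl_mono ?_ hg₁) (icl_mono ?_ hg₂)) ?_
    · rintro z (rfl | hz)
      exacts [Or.inl rfl, Or.inr (Or.inl hz)]
    · rintro z (rfl | hz)
      exacts [Or.inl rfl, Or.inr (Or.inr hz)]
    · rw [show g₁ - g₂ = k₂ - k₁ by linear_combination e₂ - e₁]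
      refine sub_mem (icl_mono ?_ hk₂) (icl_mono ?_ hk₁)
      · rintro z (rfl | hz)
        exacts [Or.inl rfl, Or.inr (Or.inr hz)]
      · rintro z (rfl | hz)
        exacts [Or.inl rfl, Or.inr (Or.inl hz)]
  obtain ⟨u₁, hu₁, u₂, hu₂, e⟩ := h.exists_add_of_mem_icl hu
  refine ⟨g₁ - u₁, ?_, k₁ + u₁, ?_, by rw [e₁]; ring⟩
  · refine mem_icl_of_mem_icl_adj (x := x) (y := y)
      (sub_mem hg₁ (subset_icl _ (Or.inr hu₁))) ?_
    rw [show g₁ - u₁ = g₂ + u₂ by linear_combination e]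
    exact add_mem hg₂ (subset_icl _ (Or.inr hu₂))
  · refine mem_icl_of_mem_icl_adj (x := x) (y := y)
      (add_mem hk₁ (subset_icl _ (Or.inr hu₁))) ?_
    rw [show k₁ + u₁ = k₂ - u₂ by linear_combination e₂ - e₁ - e]
    exact sub_mem hk₂ (subset_icl _ (Or.inr hu₂))

/-- Vanishing of the first cohomology of the structure sheaf of the normalized blow-up of an
ideal generated by two elements in a two-dimensional regular local ring. -/
theorem split (N : ℕ) {A : Subring K} {x y : K} (h : Reg2 A x y) {a b : A} (ha : a ≠ 0)
    (hb : b ≠ 0) (hN : ChainLT (Ideal.span {a, b}) N) : Split A (b / a) := by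
  induction N generalizing A x y with
  | zero => exact absurd (hN (RelSeries.singleton _ ⟨⊤, Set.mem_Ici.2 le_top⟩)) (by simp)
  | succ N ih =>
    by_cases hab : Ideal.span {a, b} = ⊤
    · refine Split.of_div_mem ?_
      have ha0 : (a : K) ≠ 0 := fun h0 => ha (Subtype.ext h0)
      have hb0 : (b : K) ≠ 0 := fun h0 => hb (Subtype.ext h0)
      have : ∃ c ∈ ({a, b} : Set A), c ∉ h.maxIdeal := by
        by_contra hcon
        push Not at hcon
        exact h.isMaximal_maxIdeal.ne_top (top_le_iff.1 (hab ▸ Ideal.span_le.2 hcon))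
      obtain ⟨c, hc, hcm⟩ := this
      obtain ⟨d, hd⟩ := (h.isUnit_of_notMem hcm).exists_right_inv
      have hd := congrArg Subtype.val hd
      push_cast at hd
      rcases hc with rfl | rfl
      · left
        have : (b : K) / c = b * d := by
          rw [div_eq_iff ha0]; linear_combination (-(b : K)) * hd
        rw [this]
        exact mul_mem b.2 d.2
      · right
        have : (a : K) / c = a * d := by
          rw [div_eq_iff hb0]; linear_combination (-(a : K)) * hd
        rw [this]
        exact mul_mem a.2 d.2
    · refine h.split_of_adj ?_ ?_
      · exact h.split_adj (fun B u v hB a b ha hb hN => ih hB ha hb hN) ha hb hN hab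
      · exact h.symm.split_adj (fun B u v hB a b ha hb hN => ih hB ha hb hN) ha hb hN hab

end Reg2

end Split

section Dominates

variable {R K : Type*} [CommRing R] [Field K] [Algebra R K]

/-- The valuation ring `V` of `K` dominates the local ring `R`. -/
structure Dominates (R : Type*) [CommRing R] [IsLocalRing R] [Algebra R K]
    (V : ValuationSubring K) : Prop where
  le_one : ∀ a : R, V.valuation (algebraMap R K a) ≤ 1
  lt_one : ∀ a ∈ maximalIdeal R, V.valuation (algebraMap R K a) < 1

lemma valuation_lt_pow {Γ : Type*} [LinearOrderedCommGroupWithZero Γ] (v : Valuation R Γ)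
    {I : Ideal R} {γ : Γ} (hI : ∀ a ∈ I, v a < γ) (n : ℕ) :
    ∀ a ∈ I ^ (n + 1), v a < γ ^ (n + 1) := by
  induction n with
  | zero => simpa using hI
  | succ n ih =>
    intro a ha
    rw [pow_succ] at ha
    induction ha using Submodule.mul_induction_on' with
    | mem_mul_mem b hb c hc =>
      rw [map_mul, pow_succ]
      exact mul_lt_mul'' (ih b hb) (hI c hc) zero_le zero_le
    | add b _ c _ hb hc => exact (v.map_add b c).trans_lt (max_lt hb hc)

lemma exists_le_valuation_of_memIntClosure {Γ : Type*} [LinearOrderedCommGroupWithZero Γ]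
    (v : Valuation R Γ) {I : Ideal R} {z : R} (hz : MemIntClosure I z) :
    ∃ a ∈ I, v z ≤ v a := by
  obtain ⟨n, hn, c, hc, e⟩ := hz
  by_contra! hcon
  have hz0 : 0 < v z := by simpa using hcon 0 (zero_mem _)
  have hlt : v (∑ i ∈ Finset.Icc 1 n, c i * z ^ (n - i)) < v z ^ n := by
    refine v.map_sum_lt (pow_ne_zero _ hz0.ne') fun i hi => ?_
    obtain ⟨h1, h2⟩ := Finset.mem_Icc.1 hi
    obtain ⟨j, rfl⟩ := Nat.exists_eq_add_of_le' h1
    rw [map_mul, map_pow]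
    calc v (c (j + 1)) * v z ^ (n - (j + 1)) < v z ^ (j + 1) * v z ^ (n - (j + 1)) :=
          mul_lt_mul_of_pos_right (valuation_lt_pow v hcon j _ (hc _ hi)) (pow_pos hz0 _)
      _ = v z ^ n := by rw [← pow_add, Nat.add_sub_cancel' h2]
  rw [← neg_eq_of_add_eq_zero_right e, Valuation.map_neg, map_pow] at hlt
  exact hlt.false

lemma exists_sum_of_mem_sup_pow {I : Ideal R} {z : R} (n : ℕ) {s : R}
    (hs : s ∈ (I ⊔ Ideal.span {z}) ^ n) :
    ∃ c : ℕ → R, (∀ i, c i ∈ I ^ i) ∧ s = ∑ i ∈ Finset.range (n + 1), c i * z ^ (n - i) := by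
  induction n generalizing s with
  | zero => exact ⟨fun i => if i = 0 then s else 0, fun i => by
      by_cases h : i = 0 <;> simp [h], by simp⟩
  | succ n ih =>
    rw [pow_succ] at hs
    induction hs using Submodule.mul_induction_on' with
    | mem_mul_mem b hb d hd =>
      obtain ⟨c, hc, rfl⟩ := ih hb
      obtain ⟨a, ha, t, ht, rfl⟩ := Submodule.mem_sup.1 hd
      obtain ⟨u, rfl⟩ := Ideal.mem_span_singleton'.1 ht
      refine ⟨fun i => (if i ≤ n then u * c i else 0) + (if i = 0 then 0 else c (i - 1) * a),
        fun i => ?_, ?_⟩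
      · refine add_mem ?_ ?_
        · split_ifs
          exacts [Ideal.mul_mem_left _ _ (hc i), zero_mem _]
        · split_ifs with h
          · exact zero_mem _
          · obtain ⟨j, rfl⟩ := Nat.exists_eq_succ_of_ne_zero h
            rw [pow_succ]
            exact Ideal.mul_mem_mul (hc j) ha
      · simp only [add_mul, Finset.sum_add_distrib]
        rw [Finset.sum_range_succ _ (n + 1), Finset.sum_range_succ' _ (n + 1), mul_add, add_comm]
        simp only [Nat.not_succ_le_self, if_false, zero_mul, add_zero,
          Nat.add_sub_cancel, Nat.add_eq_zero_iff, one_ne_zero, and_false, if_true,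
          Nat.add_sub_add_right, Finset.sum_mul]
        congr 1
        · refine Finset.sum_congr rfl fun i hi => ?_
          have hi : i ≤ n := by simp at hi; omega
          rw [if_pos hi, show n + 1 - i = n - i + 1 by omega, pow_succ]
          ring
        · exact Finset.sum_congr rfl fun i hi => by ring
    | add b _ d _ hb hd =>
      obtain ⟨c, hc, rfl⟩ := hb
      obtain ⟨c', hc', rfl⟩ := hd
      exact ⟨fun i => c i + c' i, fun i => add_mem (hc i) (hc' i), by
        simp only [add_mul, Finset.sum_add_distrib]⟩

lemma memIntClosure_of_pow_mem {I : Ideal R} {z : R} {n : ℕ}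
    (h : z ^ (n + 1) ∈ I * (I ⊔ Ideal.span {z}) ^ n) : MemIntClosure I z := by
  suffices ∀ s ∈ I * (I ⊔ Ideal.span {z}) ^ n, ∃ c : ℕ → R, (∀ i, c i ∈ I ^ (i + 1)) ∧
      s = ∑ i ∈ Finset.range (n + 1), c i * z ^ (n - i) by
    obtain ⟨c, hc, e⟩ := this _ h
    refine ⟨n + 1, n.succ_pos, fun i => -c (i - 1), fun i hi => ?_, ?_⟩
    · obtain ⟨j, rfl⟩ := Nat.exists_eq_add_of_le' (Finset.mem_Icc.1 hi).1
      exact neg_mem (hc j)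
    · rw [← Finset.Ico_add_one_right_eq_Icc, Finset.sum_Ico_eq_sum_range, e,
        Nat.add_sub_cancel, ← Finset.sum_add_distrib]
      refine Finset.sum_eq_zero fun i _ => ?_
      simp only [add_comm 1 i, Nat.add_sub_cancel, Nat.add_sub_add_right]
      ring
  intro s hs
  induction hs using Submodule.mul_induction_on' with
  | mem_mul_mem a ha b hb =>
    obtain ⟨c, hc, rfl⟩ := exists_sum_of_mem_sup_pow n hb
    refine ⟨fun i => a * c i, fun i => ?_, ?_⟩
    · rw [pow_succ']
      exact Ideal.mul_mem_mul ha (hc i)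
    · rw [Finset.mul_sum]
      exact Finset.sum_congr rfl fun i _ => by ring
  | add b _ d _ hb hd =>
    obtain ⟨c, hc, rfl⟩ := hb
    obtain ⟨c', hc', rfl⟩ := hd
    exact ⟨fun i => c i + c' i, fun i => add_mem (hc i) (hc' i), by
      simp only [add_mul, Finset.sum_add_distrib]⟩

variable [IsLocalRing R] [FaithfulSMul R K]

lemma memIntClosure_of_dominates {I : Ideal R} {z : R}
    (h : ∀ V : ValuationSubring K, Dominates R V →
      ∃ a ∈ I, V.valuation (algebraMap R K z) ≤ V.valuation (algebraMap R K a)) :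
    MemIntClosure I z := by
  set φ := algebraMap R K with hφ
  have hinj : Function.Injective φ := FaithfulSMul.algebraMap_injective R K
  by_cases hz : z = 0
  · exact ⟨1, one_pos, 0, by simp, by simp [hz]⟩
  have hz' : φ z ≠ 0 := by rwa [Ne, map_eq_zero_iff φ hinj]
  set L := I ⊔ Ideal.span {z} with hL
  have hzL : z ∈ L := Ideal.mem_sup_right (Ideal.mem_span_singleton_self z)
  set A := Subring.closure (Set.range φ ∪ {s | ∃ a ∈ I, s = φ a / φ z}) with hA
  have hRA : ∀ r : R, φ r ∈ A := fun r => Subring.subset_closure (Or.inl ⟨r, rfl⟩)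
  have hIA : ∀ a ∈ I, φ a / φ z ∈ A := fun a ha => Subring.subset_closure (Or.inr ⟨a, ha, rfl⟩)
  have key : ∀ s ∈ A, ∃ n, ∃ b ∈ L ^ n, s * φ z ^ n = φ b := by
    intro s hs
    induction hs using Subring.closure_induction with
    | mem s hs =>
      rcases hs with ⟨r, rfl⟩ | ⟨a, ha, rfl⟩
      · exact ⟨0, r, by simp, by simp⟩
      · exact ⟨1, a, by simpa using Ideal.mem_sup_left ha, by field_simp⟩
    | zero => exact ⟨0, 0, by simp, by simp⟩
    | one => exact ⟨0, 1, by simp, by simp⟩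
    | add s t _ _ hs ht =>
      obtain ⟨n, b, hb, e⟩ := hs
      obtain ⟨m, d, hd, e'⟩ := ht
      refine ⟨n + m, b * z ^ m + z ^ n * d, ?_, ?_⟩
      · rw [pow_add]
        exact add_mem (Ideal.mul_mem_mul hb (Ideal.pow_mem_pow hzL m))
          (Ideal.mul_mem_mul (Ideal.pow_mem_pow hzL n) hd)
      · rw [map_add, map_mul, map_mul, map_pow, map_pow, ← e, ← e']; ring
    | neg s _ hs =>
      obtain ⟨n, b, hb, e⟩ := hs
      exact ⟨n, -b, neg_mem hb, by rw [map_neg, ← e]; ring⟩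
    | mul s t _ _ hs ht =>
      obtain ⟨n, b, hb, e⟩ := hs
      obtain ⟨m, d, hd, e'⟩ := ht
      refine ⟨n + m, b * d, ?_, ?_⟩
      · rw [pow_add]; exact Ideal.mul_mem_mul hb hd
      · rw [map_mul, ← e, ← e']; ring
  let J : Ideal A := Ideal.span ({s | ∃ m ∈ maximalIdeal R, (s : K) = φ m} ∪
    {s | ∃ a ∈ I, (s : K) = φ a / φ z})
  have hJ : J = ⊤ := by
    by_contra hJ
    obtain ⟨V, hAV, hV⟩ := Ideal.image_subset_nonunits_valuationSubring J hJ
    obtain ⟨a, ha, hle⟩ := h V ⟨fun a => (V.valuation_le_one_iff _).2 (hAV (hRA a)), fun m hm => by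
      refine V.mem_nonunits_iff.1 (hV ⟨⟨φ m, hRA m⟩, Ideal.subset_span (Or.inl ⟨m, hm, rfl⟩), rfl⟩)⟩
    have := V.mem_nonunits_iff.1
      (hV ⟨⟨φ a / φ z, hIA a ha⟩, Ideal.subset_span (Or.inr ⟨a, ha, rfl⟩), rfl⟩)
    rw [Subring.subtype_apply, map_div₀, div_lt_one₀ (by
      rwa [zero_lt_iff, Valuation.ne_zero_iff])] at this
    exact absurd hle (not_le.2 this)
  have key' : ∀ s ∈ J, ∃ n, ∃ b ∈ maximalIdeal R * L ^ (n + 1) ⊔ I * L ^ n,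
      (s : K) * φ z ^ (n + 1) = φ b := by
    intro s hs
    induction hs using Submodule.span_induction with
    | mem s hs =>
      rcases hs with ⟨m, hm, e⟩ | ⟨a, ha, e⟩
      · exact ⟨0, m * z, Ideal.mem_sup_left (Ideal.mul_mem_mul hm (by simpa using hzL)), by
          rw [e, map_mul]; simp⟩
      · exact ⟨0, a, Ideal.mem_sup_right (by simpa using ha), by
        rw [e, zero_add, pow_one, div_mul_cancel₀ _ hz']⟩
    | zero => exact ⟨0, 0, by simp, by simp⟩
    | add s t _ _ hs ht =>
      obtain ⟨n, b, hb, e⟩ := hs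
      obtain ⟨m, d, hd, e'⟩ := ht
      have hmul : ∀ (n m : ℕ) {b : R}, b ∈ maximalIdeal R * L ^ (n + 1) ⊔ I * L ^ n →
          ∀ c ∈ L ^ m, b * c ∈ maximalIdeal R * L ^ (n + m + 1) ⊔ I * L ^ (n + m) := by
        intro n m b hb c hc
        have := Ideal.mul_mem_mul hb hc
        rwa [Ideal.sup_mul, mul_assoc, mul_assoc, ← pow_add, ← pow_add, add_right_comm] at this
      refine ⟨n + m, b * z ^ m + d * z ^ n, ?_, ?_⟩
      · refine add_mem (hmul n m hb _ (Ideal.pow_mem_pow hzL m)) ?_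
        rw [add_comm n m]
        exact hmul m n hd _ (Ideal.pow_mem_pow hzL n)
      · rw [map_add, map_mul, map_mul, map_pow, map_pow, ← e, ← e']; push_cast; ring
    | smul t s _ hs =>
      obtain ⟨n, b, hb, e⟩ := hs
      obtain ⟨m, d, hd, e'⟩ := key t t.2
      refine ⟨n + m, b * d, ?_, ?_⟩
      · have := Ideal.mul_mem_mul hb hd
        rwa [Ideal.sup_mul, mul_assoc, mul_assoc, ← pow_add, ← pow_add, add_right_comm] at this
      · rw [map_mul, ← e, ← e', smul_eq_mul]; push_cast; ring
  obtain ⟨n, b, hb, e⟩ := key' 1 (hJ ▸ Submodule.mem_top)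
  rw [Subring.coe_one, one_mul, ← map_pow] at e
  obtain rfl := hinj e
  have hle : maximalIdeal R * L ^ (n + 1) ⊔ I * L ^ n ≤
      maximalIdeal R * Ideal.span {z ^ (n + 1)} ⊔ I * L ^ n := by
    refine sup_le ?_ le_sup_right
    have : L ^ (n + 1) ≤ Ideal.span {z ^ (n + 1)} ⊔ I * L ^ n := by
      clear hb e
      induction n with
      | zero => simp [hL, sup_comm]
      | succ n ih =>
        rw [pow_succ, hL, Ideal.mul_sup, ← hL]
        refine sup_le ((mul_comm _ _).le.trans le_sup_right) ((Ideal.mul_mono_left ih).trans ?_)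
        rw [Ideal.sup_mul, Ideal.span_singleton_mul_span_singleton, ← pow_succ, mul_assoc]
        refine sup_le_sup le_rfl (Ideal.mul_mono_right ?_)
        rw [pow_succ]
        exact Ideal.mul_mono_right le_sup_right
    refine (Ideal.mul_mono_right this).trans ?_
    rw [Ideal.mul_sup]
    exact sup_le_sup le_rfl Ideal.mul_le_right
  obtain ⟨s, hs, t, ht, e⟩ := Submodule.mem_sup.1 (hle hb)
  obtain ⟨m, hm, rfl⟩ := Ideal.mem_mul_span_singleton.1 hs
  have hu : IsUnit (1 - m) := by
    by_contra hu
    have := add_mem ((mem_maximalIdeal _).2 hu) hm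
    rw [sub_add_cancel] at this
    exact (Ideal.ne_top_iff_one _).1 (maximalIdeal.isMaximal R).ne_top this
  obtain ⟨u, hu⟩ := hu
  refine memIntClosure_of_pow_mem (n := n) ?_
  rw [show z ^ (n + 1) = ↑u⁻¹ * t by
    rw [Units.eq_inv_mul_iff_mul_eq, hu]; linear_combination -e]
  exact Ideal.mul_mem_left _ _ ht

end Dominates

section RegPair

variable {R : Type*} [CommRing R] [IsLocalRing R] {x y : R}

/-- `R` is a Noetherian local domain whose maximal ideal is generated by the regular sequence
`x, y`. -/
structure RegPair (R : Type*) [CommRing R] [IsLocalRing R] (x y : R) : Prop where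
  noeth : IsNoetherianRing R
  dom : IsDomain R
  max : maximalIdeal R = Ideal.span {x, y}
  x_prime : Prime x
  y_prime : Prime y
  not_dvd : ∀ k : ℕ, ¬ x ∣ y ^ k

lemma exists_eq_pow_mul_of_not_dvd [IsNoetherianRing R] (hm : maximalIdeal R = Ideal.span {x, y})
    {a : R} (ha : ¬ x ∣ a) : ∃ k : ℕ, ∃ u, IsUnit u ∧ x ∣ a - y ^ k * u := by
  have hxm : x ∈ maximalIdeal R := hm ▸ Ideal.subset_span (by simp)
  have hym : y ∈ maximalIdeal R := hm ▸ Ideal.subset_span (by simp)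
  have hne : Ideal.span {x} ≠ ⊤ := fun h =>
    (maximalIdeal.isMaximal R).ne_top (top_le_iff.1 (h ▸ (Ideal.span_singleton_le_iff_mem _).2 hxm))
  have : Nontrivial (R ⧸ Ideal.span {x}) := Ideal.Quotient.nontrivial_iff.2 hne
  have : IsLocalRing (R ⧸ Ideal.span {x}) :=
    IsLocalRing.of_surjective' (Ideal.Quotient.mk _) Ideal.Quotient.mk_surjective
  have hex : ∃ n : ℕ, ¬ ∃ b, x ∣ a - y ^ n * b := by
    by_contra! hcon
    refine ha (Ideal.mem_span_singleton.1 (Ideal.Quotient.eq_zero_iff_mem.1 ?_))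
    have hJ : Ideal.span {Ideal.Quotient.mk (Ideal.span {x}) y} ≠ ⊤ := by
      intro h
      obtain ⟨c, hc⟩ := Ideal.mem_span_singleton'.1 ((Ideal.eq_top_iff_one _).1 h)
      obtain ⟨c, rfl⟩ := Ideal.Quotient.mk_surjective c
      rw [← map_mul, ← map_one (Ideal.Quotient.mk _), Ideal.Quotient.eq] at hc
      have h1 := (Ideal.span_singleton_le_iff_mem _).2 hxm hc
      have := sub_mem (Ideal.mul_mem_left _ c hym) h1
      rw [sub_sub_cancel] at this
      exact (Ideal.ne_top_iff_one _).1 (maximalIdeal.isMaximal R).ne_top this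
    have := Ideal.iInf_pow_eq_bot_of_isLocalRing _ hJ
    rw [← Ideal.mem_bot, ← this, Submodule.mem_iInf]
    intro n
    obtain ⟨b, hb⟩ := hcon n
    rw [Ideal.span_singleton_pow, Ideal.mem_span_singleton']
    refine ⟨Ideal.Quotient.mk _ b, ?_⟩
    rw [← map_pow, ← map_mul, eq_comm, Ideal.Quotient.eq, mul_comm b]
    exact Ideal.mem_span_singleton.2 hb
  classical
  have h0 : Nat.find hex ≠ 0 := fun h0 => by
    have := Nat.find_spec hex
    rw [h0] at this
    exact this ⟨a, by simp⟩
  obtain ⟨k, hk⟩ := Nat.exists_eq_succ_of_ne_zero h0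
  obtain ⟨u, hu⟩ := not_not.1 (Nat.find_min hex (m := k) (by omega))
  refine ⟨k, u, ?_, hu⟩
  by_contra hun
  have hmem : u ∈ Ideal.span {x, y} := hm ▸ (mem_maximalIdeal _).2 hun
  obtain ⟨s, t, rfl⟩ := Ideal.mem_span_pair.1 hmem
  have := Nat.find_spec hex
  rw [hk] at this
  refine this ⟨t, ?_⟩
  have := dvd_add hu (Dvd.intro (y ^ k * s) rfl : x ∣ x * (y ^ k * s))
  convert this using 1
  rw [Nat.succ_eq_add_one, pow_succ]; ring

lemma not_dvd_pow_of_height [IsNoetherianRing R] (hm : maximalIdeal R = Ideal.span {x, y})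
    (hh : ¬ (maximalIdeal R).height ≤ 1) (k : ℕ) : ¬ x ∣ y ^ k := by
  intro hk
  refine hh (Ideal.height_le_one_of_isPrincipal_of_mem_minimalPrimes (Ideal.span {x}) _ ?_)
  refine ⟨⟨inferInstance, hm ▸ Ideal.span_mono (by simp)⟩, fun q hq _ => ?_⟩
  have hx : x ∈ q := hq.2 (Ideal.mem_span_singleton_self x)
  have hy : y ∈ q := hq.1.mem_of_pow_mem k (q.mem_of_dvd hk hx)
  rw [hm, Ideal.span_le]
  rintro z (rfl | rfl) <;> assumption

lemma prime_of_height [IsNoetherianRing R] (hm : maximalIdeal R = Ideal.span {x, y})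
    (hh : ¬ (maximalIdeal R).height ≤ 1) : (Ideal.span {x}).IsPrime := by
  refine Ideal.isPrime_iff.2 ⟨fun h => ?_, fun {a b} hab => ?_⟩
  · exact not_dvd_pow_of_height hm hh 0 (isUnit_iff_dvd_one.1 (Ideal.span_singleton_eq_top.1 h)
      |>.trans
      (by simp))
  · simp only [Ideal.mem_span_singleton] at hab ⊢
    by_contra! hcon
    obtain ⟨k, u, hu, h1⟩ := exists_eq_pow_mul_of_not_dvd hm hcon.1
    obtain ⟨l, w, hw, h2⟩ := exists_eq_pow_mul_of_not_dvd hm hcon.2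
    have h3 : x ∣ y ^ (k + l) * (u * w) := by
      have := ((hab.sub (h1.mul_left b)).sub (h2.mul_left (y ^ k * u)))
      convert this using 1
      rw [pow_add]; ring
    exact not_dvd_pow_of_height hm hh (k + l) ((hu.mul hw).dvd_mul_right.1 h3)

lemma not_height_le_one (hdim : ringKrullDim R = 2) : ¬ (maximalIdeal R).height ≤ 1 := by
  intro h
  have h1 : ((maximalIdeal R).height : WithBot ℕ∞) ≤ (1 : ℕ∞) := WithBot.coe_le_coe.2 h
  rw [IsLocalRing.maximalIdeal_height_eq_ringKrullDim, hdim] at h1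
  exact absurd h1 (by decide)

lemma isDomain_of_ringKrullDim [IsNoetherianRing R] (hm : maximalIdeal R = Ideal.span {x, y})
    (hdim : ringKrullDim R = 2) : IsDomain R := by
  have hh := not_height_le_one hdim
  have hxp := prime_of_height hm hh
  obtain ⟨l, hl⟩ := Order.le_krullDim_iff.1 (show ((2 : ℕ) : WithBot ℕ∞) ≤
    Order.krullDim (PrimeSpectrum R) from hdim.ge)
  set p := (l 0).asIdeal with hp
  have hpr : p.IsPrime := (l 0).isPrime
  have h01 : p < (l ⟨1, by omega⟩).asIdeal := l.strictMono (show (0 : Fin _) < ⟨1, _⟩ by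
    simp [Fin.lt_def])
  have h12 : (l ⟨1, by omega⟩).asIdeal < (l ⟨2, by omega⟩).asIdeal :=
    l.strictMono (by simp [Fin.lt_def])
  have hp1 := (l ⟨1, by omega⟩).isPrime
  have hp2 := (l ⟨2, by omega⟩).isPrime
  set p1 := (l ⟨1, by omega⟩).asIdeal
  set p2 := (l ⟨2, by omega⟩).asIdeal
  have hmx : ∀ q : Ideal R, q.IsPrime → x ∈ q → Ideal.span {x} ≠ q → q = maximalIdeal R := by
    intro q hq hxq hne
    have hle : Ideal.span {x} < q :=
      lt_of_le_of_ne ((Ideal.span_singleton_le_iff_mem _).2 hxq) hne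
    obtain ⟨a, haq, hax⟩ := SetLike.exists_of_lt hle
    rw [Ideal.mem_span_singleton] at hax
    obtain ⟨k, u, hu, h1⟩ := exists_eq_pow_mul_of_not_dvd hm hax
    have : y ^ k * u ∈ q := by
      have := sub_mem haq (q.mem_of_dvd h1 hxq)
      rwa [sub_sub_cancel] at this
    have hy : y ∈ q := hq.mem_of_pow_mem k ((hq.mem_or_mem this).resolve_right fun hu' =>
      hq.ne_top (Ideal.eq_top_of_isUnit_mem _ hu' hu))
    refine le_antisymm (le_maximalIdeal hq.ne_top) ?_
    rw [hm, Ideal.span_le]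
    rintro z (rfl | rfl) <;> assumption
  have hxp0 : x ∉ p := by
    intro hx
    have hne : Ideal.span {x} ≠ p1 := fun h =>
      h01.not_ge (h ▸ (Ideal.span_singleton_le_iff_mem _).2 hx)
    exact h12.not_ge ((le_maximalIdeal hp2.ne_top).trans (hmx p1 hp1 (h01.le hx) hne).ge)
  have hple : p ≤ Ideal.span {x} := by
    by_contra hcon
    obtain ⟨f, hfp, hfx⟩ := SetLike.not_le_iff_exists.1 hcon
    have hmin : ∀ q : Ideal R, q.IsPrime → p ≤ q → x ∈ q → q = maximalIdeal R :=
      fun q hq hpq hxq => hmx q hq hxq fun h => hfx (h ▸ hpq hfp)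
    have hpm : p ≤ maximalIdeal R := le_maximalIdeal hpr.ne_top
    have : Nontrivial (R ⧸ p) := Ideal.Quotient.nontrivial_iff.2 hpr.ne_top
    have : IsLocalRing (R ⧸ p) :=
      IsLocalRing.of_surjective' (Ideal.Quotient.mk _) Ideal.Quotient.mk_surjective
    have hmap : ∀ q : Ideal (R ⧸ p), q.IsPrime → Ideal.Quotient.mk p x ∈ q →
        q.comap (Ideal.Quotient.mk p) = maximalIdeal R := fun q hq hxq =>
      hmin _ (hq.comap _) (fun z hz => by
        rw [Ideal.mem_comap, Ideal.Quotient.eq_zero_iff_mem.2 hz]; exact zero_mem _) hxq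
    have hmM : (maximalIdeal (R ⧸ p)).comap (Ideal.Quotient.mk p) = maximalIdeal R := by
      refine hmap _ inferInstance ?_
      rw [mem_maximalIdeal]
      intro hu
      obtain ⟨c, hc⟩ := hu.exists_right_inv
      obtain ⟨c, rfl⟩ := Ideal.Quotient.mk_surjective c
      rw [← map_mul, ← map_one (Ideal.Quotient.mk _), Ideal.Quotient.eq] at hc
      have hxm : x ∈ maximalIdeal R := hm ▸ Ideal.subset_span (by simp)
      have := sub_mem (Ideal.mul_mem_right c _ hxm) (hpm hc)
      rw [sub_sub_cancel] at this
      exact (Ideal.ne_top_iff_one _).1 (maximalIdeal.isMaximal R).ne_top this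
    have hle : (maximalIdeal (R ⧸ p)).height ≤ 1 := by
      refine Ideal.height_le_one_of_isPrincipal_of_mem_minimalPrimes
        (Ideal.span {Ideal.Quotient.mk p x}) _ ⟨⟨inferInstance, ?_⟩, fun q hq _ => ?_⟩
      · rw [Ideal.span_singleton_le_iff_mem, ← Ideal.mem_comap, hmM, hm]
        exact Ideal.subset_span (by simp)
      · have := hmap q hq.1 (hq.2 (Ideal.mem_span_singleton_self _))
        rw [← hmM] at this
        exact (Ideal.comap_injective_of_surjective _ Ideal.Quotient.mk_surjective this).ge
    have hdq : ((2 : ℕ) : WithBot ℕ∞) ≤ ringKrullDim (R ⧸ p) := by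
      rw [ringKrullDim_quotient]
      have hz : ∀ i, l i ∈ PrimeSpectrum.zeroLocus (p : Set R) := fun i =>
        (show (l 0).asIdeal ≤ (l i).asIdeal from l.monotone (Fin.zero_le i))
      refine Order.le_krullDim_iff.2 ⟨⟨l.length, fun i => ⟨l i, hz i⟩, fun i => l.step i⟩, hl⟩
    rw [← IsLocalRing.maximalIdeal_height_eq_ringKrullDim] at hdq
    have := hdq.trans (WithBot.coe_le_coe.2 hle)
    exact absurd this (by decide)
  have hp0 : p = ⊥ := by
    refine Submodule.eq_bot_of_le_smul_of_le_jacobson_bot (maximalIdeal R) p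
      (IsNoetherian.noetherian p) (fun f hf => ?_)
      (IsLocalRing.jacobson_eq_maximalIdeal _ bot_ne_top).ge
    obtain ⟨c, rfl⟩ := Ideal.mem_span_singleton.1 (hple hf)
    exact Ideal.mul_mem_mul (hm ▸ Ideal.subset_span (by simp))
      ((hpr.mem_or_mem hf).resolve_left hxp0)
  rw [hp0] at hpr
  exact IsDomain.of_bot_isPrime R

lemma IsTwoDimRegularLocal.exists_regPair (h : IsTwoDimRegularLocal R) :
    ∃ x y : R, RegPair R x y := by
  obtain ⟨hn, hdim, x, y, hm⟩ := h
  have hm' : maximalIdeal R = Ideal.span {y, x} := by rw [hm, Set.pair_comm]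
  have hd := isDomain_of_ringKrullDim hm hdim
  have hh := not_height_le_one hdim
  have hne : ∀ x y : R, maximalIdeal R = Ideal.span {x, y} → Prime x := fun x y hm => by
    have hx : x ≠ 0 := by
      rintro rfl
      have hp : (maximalIdeal R).IsPrincipal :=
        ⟨y, by rw [hm]; simp [Ideal.span_insert, Ideal.submodule_span_eq]⟩
      exact hh (Ideal.height_le_one_of_isPrincipal_of_mem_minimalPrimes (maximalIdeal R) _
        ⟨⟨inferInstance, le_rfl⟩, fun q hq _ => hq.2⟩)
    exact (Ideal.span_singleton_prime hx).1 (prime_of_height hm hh)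
  exact ⟨x, y, hn, hd, hm, hne x y hm, hne y x hm', not_dvd_pow_of_height hm hh⟩

namespace RegPair

variable (h : RegPair R x y)
include h

lemma symm : RegPair R y x where
  noeth := h.noeth
  dom := h.dom
  max := by rw [h.max, Set.pair_comm]
  x_prime := h.y_prime
  y_prime := h.x_prime
  not_dvd k hk := by
    have := h.noeth
    have := h.dom
    obtain ⟨c, hc⟩ := h.y_prime.dvd_of_dvd_pow hk
    rcases h.x_prime.dvd_or_dvd (hc ▸ dvd_rfl : x ∣ y * c) with h1 | ⟨d, rfl⟩
    · exact h.not_dvd 1 (by simpa using h1)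
    · refine h.y_prime.not_isUnit (IsUnit.of_mul_eq_one d (mul_left_cancel₀ h.x_prime.ne_zero ?_))
      rw [mul_one]
      nth_rw 2 [hc]
      ring

lemma x_mem : x ∈ maximalIdeal R := h.max ▸ Ideal.subset_span (by simp)

lemma y_mem : y ∈ maximalIdeal R := h.symm.x_mem

lemma reg {u v : R} (e : x * u = y * v) : ∃ w, u = y * w ∧ v = x * w := by
  have := h.dom
  obtain ⟨w, rfl⟩ := (h.x_prime.dvd_or_dvd (Dvd.intro u e : x ∣ y * v)).resolve_left
    (by simpa using h.not_dvd 1)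
  exact ⟨w, mul_left_cancel₀ h.x_prime.ne_zero (by rw [e]; ring), rfl⟩

lemma pow_dvd_of_pow_dvd_pow_mul {n m : ℕ} {a : R} (hd : x ^ n ∣ y ^ m * a) : x ^ n ∣ a :=
  have := h.dom
  h.x_prime.pow_dvd_of_dvd_mul_left n (by simpa using h.not_dvd m) hd

lemma exists_eq_algebraMap {K : Type*} [Field K] [Algebra R K] [FaithfulSMul R K] {q : K}
    {n m : ℕ} {a b : R} (ha : algebraMap R K (x ^ n) * q = algebraMap R K a)
    (hb : algebraMap R K (y ^ m) * q = algebraMap R K b) : ∃ c, q = algebraMap R K c := by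
  have := h.dom
  have hinj := FaithfulSMul.algebraMap_injective R K
  have e : x ^ n * b = y ^ m * a := hinj (by rw [map_mul, map_mul, ← ha, ← hb]; ring)
  obtain ⟨c, rfl⟩ := h.pow_dvd_of_pow_dvd_pow_mul (Dvd.intro _ e)
  refine ⟨c, mul_left_cancel₀ (a := algebraMap R K (x ^ n)) ?_ (by rw [ha, map_mul])⟩
  rw [Ne, map_eq_zero_iff _ hinj]
  exact pow_ne_zero _ h.x_prime.ne_zero

lemma uniqueFactorizationMonoid : UniqueFactorizationMonoid R := by
  have := h.noeth
  have := h.dom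
  refine UniqueFactorizationMonoid.iff_exists_prime_mem_of_isPrime.2 fun p hp0 hp => ?_
  by_cases hxp : x ∈ p
  · exact ⟨x, hxp, h.x_prime⟩
  have hjac : maximalIdeal R ≤ Ideal.jacobson ⊥ :=
    (IsLocalRing.jacobson_eq_maximalIdeal _ bot_ne_top).ge
  have hex : ∃ k : ℕ, ∃ f ∈ p, ∃ u, IsUnit u ∧ x ∣ f - y ^ k * u := by
    by_contra! hcon
    refine hp0 (Submodule.eq_bot_of_le_smul_of_le_jacobson_bot (maximalIdeal R) p
      (IsNoetherian.noetherian p) (fun f hf => ?_) hjac)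
    by_cases hxf : x ∣ f
    · obtain ⟨c, rfl⟩ := hxf
      exact Ideal.mul_mem_mul h.x_mem ((hp.mem_or_mem hf).resolve_left hxp)
    · obtain ⟨k, u, hu, h1⟩ := exists_eq_pow_mul_of_not_dvd h.max hxf
      exact absurd h1 (hcon k f hf u hu)
  classical
  obtain ⟨f, hf, u, hu, hfu⟩ := Nat.find_spec hex
  have hpf : p = Ideal.span {f} := by
    refine le_antisymm (Submodule.le_of_le_smul_of_le_jacobson_bot (IsNoetherian.noetherian p) hjac
      fun g hg => ?_) ((Ideal.span_singleton_le_iff_mem _).2 hf)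
    have hg' : ∃ s, x ∣ g - s * f := by
      by_cases hxg : x ∣ g
      · exact ⟨0, by simpa using hxg⟩
      · obtain ⟨k, w, hw, hgw⟩ := exists_eq_pow_mul_of_not_dvd h.max hxg
        obtain ⟨j, rfl⟩ := Nat.exists_eq_add_of_le (Nat.find_min' hex ⟨g, hg, w, hw, hgw⟩)
        obtain ⟨u, rfl⟩ := hu
        refine ⟨y ^ j * w * ↑u⁻¹, ?_⟩
        have := hgw.sub (hfu.mul_left (y ^ j * w * ↑u⁻¹))
        convert this using 1
        rw [pow_add]
        linear_combination -(y ^ Nat.find hex * y ^ j * w) * u.inv_mul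
    obtain ⟨s, c, e⟩ := hg'
    rw [← sub_add_cancel g (s * f), e]
    refine add_mem (Submodule.mem_sup_right (Ideal.mul_mem_mul h.x_mem ?_))
      (Submodule.mem_sup_left (Ideal.mul_mem_left _ _ (Ideal.mem_span_singleton_self f)))
    have : x * c ∈ p := e ▸ sub_mem hg (Ideal.mul_mem_left _ _ hf)
    exact (hp.mem_or_mem this).resolve_left hxp
  have hf0 : f ≠ 0 := by
    rintro rfl
    exact hp0 (by rw [hpf]; simp)
  exact ⟨f, hf, (Ideal.span_singleton_prime hf0).1 (hpf ▸ hp)⟩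

lemma isIntegrallyClosed : IsIntegrallyClosed R := by
  have := h.dom
  have := h.uniqueFactorizationMonoid
  infer_instance

lemma reg2 (K : Type*) [Field K] [Algebra R K] [IsFractionRing R K] :
    Reg2 (algebraMap R K).range (algebraMap R K x) (algebraMap R K y) := by
  have := h.dom
  have := h.isIntegrallyClosed
  have hinj := IsFractionRing.injective R K
  refine ⟨⟨x, rfl⟩, ⟨y, rfl⟩, ?_, ?_, ?_, ?_, ?_, ?_⟩
  · simpa using h.x_prime.ne_zero
  · simpa using h.y_prime.ne_zero
  · rintro _ ⟨a, rfl⟩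
    by_cases ha : IsUnit a
    · obtain ⟨u, rfl⟩ := ha
      refine Or.inl ⟨↑u⁻¹, eq_inv_of_mul_eq_one_left ?_⟩
      rw [← map_mul]; simp
    · have := (mem_maximalIdeal a).2 ha
      rw [h.max, Ideal.mem_span_pair] at this
      obtain ⟨s, t, rfl⟩ := this
      exact Or.inr ⟨_, ⟨s, rfl⟩, _, ⟨t, rfl⟩, by simp [mul_comm]⟩
  · rintro _ ⟨b, rfl⟩ _ ⟨c, rfl⟩ e
    rw [← map_mul, ← map_mul, ← map_add, ← map_one (algebraMap R K)] at e
    refine (Ideal.ne_top_iff_one _).1 (maximalIdeal.isMaximal R).ne_top ?_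
    rw [← hinj e]
    exact add_mem (Ideal.mul_mem_right _ _ h.x_mem) (Ideal.mul_mem_right _ _ h.y_mem)
  · rintro _ ⟨u, rfl⟩ _ ⟨v, rfl⟩ e
    rw [← map_mul, ← map_mul] at e
    obtain ⟨w, rfl, rfl⟩ := h.reg (hinj e)
    exact ⟨_, ⟨w, rfl⟩, by simp, by simp⟩
  · intro z hz
    have hz : IsIntegral (algebraMap R K).range z := mem_icl_coe.1 hz
    have : IsIntegral R z := by
      obtain ⟨P, hP, e⟩ := hz
      obtain ⟨Q, hQ, -, hQm⟩ := Polynomial.lifts_and_natDegree_eq_and_monic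
        (f := (algebraMap R K).rangeRestrict) (p := P)
        (Polynomial.mem_lifts_of_surjective (RingHom.rangeRestrict_surjective _) P) hP
      refine ⟨Q, hQm, ?_⟩
      rw [← e, ← hQ, Polynomial.eval₂_map]
      rfl
    exact IsIntegrallyClosed.isIntegral_iff.1 this

end RegPair

end RegPair

section Length

lemma length_quotient_eq_add {R F G : Type*} [CommRing R] [AddCommGroup F] [AddCommGroup G]
    [Module R F] [Module R G] (f : F →ₗ[R] G) (N : Submodule R G) :
    Module.length R (G ⧸ N) =
      Module.length R (F ⧸ N.comap f) + Module.length R (G ⧸ (N ⊔ LinearMap.range f)) := by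
  refine Module.length_eq_add_of_exact ((N.comap f).mapQ N f le_rfl)
    (Submodule.factor le_sup_left) ?_ (Submodule.factor_surjective _) ?_
  · rw [← LinearMap.ker_eq_bot, Submodule.ker_mapQ, Submodule.mkQ_map_self]
  · intro z
    obtain ⟨z, rfl⟩ := N.mkQ_surjective z
    rw [Submodule.factor_mk, Submodule.mkQ_apply, Submodule.mkQ_apply,
      Submodule.Quotient.mk_eq_zero, Submodule.mem_sup]
    constructor
    · rintro ⟨n, hn, _, ⟨a, rfl⟩, rfl⟩
      refine ⟨Submodule.Quotient.mk a, ?_⟩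
      rw [Submodule.mapQ_apply, Submodule.Quotient.eq]
      simpa using hn
    · rintro ⟨a, ha⟩
      obtain ⟨a, rfl⟩ := (N.comap f).mkQ_surjective a
      rw [Submodule.mkQ_apply, Submodule.mapQ_apply, Submodule.Quotient.eq] at ha
      exact ⟨z - f a, by rw [← neg_mem_iff]; simpa using ha, _, ⟨a, rfl⟩, by simp⟩

lemma length_quotient_anti {R G : Type*} [CommRing R] [AddCommGroup G] [Module R G]
    {N N' : Submodule R G} (h : N ≤ N') : Module.length R (G ⧸ N') ≤ Module.length R (G ⧸ N) :=
  Module.length_le_of_surjective _ (Submodule.factor_surjective h)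

lemma eq_of_length_quotient_eq {R G : Type*} [CommRing R] [AddCommGroup G] [Module R G]
    {N N' : Submodule R G} (h : N ≤ N') (hfin : Module.length R (G ⧸ N') ≠ ⊤)
    (he : Module.length R (G ⧸ N) = Module.length R (G ⧸ N')) : N = N' := by
  have h1 := length_quotient_eq_add N'.subtype N
  rw [Submodule.range_subtype, sup_eq_right.2 h, he] at h1
  have h2 : Module.length R (N' ⧸ N.comap N'.subtype) = 0 := by
    refine (WithTop.add_right_inj hfin).1 ?_
    exact h1.symm.trans (zero_add _).symm
  rw [Module.length_eq_zero_iff, Submodule.Quotient.subsingleton_iff,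
    Submodule.comap_subtype_eq_top] at h2
  exact le_antisymm h h2

lemma length_quotient_ideal_le {R : Type*} [CommRing R] (J L : Ideal R) (g : R)
    (h : ∀ l ∈ L, g * l ∈ J) : Module.length R (R ⧸ J) ≤
      Module.length R (R ⧸ L) + Module.length R (R ⧸ (J ⊔ Ideal.span {g})) := by
  have h1 := length_quotient_eq_add (LinearMap.mulLeft R g) J
  have h2 : LinearMap.range (LinearMap.mulLeft R g) = Ideal.span {g} := by
    ext z
    simp [Ideal.mem_span_singleton, dvd_def, eq_comm]
  rw [h2] at h1
  rw [h1]
  gcongr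
  exact length_quotient_anti h

lemma length_quotient_ideal_eq {R : Type*} [CommRing R] (J L : Ideal R) (g : R)
    (h : ∀ l, g * l ∈ J ↔ l ∈ L) : Module.length R (R ⧸ J) =
      Module.length R (R ⧸ L) + Module.length R (R ⧸ (J ⊔ Ideal.span {g})) := by
  have h1 := length_quotient_eq_add (LinearMap.mulLeft R g) J
  have h2 : LinearMap.range (LinearMap.mulLeft R g) = Ideal.span {g} := by
    ext z
    simp [Ideal.mem_span_singleton, dvd_def, eq_comm]
  have h3 : Submodule.comap (LinearMap.mulLeft R g) J = L := by
    ext l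
    exact h l
  rwa [h2, h3] at h1

lemma length_quotient_maximalIdeal {R : Type*} [CommRing R] [IsLocalRing R] :
    Module.length R (R ⧸ maximalIdeal R) = 1 :=
  Module.length_eq_one_iff.2 (isSimpleModule_iff_isCoatom.2 (maximalIdeal.isMaximal R).out)

end Length

section RegPair

variable {R : Type*} [CommRing R] [IsLocalRing R] {x y : R}

namespace RegPair

variable (h : RegPair R x y)
include h

lemma exists_eq_of_mem_pow_succ {d : ℕ} {z : R} (hz : z ∈ maximalIdeal R ^ (d + 1)) :
    ∃ u ∈ maximalIdeal R ^ d, ∃ c, z = x * u + y ^ (d + 1) * c := by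
  induction d generalizing z with
  | zero =>
    rw [zero_add, pow_one, h.max, Ideal.mem_span_pair] at hz
    obtain ⟨a, b, rfl⟩ := hz
    exact ⟨a, by simp, b, by ring⟩
  | succ d ih =>
    rw [pow_succ'] at hz
    refine Submodule.mul_induction_on hz (fun a ha b hb => ?_) ?_
    · obtain ⟨u, hu, c, rfl⟩ := ih hb
      rw [h.max, Ideal.mem_span_pair] at ha
      obtain ⟨s, t, rfl⟩ := ha
      refine ⟨s * (x * u + y ^ (d + 1) * c) + t * (y * u), add_mem (Ideal.mul_mem_left _ _ hb)
        (Ideal.mul_mem_left _ _ ?_), t * c, by ring⟩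
      rw [pow_succ']
      exact Ideal.mul_mem_mul h.y_mem hu
    · rintro _ _ ⟨u, hu, c, rfl⟩ ⟨v, hv, d, rfl⟩
      exact ⟨u + v, add_mem hu hv, c + d, by ring⟩

lemma mem_pow_of_x_mul_mem {d : ℕ} {u : R} (hu : x * u ∈ maximalIdeal R ^ (d + 1)) :
    u ∈ maximalIdeal R ^ d := by
  have := h.dom
  obtain ⟨u', hu', c, e⟩ := h.exists_eq_of_mem_pow_succ hu
  obtain ⟨c, rfl⟩ := (h.x_prime.dvd_or_dvd (Dvd.intro (u - u') (by linear_combination e) :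
    x ∣ y ^ (d + 1) * c)).resolve_left (h.not_dvd _)
  have : u = u' + y ^ (d + 1) * c := mul_left_cancel₀ h.x_prime.ne_zero (by rw [e]; ring)
  rw [this]
  exact add_mem hu' (Ideal.mul_mem_right _ _
    (Ideal.pow_le_pow_right (Nat.le_succ d) (Ideal.pow_mem_pow h.y_mem _)))

lemma mem_or_mem_pow_succ {i j : ℕ} {a b : R} (ha : a ∈ maximalIdeal R ^ i)
    (hb : b ∈ maximalIdeal R ^ j) (hab : a * b ∈ maximalIdeal R ^ (i + j + 1)) :
    a ∈ maximalIdeal R ^ (i + 1) ∨ b ∈ maximalIdeal R ^ (j + 1) := by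
  have base {k : ℕ} {u v : R} (huv : u * v ∈ maximalIdeal R ^ (k + 1)) :
      u ∈ maximalIdeal R ∨ v ∈ maximalIdeal R ^ (k + 1) := by
    by_cases hu : IsUnit u
    · exact Or.inr ((Ideal.unit_mul_mem_iff_mem _ hu).1 huv)
    · exact Or.inl hu
  have key {k : ℕ} {u c : R} (hc : c ∈ maximalIdeal R) (hu : u ∈ maximalIdeal R ^ (k + 1)) :
      x * u + y ^ (k + 1) * c ∈ maximalIdeal R ^ (k + 1 + 1) :=
    add_mem (by rw [pow_succ' _ (k + 1)]; exact Ideal.mul_mem_mul h.x_mem hu)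
      (by rw [pow_succ _ (k + 1)]; exact Ideal.mul_mem_mul (Ideal.pow_mem_pow h.y_mem _) hc)
  induction hn : i + j generalizing i j a b with
  | zero =>
    obtain ⟨rfl, rfl⟩ : i = 0 ∧ j = 0 := by omega
    simpa using base hab
  | succ n ih =>
    rcases i with _ | i
    · simpa using base (k := j) (by simpa using hab)
    rcases j with _ | j
    · simpa [or_comm] using base (k := i + 1) (by simpa [mul_comm] using hab)
    obtain ⟨a', ha', c, rfl⟩ := h.exists_eq_of_mem_pow_succ ha
    obtain ⟨b', hb', d, rfl⟩ := h.exists_eq_of_mem_pow_succ hb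
    have hcd : c * d ∈ maximalIdeal R := by
      obtain ⟨w, -, e, hw⟩ := h.exists_eq_of_mem_pow_succ hab
      have hx : x ∣ y ^ (i + 1 + (j + 1)) * (c * d - y * e) :=
        ⟨w - a' * (x * b' + y ^ (j + 1) * d) - y ^ (i + 1) * c * b', by
          linear_combination hw⟩
      obtain ⟨s, hs⟩ := (h.x_prime.dvd_or_dvd hx).resolve_left (h.not_dvd _)
      rw [sub_eq_iff_eq_add.1 hs]
      exact add_mem (Ideal.mul_mem_right _ _ h.x_mem) (Ideal.mul_mem_right _ _ h.y_mem)
    rcases (maximalIdeal.isMaximal R).isPrime.mem_or_mem hcd with hc | hd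
    · have h1 : a' * (x * b' + y ^ (j + 1) * d) ∈ maximalIdeal R ^ (i + (j + 1) + 1) := by
        refine h.mem_pow_of_x_mul_mem ?_
        have h2 : (y ^ (i + 1) * c) * (x * b' + y ^ (j + 1) * d) ∈
            maximalIdeal R ^ (i + (j + 1) + 1 + 1) := by
          have : i + (j + 1) + 1 + 1 = (i + 1 + 1) + (j + 1) := by ring
          rw [this, pow_add]
          refine Ideal.mul_mem_mul ?_ hb
          rw [pow_succ]
          exact Ideal.mul_mem_mul (Ideal.pow_mem_pow h.y_mem _) hc
        have h3 := sub_mem (show _ ∈ maximalIdeal R ^ (i + (j + 1) + 1 + 1) by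
          convert hab using 2; ring) h2
        convert h3 using 1
        ring
      rcases ih (i := i) (j := j + 1) ha' hb h1 (by omega) with h2 | h2
      · exact Or.inl (key hc h2)
      · exact Or.inr h2
    · have h1 : (x * a' + y ^ (i + 1) * c) * b' ∈ maximalIdeal R ^ (i + 1 + j + 1) := by
        refine h.mem_pow_of_x_mul_mem ?_
        have h2 : (x * a' + y ^ (i + 1) * c) * (y ^ (j + 1) * d) ∈
            maximalIdeal R ^ (i + 1 + j + 1 + 1) := by
          have : i + 1 + j + 1 + 1 = (i + 1) + (j + 1 + 1) := by ring
          rw [this, pow_add]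
          refine Ideal.mul_mem_mul ha ?_
          rw [pow_succ]
          exact Ideal.mul_mem_mul (Ideal.pow_mem_pow h.y_mem _) hd
        have h3 := sub_mem (show _ ∈ maximalIdeal R ^ (i + 1 + j + 1 + 1) by
          convert hab using 2; ring) h2
        convert h3 using 1
        ring
      rcases ih (i := i + 1) (j := j) ha hb' h1 (by omega) with h2 | h2
      · exact Or.inl h2
      · exact Or.inr (key hd h2)

lemma length_quotient_span_x_y_pow (k : ℕ) :
    Module.length R (R ⧸ Ideal.span {x, y ^ k}) = k := by
  induction k with
  | zero =>
    rw [Nat.cast_zero, Module.length_eq_zero_iff, Submodule.Quotient.subsingleton_iff]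
    exact (Ideal.eq_top_iff_one _).2 (Ideal.subset_span (by simp))
  | succ k ih =>
    rw [length_quotient_ideal_eq _ (Ideal.span {x, y ^ k}) y, ih]
    · have : Ideal.span {x, y ^ (k + 1)} ⊔ Ideal.span {y} = maximalIdeal R := by
        rw [h.max]
        refine le_antisymm (sup_le (Ideal.span_le.2 ?_) (Ideal.span_mono (by simp)))
          (Ideal.span_le.2 ?_)
        · rintro _ (rfl | rfl)
          · exact Ideal.subset_span (by simp)
          · rw [pow_succ]
            exact Ideal.mul_mem_left _ _ (Ideal.subset_span (by simp))
        · rintro _ (rfl | rfl)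
          · exact Ideal.mem_sup_left (Ideal.subset_span (by simp))
          · exact Ideal.mem_sup_right (Ideal.subset_span (by simp))
      rw [this, length_quotient_maximalIdeal, Nat.cast_succ]
    · intro l
      simp only [Ideal.mem_span_pair]
      constructor
      · rintro ⟨a, b, e⟩
        obtain ⟨w, hw, -⟩ := h.symm.reg (u := l - b * y ^ k) (v := a) (by rw [mul_sub, ← e]; ring)
        exact ⟨w, b, by linear_combination -hw⟩
      · rintro ⟨a, b, rfl⟩
        exact ⟨y * a, b, by ring⟩

lemma length_quotient_pow (k : ℕ) :
    Module.length R (R ⧸ maximalIdeal R ^ k) = ((k * (k + 1) / 2 : ℕ) : ℕ∞) := by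
  induction k with
  | zero =>
    rw [zero_mul, Nat.zero_div, Nat.cast_zero, Module.length_eq_zero_iff,
      Submodule.Quotient.subsingleton_iff, pow_zero, Ideal.one_eq_top]
  | succ k ih =>
    rw [length_quotient_ideal_eq _ (maximalIdeal R ^ k) x, ih]
    · have : maximalIdeal R ^ (k + 1) ⊔ Ideal.span {x} = Ideal.span {x, y ^ (k + 1)} := by
        refine le_antisymm (sup_le (fun z hz => ?_) (Ideal.span_mono (by simp)))
          (Ideal.span_le.2 ?_)
        · obtain ⟨u, -, c, rfl⟩ := h.exists_eq_of_mem_pow_succ hz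
          exact Ideal.mem_span_pair.2 ⟨u, c, by ring⟩
        · rintro _ (rfl | rfl)
          · exact Ideal.mem_sup_right (Ideal.subset_span (by simp))
          · exact Ideal.mem_sup_left (Ideal.pow_mem_pow h.y_mem _)
      rw [this, h.length_quotient_span_x_y_pow, ← Nat.cast_add]
      congr 1
      rw [← Nat.add_mul_div_right _ _ two_pos]
      congr 1
      ring
    · refine fun l => ⟨h.mem_pow_of_x_mul_mem, fun hl => ?_⟩
      rw [pow_succ']
      exact Ideal.mul_mem_mul h.x_mem hl

lemma succ_le_card_of_pow_le {ι : Type*} {d : ℕ} (s : Finset ι) (g : ι → R)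
    (hg : ∀ i ∈ s, g i ∈ maximalIdeal R ^ d)
    (hle : maximalIdeal R ^ d ≤ Ideal.span (g '' s) ⊔ maximalIdeal R ^ (d + 1)) :
    d + 1 ≤ s.card := by
  classical
  have key (t : Finset ι) (ht : ∀ i ∈ t, g i ∈ maximalIdeal R ^ d) :
      Module.length R (R ⧸ maximalIdeal R ^ (d + 1)) ≤
        t.card + Module.length R (R ⧸ (maximalIdeal R ^ (d + 1) ⊔ Ideal.span (g '' t))) := by
    induction t using Finset.induction_on with
    | empty =>
      rw [Finset.card_empty, Nat.cast_zero, zero_add]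
      exact length_quotient_anti (sup_le le_rfl (by simp))
    | insert i t hi ih =>
      refine (ih fun j hj => ht j (Finset.mem_insert_of_mem hj)).trans ?_
      rw [Finset.card_insert_of_notMem hi, Nat.cast_add, Nat.cast_one, add_assoc]
      gcongr
      refine (length_quotient_ideal_le _ (maximalIdeal R) (g i) fun l hl => ?_).trans ?_
      · refine Ideal.mem_sup_left ?_
        rw [pow_succ]
        exact Ideal.mul_mem_mul (ht i (Finset.mem_insert_self _ _)) hl
      · rw [length_quotient_maximalIdeal, sup_assoc, ← Ideal.span_union]
        gcongr
        refine length_quotient_anti (sup_le_sup le_rfl (Ideal.span_mono ?_))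
        rw [Finset.coe_insert, Set.image_insert_eq, Set.union_singleton]
  have h1 := (key s hg).trans (add_le_add_right (length_quotient_anti (sup_comm
    (Ideal.span (g '' s)) _ ▸ hle)) _)
  rw [h.length_quotient_pow, h.length_quotient_pow] at h1
  have h2 : (d + 1) * (d + 1 + 1) / 2 ≤ s.card + d * (d + 1) / 2 := by exact_mod_cast h1
  have h3 : (d + 1) * (d + 1 + 1) / 2 = d * (d + 1) / 2 + (d + 1) := by
    rw [← Nat.add_mul_div_right _ _ two_pos]
    congr 1
    ring
  omega

lemma mul_le_length_quotient_span_pair {m k : ℕ} {a b : R} (ha : a ∈ maximalIdeal R ^ m)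
    (hb : b ∈ maximalIdeal R ^ k) :
    ((m * k : ℕ) : ℕ∞) ≤ Module.length R (R ⧸ Ideal.span {a, b}) := by
  have h1 := length_quotient_ideal_le (maximalIdeal R ^ (m + k)) (maximalIdeal R ^ k) a
    fun l hl => pow_add (maximalIdeal R) m k ▸ Ideal.mul_mem_mul ha hl
  have h2 := length_quotient_ideal_le (maximalIdeal R ^ (m + k) ⊔ Ideal.span {a})
    (maximalIdeal R ^ m) b fun l hl => Ideal.mem_sup_left
      (pow_add (maximalIdeal R) m k ▸ mul_comm l b ▸ Ideal.mul_mem_mul hl hb)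
  have h3 := h1.trans (add_le_add_right (h2.trans (add_le_add_right (length_quotient_anti
    (N := Ideal.span {a, b}) (Ideal.span_le.2 ?_)) _)) _)
  · rw [h.length_quotient_pow, h.length_quotient_pow, h.length_quotient_pow] at h3
    have e : (m + k) * (m + k + 1) / 2 = k * (k + 1) / 2 + (m * (m + 1) / 2 + m * k) := by
      have := Nat.div_mul_cancel (Nat.even_mul_succ_self (m + k)).two_dvd
      have := Nat.div_mul_cancel (Nat.even_mul_succ_self m).two_dvd
      have := Nat.div_mul_cancel (Nat.even_mul_succ_self k).two_dvd
      nlinarith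
    rw [e] at h3
    push_cast at h3 ⊢
    exact (ENat.add_le_add_iff_left (ENat.natCast_ne_top _)).1
      ((ENat.add_le_add_iff_left (ENat.natCast_ne_top _)).1 h3)
  · rintro _ (rfl | rfl)
    · exact Ideal.mem_sup_left (Ideal.mem_sup_right (Ideal.subset_span rfl))
    · exact Ideal.mem_sup_right (Ideal.subset_span rfl)

end RegPair

end RegPair

section Rees

lemma exists_notMem_of_finset {R M ι : Type*} [CommRing R] [IsLocalRing R]
    [Infinite (ResidueField R)] [AddCommGroup M] [Module R M] (s : Finset ι)
    (p : ι → Submodule R M) (hp : ∀ i ∈ s, p i ≠ ⊤) : ∃ m, ∀ i ∈ s, m ∉ p i := by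
  by_contra! hcon
  obtain ⟨i, hi, hfin⟩ := AddSubgroup.exists_finiteIndex_of_leftCoset_cover (s := s)
    (H := fun i => (p i).toAddSubgroup) (g := fun _ => 0) (by
      refine Set.eq_univ_of_forall fun m => ?_
      obtain ⟨i, hi, hm⟩ := hcon m
      exact Set.mem_iUnion₂.2 ⟨i, hi, by simpa using hm⟩)
  obtain ⟨m, -, hm⟩ := SetLike.exists_of_lt (hp i hi).lt_top
  let f : R →+ M ⧸ (p i).toAddSubgroup :=
    (QuotientAddGroup.mk' _).comp (LinearMap.toSpanSingleton R M m).toAddMonoidHom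
  have hfin' : Finite (M ⧸ (p i).toAddSubgroup) := AddSubgroup.finite_quotient_of_finiteIndex
  obtain ⟨a, b, hab, e⟩ := Finite.exists_ne_map_eq_of_infinite
    (fun k : ResidueField R => f (Function.surjInv (residue_surjective (R := R)) k))
  rw [← sub_eq_zero, ← map_sub] at e
  have hu : ¬ IsUnit (Function.surjInv (residue_surjective (R := R)) a -
      Function.surjInv (residue_surjective (R := R)) b) := by
    intro hu
    refine hm ((Submodule.smul_mem_iff_of_isUnit _ hu).1 ?_)
    exact (QuotientAddGroup.eq_zero_iff _).1 e
  refine hab (sub_eq_zero.1 ?_)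
  have := (residue_eq_zero_iff _).2 ((mem_maximalIdeal _).2 hu)
  rwa [map_sub, Function.surjInv_eq residue_surjective,
    Function.surjInv_eq residue_surjective] at this

lemma exists_forall_le_height {R M S : Type*} [CommRing R] [IsLocalRing R]
    [Infinite (ResidueField R)] [AddCommGroup M] [Module R M] [CommRing S] [IsDomain S]
    [IsNoetherianRing S] [Algebra R S] (ℓ : M →ₗ[R] S) {a : R} (ha : a ∈ maximalIdeal R)
    (ha0 : algebraMap R S a ≠ 0) (n : ℕ) :
    ∃ c : Fin n → M, ∀ Q : Ideal S, Q.IsPrime → (maximalIdeal R).map (algebraMap R S) ≤ Q →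
      (∀ j, ℓ (c j) ∈ Q) → (∃ m, ℓ m ∉ Q) → ((n + 1 : ℕ) : ℕ∞) ≤ Q.height := by
  induction n with
  | zero =>
    refine ⟨Fin.elim0, fun Q hQ h1 _ _ => ?_⟩
    have : (⊥ : Ideal S) < Q := bot_lt_iff_ne_bot.2 fun h =>
      ha0 (by simpa [h] using h1 (Ideal.mem_map_of_mem _ ha))
    exact le_trans (by simp) (Ideal.height_add_one_le_of_lt_of_isPrime this)
  | succ n ih =>
    obtain ⟨c, hc⟩ := ih
    let J : Ideal S := (maximalIdeal R).map (algebraMap R S) ⊔ Ideal.span (Set.range (ℓ ∘ c))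
    let s := (Ideal.finite_minimalPrimes_of_isNoetherianRing S J).toFinset
    classical
    obtain ⟨m, hm⟩ := exists_notMem_of_finset
      (s.filter fun P => ((P.restrictScalars R).comap ℓ : Submodule R M) ≠ ⊤)
      (fun P => (P.restrictScalars R).comap ℓ) fun P hP => (Finset.mem_filter.1 hP).2
    refine ⟨Fin.snoc c m, fun Q hQ h1 h2 ⟨w, hw⟩ => ?_⟩
    have hJ : J ≤ Q := by
      refine sup_le h1 (Ideal.span_le.2 ?_)
      rintro _ ⟨j, rfl⟩
      simpa using h2 j.castSucc
    obtain ⟨P, hP, hPQ⟩ := Ideal.exists_minimalPrimes_le hJ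
    have hPp : P.IsPrime := hP.1.1
    have hJP : J ≤ P := hP.1.2
    have hwP : ℓ w ∉ P := fun h => hw (hPQ h)
    have hmP : ℓ m ∉ P := hm P (Finset.mem_filter.2
      ⟨by simpa [s] using hP, fun h => hwP (by simpa using h.ge (Submodule.mem_top (x := w)))⟩)
    have hlt : P < Q := lt_of_le_of_ne hPQ fun h => hmP (h ▸ by simpa using h2 (Fin.last n))
    have := hc P hPp (le_sup_left.trans hJP)
      (fun j => hJP (Ideal.mem_sup_right (Ideal.subset_span ⟨j, rfl⟩))) ⟨w, hwP⟩
    refine le_trans ?_ (Ideal.height_add_one_le_of_lt_of_isPrime hlt)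
    push_cast at this ⊢
    gcongr

lemma exists_subalgebra_ringKrullDim_le {R D : Type*} [CommRing R] [CommRing D] [IsDomain D]
    [Algebra R D] {A T : Subalgebra R D} (hAT : A ≤ T) [IsNoetherianRing A] {d : ℕ}
    (hd : ringKrullDim A ≤ d) (s : Finset D) (hs : ∀ z ∈ s, z ∈ T)
    (hsA : ∀ z ∈ s, ∃ a ∈ A, a ≠ 0 ∧ a * z ∈ A) :
    ∃ B : Subalgebra R D, A ≤ B ∧ B ≤ T ∧ (∀ z ∈ s, z ∈ B) ∧ IsNoetherianRing B ∧
      ringKrullDim B ≤ d := by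
  classical
  induction s using Finset.induction_on with
  | empty => exact ⟨A, le_rfl, hAT, by simp, inferInstance, hd⟩
  | insert z s hz ih =>
    obtain ⟨B, hAB, hBT, hsB, hB, hdB⟩ := ih (fun w hw => hs w (Finset.mem_insert_of_mem hw))
      fun w hw => hsA w (Finset.mem_insert_of_mem hw)
    let f : Polynomial B →ₐ[B] D := Polynomial.aeval z
    obtain ⟨a, ha, ha0, haz⟩ := hsA z (Finset.mem_insert_self _ _)
    have hBf : ∀ b ∈ B, b ∈ f.range := fun b hb => ⟨Polynomial.C ⟨b, hb⟩, by simp [f]⟩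
    refine ⟨f.range.restrictScalars R, fun b hb => hBf b (hAB hb), ?_, ?_, ?_, ?_⟩
    · rintro _ ⟨P, rfl⟩
      change Polynomial.aeval z P ∈ T
      rw [Polynomial.aeval_eq_sum_range]
      refine sum_mem fun i _ => ?_
      rw [Algebra.smul_def]
      exact mul_mem (hBT (P.coeff i).2) (pow_mem (hs z (Finset.mem_insert_self _ _)) i)
    · intro w hw
      rcases Finset.mem_insert.1 hw with rfl | hw
      · exact ⟨Polynomial.X, by simp [f]⟩
      · exact hBf w (hsB w hw)
    · exact isNoetherianRing_of_surjective _ f.range _ f.rangeRestrict_surjective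
    · have h1 := ringKrullDim_succ_le_of_surjective (f.rangeRestrict : Polynomial B →+* f.range)
        f.rangeRestrict_surjective
        (r := Polynomial.C ⟨a, hAB ha⟩ * Polynomial.X - Polynomial.C ⟨a * z, hAB haz⟩)
        (mem_nonZeroDivisors_of_ne_zero fun h => ha0 (by
          simpa using congrArg (fun P : Polynomial B => ((P.coeff 1 : B) : D)) h))
        (by ext; simp [f])
      rw [Polynomial.ringKrullDim_of_isNoetherianRing] at h1
      have h2 : ringKrullDim f.range + 1 ≤ (d : WithBot ℕ∞) + 1 := h1.trans (by gcongr)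
      exact ENat.WithBot.add_le_add_one_right_iff.1 h2

variable {R : Type*} [CommRing R] {r : ℕ}

/-- The linear form `∑ mᵢ Xᵢ` attached to a vector `m`. -/
noncomputable def linForm (R : Type*) [CommRing R] (r : ℕ) :
    (Fin r → R) →ₗ[R] MvPolynomial (Fin r) R :=
  Fintype.linearCombination R MvPolynomial.X

/-- The Rees algebra of a submodule of a free module. -/
noncomputable def reesAlg (M : Submodule R (Fin r → R)) : Subalgebra R (MvPolynomial (Fin r) R) :=
  Algebra.adjoin R (linForm R r '' M)

lemma linForm_mem_reesAlg {M : Submodule R (Fin r → R)} {m : Fin r → R} (hm : m ∈ M) :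
    linForm R r m ∈ reesAlg M :=
  Algebra.subset_adjoin ⟨m, hm, rfl⟩

lemma reesAlg_noetherian_and_ringKrullDim_le [IsDomain R] [IsNoetherianRing R] {d : ℕ}
    (hd : ringKrullDim R ≤ d) {M : Submodule R (Fin r → R)} {q : R} (hq : q ≠ 0)
    (hqM : ∀ i, q • Pi.single i (1 : R) ∈ M) :
    IsNoetherianRing (reesAlg M) ∧ ringKrullDim (reesAlg M) ≤ (d + r : ℕ) := by
  let f : MvPolynomial (Fin r) R →ₐ[R] MvPolynomial (Fin r) R :=
    MvPolynomial.aeval fun i => q • MvPolynomial.X i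
  have hX (i : Fin r) : q • MvPolynomial.X i ∈ f.range := ⟨MvPolynomial.X i, by simp [f]⟩
  have hA : f.range ≤ reesAlg M := by
    rw [← Algebra.adjoin_range_eq_range_aeval]
    refine Algebra.adjoin_mono ?_
    rintro _ ⟨i, rfl⟩
    exact ⟨_, hqM i, by simp [linForm]⟩
  have : IsNoetherianRing f.range :=
    isNoetherianRing_of_surjective _ f.range _ f.rangeRestrict_surjective
  obtain ⟨s, hs⟩ := IsNoetherian.noetherian M
  classical
  obtain ⟨B, -, hBM, hsB, hB, hdB⟩ := exists_subalgebra_ringKrullDim_le hA (d := d + r)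
    ((ringKrullDim_le_of_surjective (f.rangeRestrict : MvPolynomial (Fin r) R →+* f.range)
      f.rangeRestrict_surjective).trans (by
        rw [MvPolynomial.ringKrullDim_of_isNoetherianRing, Nat.card_fin]
        push_cast
        gcongr))
    (s.image (linForm R r))
    (fun z hz => by
      obtain ⟨m, hm, rfl⟩ := Finset.mem_image.1 hz
      exact linForm_mem_reesAlg (hs ▸ Submodule.subset_span hm))
    (fun z hz => by
      obtain ⟨m, hm, rfl⟩ := Finset.mem_image.1 hz
      refine ⟨algebraMap R _ q, f.range.algebraMap_mem q, by simpa using hq, ?_⟩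
      rw [← Algebra.smul_def, linForm, Fintype.linearCombination_apply, Finset.smul_sum]
      refine sum_mem fun i _ => ?_
      rw [smul_comm]
      exact f.range.smul_mem (hX i) _)
  have : B = reesAlg M := by
    refine le_antisymm hBM (Algebra.adjoin_le ?_)
    have : M ≤ (Subalgebra.toSubmodule B).comap (linForm R r) := by
      rw [← hs, Submodule.span_le]
      exact fun m hm => hsB _ (Finset.mem_image_of_mem _ hm)
    rintro _ ⟨m, hm, rfl⟩
    exact this hm
  subst this
  exact ⟨hB, hdB⟩

end Rees

section GenericColumns

lemma Valuation.exists_forall_mem_span_le {R Γ : Type*} [CommRing R] [IsNoetherianRing R]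
    [LinearOrderedCommMonoidWithZero Γ] (v : Valuation R Γ) (hv : ∀ a, v a ≤ 1) {S : Set R}
    (hS : S.Nonempty) : ∃ s ∈ S, ∀ z ∈ Ideal.span S, v z ≤ v s := by
  obtain ⟨T, hTS, hT⟩ := (Submodule.fg_span_iff_fg_span_finset_subset S).1
    (IsNoetherian.noetherian (Ideal.span S))
  have key {s : R} (hs : ∀ t ∈ T, v t ≤ v s) : ∀ z ∈ Ideal.span S, v z ≤ v s := by
    intro z hz
    rw [Ideal.span, hT] at hz
    induction hz using Submodule.span_induction with
    | mem t ht => exact hs t ht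
    | zero => simp
    | add a b _ _ ha hb => exact v.map_add_le ha hb
    | smul a b _ hb =>
      rw [smul_eq_mul, map_mul]
      exact (mul_le_mul' (hv a) hb).trans_eq (one_mul _)
  rcases T.eq_empty_or_nonempty with rfl | hne
  · obtain ⟨s, hs⟩ := hS
    exact ⟨s, hs, key (by simp)⟩
  · obtain ⟨s, hs, hmax⟩ := T.exists_max_image v hne
    exact ⟨s, hTS hs, key hmax⟩

lemma exists_det_ne_zero_or_exists_dot_eq_zero {k ι : Type*} [Field k] {r : ℕ}
    (a : ι → Fin r → k) :
    (∃ f : Fin r → ι, colDet (a ∘ f) ≠ 0) ∨ ∃ ξ : Fin r → k, ξ ≠ 0 ∧ ∀ j, ∑ i, ξ i * a j i = 0 := by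
  by_cases htop : Submodule.span k (Set.range a) = ⊤
  · left
    obtain ⟨g, hg, -, hli⟩ := Submodule.exists_fun_fin_finrank_span_eq k (Set.range a)
    have hr : Module.finrank k (Submodule.span k (Set.range a)) = r := by
      rw [htop, finrank_top, Module.finrank_fin_fun]
    generalize Module.finrank k (Submodule.span k (Set.range a)) = r' at g hg hli hr
    subst hr
    choose f hf using hg
    refine ⟨f, ?_⟩
    have : LinearIndependent k (Matrix.of fun i j => (a ∘ f) j i).col := by
      have e : (Matrix.of fun i j => (a ∘ f) j i).col = g := by
        ext j i
        simp [Matrix.col, ← hf]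
      rw [e]
      exact hli
    exact ((Matrix.isUnit_iff_isUnit_det _).1
      (Matrix.linearIndependent_cols_iff_isUnit.1 this)).ne_zero
  · right
    obtain ⟨φ, hφ0, hφ⟩ := Submodule.exists_le_ker_of_lt_top _ (lt_top_iff_ne_top.2 htop)
    refine ⟨fun i => φ (Pi.single i 1), fun h => hφ0 ?_, fun j => ?_⟩
    · refine LinearMap.pi_ext' fun i => LinearMap.ext_ring ?_
      exact congrFun h i
    · have : φ (a j) = 0 := hφ (Submodule.subset_span ⟨j, rfl⟩)
      rw [pi_eq_sum_univ' (a j), map_sum] at this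
      simpa [mul_comm] using this

variable {R : Type*} [CommRing R] [IsLocalRing R] {r : ℕ}

open Polynomial in
lemma exists_isPrime_of_valuation {K : Type*} [Field K] [Algebra R K] {V : ValuationSubring K}
    (hV : Dominates R V) {M : Submodule R (Fin r → R)} (η : (Fin r → K) →ₗ[K] K)
    (hη : ∀ m ∈ M, η (algebraMap R K ∘ m) ∈ V)
    (hM : ∃ m ∈ M, V.valuation (η (algebraMap R K ∘ m)) = 1) :
    ∃ Q P : Ideal (reesAlg M), Q.IsPrime ∧ P.IsPrime ∧ Q < P ∧
      (maximalIdeal R).map (algebraMap R (reesAlg M)) ≤ Q ∧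
      ∀ m (hm : m ∈ M), (⟨linForm R r m, linForm_mem_reesAlg hm⟩ : reesAlg M) ∈ Q ↔
        V.valuation (η (algebraMap R K ∘ m)) < 1 := by
  let Ψ : MvPolynomial (Fin r) R →+* K[X] :=
    MvPolynomial.eval₂Hom (C.comp (algebraMap R K)) fun i => C (η (Pi.single i 1)) * X
  have hΨ (m : Fin r → R) : Ψ (linForm R r m) = C (η (algebraMap R K ∘ m)) * X := by
    rw [pi_eq_sum_univ' (algebraMap R K ∘ m), linForm, Fintype.linearCombination_apply, map_sum,
      map_sum, map_sum, Finset.sum_mul]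
    refine Finset.sum_congr rfl fun i _ => ?_
    rw [MvPolynomial.smul_eq_C_mul, map_mul, map_smul, smul_eq_mul, C_mul]
    simp [Ψ, mul_assoc]
  let ι : V[X] →+* K[X] := mapRingHom (algebraMap V K)
  have hι : Function.Injective ι := map_injective _ (FaithfulSMul.algebraMap_injective V K)
  have hφ (a : R) : algebraMap R K a ∈ V := (V.valuation_le_one_iff _).1 (hV.le_one a)
  have hmem (f : reesAlg M) : Ψ f ∈ ι.range := by
    obtain ⟨f, hf⟩ := f
    induction hf using Algebra.adjoin_induction with
    | mem f hf =>
      obtain ⟨m, hm, rfl⟩ := hf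
      exact ⟨C ⟨_, hη m hm⟩ * X, by rw [hΨ]; simp [ι]⟩
    | algebraMap a => exact ⟨C ⟨_, hφ a⟩, by simp [ι, Ψ, MvPolynomial.algebraMap_eq]⟩
    | add f g _ _ hf hg => simpa using add_mem hf hg
    | mul f g _ _ hf hg => simpa using mul_mem hf hg
  let ρ : V[X] ≃+* ι.range := RingEquiv.ofBijective ι.rangeRestrict
    ⟨fun a b hab => hι (congrArg Subtype.val hab), ι.rangeRestrict_surjective⟩
  let θ : reesAlg M →+* V[X] :=
    (ρ.symm : ι.range →+* V[X]).comp ((Ψ.comp (reesAlg M).val.toRingHom).codRestrict _ hmem)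
  have hθ (f : reesAlg M) : ι (θ f) = Ψ f := congrArg Subtype.val (ρ.apply_symm_apply ⟨_, hmem f⟩)
  have hθm (m) (hm : m ∈ M) : θ ⟨linForm R r m, linForm_mem_reesAlg hm⟩ = C ⟨_, hη m hm⟩ * X :=
    hι (by rw [hθ, hΨ]; simp [ι])
  have hθa (a : R) : θ (algebraMap R _ a) = C ⟨_, hφ a⟩ :=
    hι (by rw [hθ]; simp [ι, Ψ, MvPolynomial.algebraMap_eq])
  let Θ : reesAlg M →+* (ResidueField V)[X] := (mapRingHom (residue V)).comp θ
  have hΘm (m) (hm : m ∈ M) : Θ ⟨linForm R r m, linForm_mem_reesAlg hm⟩ =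
      C (residue V ⟨_, hη m hm⟩) * X := by
    simp [Θ, hθm m hm]
  have hQ (m) (hm : m ∈ M) : (⟨linForm R r m, linForm_mem_reesAlg hm⟩ : reesAlg M) ∈
      RingHom.ker Θ ↔ V.valuation (η (algebraMap R K ∘ m)) < 1 := by
    rw [RingHom.mem_ker, hΘm m hm, mul_eq_zero, or_iff_left X_ne_zero, C_eq_zero,
      residue_eq_zero_iff, V.valuation_lt_one_iff]
  refine ⟨RingHom.ker Θ, RingHom.ker (constantCoeff.comp Θ), RingHom.ker_isPrime _,
    RingHom.ker_isPrime _, ?_, ?_, hQ⟩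
  · obtain ⟨m, hm, h1⟩ := hM
    refine SetLike.lt_iff_le_and_exists.2 ⟨fun f hf => ?_,
      ⟨linForm R r m, linForm_mem_reesAlg hm⟩, ?_, fun h => ?_⟩
    · rw [RingHom.mem_ker] at hf ⊢
      simp [hf]
    · rw [RingHom.mem_ker, RingHom.comp_apply, hΘm m hm]
      simp
    · exact ((hQ m hm).1 h).ne h1
  · rw [Ideal.map_le_iff_le_comap]
    intro a ha
    rw [Ideal.mem_comap, RingHom.mem_ker, RingHom.comp_apply, hθa, coe_mapRingHom, map_C,
      C_eq_zero, residue_eq_zero_iff, V.valuation_lt_one_iff]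
    exact hV.lt_one a ha

lemma exists_colDet_valuation_le [IsDomain R] [IsNoetherianRing R] [Infinite (ResidueField R)]
    (hdim : ringKrullDim R ≤ 2) (K : Type*) [Field K] [Algebra R K] [FaithfulSMul R K]
    {M : Submodule R (Fin r → R)} {q : R} (hq : q ≠ 0) (hqm : q ∈ maximalIdeal R)
    (hqM : ∀ i, q • Pi.single i (1 : R) ∈ M) :
    ∃ c : Fin (r + 1) → Fin r → R, (∀ j, c j ∈ M) ∧ ∀ V : ValuationSubring K, Dominates R V →
      ∃ f : Fin r → Fin (r + 1), ∀ z ∈ maxMinors M,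
        V.valuation (algebraMap R K z) ≤ V.valuation (algebraMap R K (colDet (c ∘ f))) := by
  obtain ⟨hN, hdim'⟩ := reesAlg_noetherian_and_ringKrullDim_le hdim hq hqM
  let ℓ : M →ₗ[R] reesAlg M :=
    ((linForm R r).comp M.subtype).codRestrict (Subalgebra.toSubmodule (reesAlg M))
      fun m => linForm_mem_reesAlg m.2
  obtain ⟨c, hc⟩ := exists_forall_le_height ℓ hqm (by simpa [Subtype.ext_iff] using hq) (r + 1)
  refine ⟨fun j => c j, fun j => (c j).2, fun V hV => ?_⟩
  have hinj := FaithfulSMul.algebraMap_injective R K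
  obtain ⟨_, ⟨w, hwM, rfl⟩, hw⟩ := (V.valuation.comap (algebraMap R K)).exists_forall_mem_span_le
    hV.le_one (S := {d | ∃ w : Fin r → Fin r → R, (∀ j, w j ∈ M) ∧ d = colDet w})
    ⟨_, fun i => q • Pi.single i 1, hqM, rfl⟩
  simp only [Valuation.comap_apply] at hw
  let W : Matrix (Fin r) (Fin r) K := Matrix.of fun i j => algebraMap R K (w j i)
  have hWdet : W.det = algebraMap R K (colDet w) := by
    rw [colDet, RingHom.map_det]; rfl
  have hW0 : W.det ≠ 0 := by
    intro h0
    have h1 := hw _ (Ideal.subset_span ⟨fun i => q • Pi.single i 1, hqM, rfl⟩)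
    rw [← hWdet, h0, map_zero, le_zero_iff, map_eq_zero, map_eq_zero_iff _ hinj] at h1
    have h2 : colDet (fun i => q • Pi.single i (1 : R) : Fin r → Fin r → R) = q ^ r := by
      have : (Matrix.of fun i j => (q • Pi.single j (1 : R) : Fin r → R) i) =
          Matrix.diagonal fun _ => q := by
        ext i j
        simp [Matrix.diagonal_apply, Pi.single_apply]
      rw [colDet, this]
      simp
    exact pow_ne_zero r hq (h2 ▸ h1)
  have hcr (m) (hm : m ∈ M) (i : Fin r) : W⁻¹.mulVec (algebraMap R K ∘ m) i ∈ V := by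
    have h1 := congrFun (Matrix.det_smul_inv_mulVec_eq_cramer W (algebraMap R K ∘ m)
      (isUnit_iff_ne_zero.2 hW0)) i
    have h2 : (W.updateCol i (algebraMap R K ∘ m)).det =
        algebraMap R K (colDet (Function.update w i m)) := by
      rw [colDet, RingHom.map_det]
      congr 1
      ext a b
      by_cases hb : b = i
      · subst hb; simp
      · simp [hb, W]
    rw [Pi.smul_apply, smul_eq_mul, Matrix.cramer_apply, h2] at h1
    have h3 := hw _ (Ideal.subset_span ⟨Function.update w i m, fun j => by
      by_cases hj : j = i
      · subst hj; simpa
      · simpa [hj] using hwM j, rfl⟩)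
    rw [← h1, map_mul, hWdet] at h3
    rw [← V.valuation_le_one_iff]
    have h4 : 0 < V.valuation (algebraMap R K (colDet w)) := by
      rw [zero_lt_iff, Valuation.ne_zero_iff, ← hWdet]
      exact hW0
    exact (mul_le_iff_le_one_right h4).1 h3
  let α : Fin (r + 1) → Fin r → V := fun j i => ⟨_, hcr (c j) (c j).2 i⟩
  rcases exists_det_ne_zero_or_exists_dot_eq_zero fun j i => residue V (α j i) with
    ⟨f, hf⟩ | ⟨ξ, hξ0, hξ⟩
  · refine ⟨f, fun z hz => (hw z hz).trans (le_of_eq ?_)⟩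
    have h1 : algebraMap R K (colDet ((fun j => (c j : Fin r → R)) ∘ f)) =
        W.det * (colDet (α ∘ f) : V) := by
      have h2 : ((colDet (α ∘ f) : V) : K) =
          (W⁻¹ * Matrix.of fun i j => algebraMap R K ((c (f j) : Fin r → R) i)).det := by
        change algebraMap V K _ = _
        rw [colDet, RingHom.map_det]
        rfl
      rw [h2, ← Matrix.det_mul, ← mul_assoc, Matrix.mul_nonsing_inv _ (isUnit_iff_ne_zero.2 hW0),
        one_mul, colDet, RingHom.map_det]
      rfl
    have h2 : V.valuation (colDet (α ∘ f) : V) = 1 := by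
      rw [← V.valuation_eq_one_iff, ← residue_ne_zero_iff_isUnit]
      convert hf
      rw [colDet, RingHom.map_det]
      rfl
    rw [h1, map_mul, h2, mul_one, hWdet]
  · exfalso
    choose ζ hζ using fun i => residue_surjective (ξ i)
    let η : (Fin r → K) →ₗ[K] K :=
      (Fintype.linearCombination K fun i => (ζ i : K)).comp W⁻¹.mulVecLin
    have hηm (m) (hm : m ∈ M) : η (algebraMap R K ∘ m) =
        (∑ i, ⟨_, hcr m hm i⟩ * ζ i : V) := by
      change _ = algebraMap V K _
      rw [map_sum]
      simp only [map_mul]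
      rfl
    have hηw (i : Fin r) : η (algebraMap R K ∘ w i) = ζ i := by
      have : W⁻¹.mulVec (algebraMap R K ∘ w i) = Pi.single i 1 := by
        have : algebraMap R K ∘ w i = W.mulVec (Pi.single i 1) := by
          ext j
          simp [W]
        rw [this, Matrix.mulVec_mulVec, Matrix.nonsing_inv_mul _ (isUnit_iff_ne_zero.2 hW0),
          Matrix.one_mulVec]
      simp [η, this, Fintype.linearCombination_apply, Pi.single_apply]
    obtain ⟨i, hi⟩ := Function.ne_iff.1 hξ0
    have hi1 : V.valuation (η (algebraMap R K ∘ w i)) = 1 := by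
      rw [hηw, ← V.valuation_eq_one_iff, ← residue_ne_zero_iff_isUnit, hζ]
      exact hi
    obtain ⟨Q, P, hQp, hPp, hlt, hmQ, hQ⟩ := exists_isPrime_of_valuation hV η
      (fun m hm => by rw [hηm m hm]; exact SetLike.coe_mem _) ⟨w i, hwM i, hi1⟩
    have h1 := hc Q hQp hmQ (fun j => (hQ _ (c j).2).2 (by
        rw [hηm _ (c j).2, ← V.valuation_lt_one_iff, ← residue_eq_zero_iff, map_sum, ← hξ j]
        simp only [map_mul, hζ]
        exact Finset.sum_congr rfl fun i _ => mul_comm _ _))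
      ⟨⟨w i, hwM i⟩, fun h => ((hQ _ (hwM i)).1 h).ne hi1⟩
    have h2 := (Ideal.height_add_one_le_of_lt_of_isPrime hlt)
    have h3 := (Ideal.height_le_ringKrullDim_of_ne_top hPp.ne_top).trans hdim'
    have h4 : ((r + 1 + 1 + 1 : ℕ) : ℕ∞) ≤ (2 + r : ℕ) := by
      have : (P.height : WithBot ℕ∞) ≤ ((2 + r : ℕ) : ℕ∞) := h3
      refine le_trans ?_ (WithBot.coe_le_coe.1 this)
      refine le_trans ?_ h2
      push_cast at h1 ⊢
      gcongr
    have : r + 1 + 1 + 1 ≤ 2 + r := by exact_mod_cast h4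
    omega

end GenericColumns

section ColDet

variable {R : Type*} [CommRing R]

lemma colDet_eq_det {r : ℕ} (w : Fin r → Fin r → R) : colDet w = Matrix.det (Matrix.of w) :=
  Matrix.det_transpose (Matrix.of w)

lemma colDet_mem_maxMinors {r : ℕ} {M : Submodule R (Fin r → R)} {w : Fin r → Fin r → R}
    (hw : ∀ j, w j ∈ M) : colDet w ∈ maxMinors M :=
  Ideal.subset_span ⟨w, hw, rfl⟩

/-- The signed maximal minors of a family of `n + 1` vectors in `R ^ n`. -/
def signedColDet {n : ℕ} (c : Fin (n + 1) → Fin n → R) (j : Fin (n + 1)) : R :=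
  (-1) ^ (j : ℕ) * colDet (c ∘ j.succAbove)

lemma det_cons_eq_sum {n : ℕ} (l : Fin (n + 1) → R) (c : Fin (n + 1) → Fin n → R) :
    Matrix.det (Matrix.of fun j => (Fin.cons (l j) (c j) : Fin (n + 1) → R)) =
      ∑ j, l j * signedColDet c j := by
  rw [Matrix.det_succ_column_zero]
  refine Finset.sum_congr rfl fun j _ => ?_
  rw [signedColDet, colDet_eq_det]
  simp only [Matrix.of_apply, Fin.cons_zero]
  have : (Matrix.of fun j => (Fin.cons (l j) (c j) : Fin (n + 1) → R)).submatrix j.succAbove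
      Fin.succ = Matrix.of (c ∘ j.succAbove) := by
    ext a b
    simp
  rw [this]
  ring

lemma sum_signedColDet_smul {n : ℕ} (c : Fin (n + 1) → Fin n → R) :
    ∑ j, signedColDet c j • c j = 0 := by
  ext i
  have := det_cons_eq_sum (fun j => c j i) c
  rw [Matrix.det_zero_of_column_eq (i := 0) (j := i.succ) (Fin.succ_ne_zero i).symm (by simp)]
    at this
  simpa [mul_comm] using this.symm

lemma colDet_comp_mem_span {n : ℕ} (c : Fin (n + 1) → Fin n → R) (f : Fin n → Fin (n + 1)) :
    colDet (c ∘ f) ∈ Ideal.span (Set.range (signedColDet c)) := by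
  by_cases hf : Function.Injective f
  · obtain ⟨j, hj⟩ : ∃ j, ∀ i, f i ≠ j := by
      by_contra! h
      have := Fintype.card_le_of_surjective f h
      simp at this
    choose s hs using fun i => Fin.exists_succAbove_eq (hj i)
    have hs' : Function.Injective s := fun a b e => hf (by rw [← hs, ← hs, e])
    let σ := Equiv.ofBijective s (Finite.injective_iff_bijective.1 hs')
    have e : Matrix.of (c ∘ f) = (Matrix.of (c ∘ j.succAbove)).submatrix σ id := by
      ext a b
      simp [σ, hs]
    rw [colDet_eq_det, e, Matrix.det_permute, ← colDet_eq_det]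
    have : colDet (c ∘ j.succAbove) = (-1) ^ (j : ℕ) * signedColDet c j := by
      rw [signedColDet, ← mul_assoc, ← mul_pow]
      simp
    rw [this]
    exact Ideal.mul_mem_left _ _ (Ideal.mul_mem_left _ _ (Ideal.subset_span ⟨j, rfl⟩))
  · obtain ⟨a, b, e, hab⟩ := Function.not_injective_iff.1 hf
    rw [colDet_eq_det, Matrix.det_zero_of_row_eq hab (by funext i; simp [e])]
    exact zero_mem _

lemma det_cons_mulVec {n : ℕ} (W : Matrix (Fin (n + 1)) (Fin (n + 1)) R) (l : Fin (n + 1) → R)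
    (c : Fin (n + 1) → Fin n → R) :
    ∑ j, W.mulVec l j * signedColDet (fun j => ∑ i, W j i • c i) j =
      W.det * ∑ j, l j * signedColDet c j := by
  rw [← det_cons_eq_sum, ← det_cons_eq_sum, ← Matrix.det_mul]
  congr 1
  ext a b
  refine Fin.cases ?_ (fun b => ?_) b
  · simp [Matrix.mul_apply, Matrix.mulVec, dotProduct]
  · simp [Matrix.mul_apply]

lemma colDet_mem_of_forall_mem {r : ℕ} {I : Ideal R} (w : Fin r → Fin r → R) {j : Fin r}
    (hw : ∀ i, w j i ∈ I) : colDet w ∈ I := by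
  rw [colDet, Matrix.det_apply]
  refine Ideal.sum_mem _ fun σ _ => ?_
  rw [Units.smul_def, zsmul_eq_mul]
  refine Ideal.mul_mem_left _ _ ?_
  rw [← Finset.mul_prod_erase _ _ (Finset.mem_univ j)]
  exact Ideal.mul_mem_right _ _ (hw _)

end ColDet

section Reduction

variable {R : Type*} [CommRing R] [IsLocalRing R]

lemma exists_isUnit_det_of_linearIndependent {n : ℕ} {l : Fin 2 → Fin (n + 2) → R}
    (hl : LinearIndependent (ResidueField R) fun a i => residue R (l a i)) :
    ∃ P : Matrix (Fin (n + 2)) (Fin (n + 2)) R,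
      IsUnit P.det ∧ (∀ i, P 0 i = l 0 i) ∧ ∀ i, P 1 i = l 1 i := by
  classical
  set b := Module.Basis.sumExtend hl
  have hb (a) : b (Sum.inl a) = fun i => residue R (l a i) := by
    simp [b, Module.Basis.sumExtend]
    rfl
  have : Finite (Fin 2 ⊕ Module.Basis.sumExtendIndex hl) := Module.Finite.finite_basis b
  have : Finite (Module.Basis.sumExtendIndex hl) :=
    Finite.of_injective (Sum.inr : _ → Fin 2 ⊕ Module.Basis.sumExtendIndex hl) Sum.inr_injective
  have hc : Nat.card (Module.Basis.sumExtendIndex hl) = n := by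
    have := Module.finrank_eq_nat_card_basis b
    rw [Nat.card_sum, Module.finrank_fintype_fun_eq_card, Fintype.card_fin, Nat.card_fin] at this
    omega
  let e := Finite.equivFinOfCardEq hc
  let σ : Fin (n + 2) → Fin 2 ⊕ Module.Basis.sumExtendIndex hl :=
    Fin.cons (.inl 0) (Fin.cons (.inl 1) fun j => .inr (e.symm j))
  have hσ : Function.Injective σ := by
    rw [Fin.cons_injective_iff, Fin.cons_injective_iff]
    refine ⟨?_, ?_, fun a b h => by simpa using h⟩
    · rintro ⟨a, h⟩
      refine Fin.cases (fun h => ?_) (fun a h => ?_) a h <;> simp at h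
    · rintro ⟨a, h⟩
      simp at h
  choose g hg using fun j i => residue_surjective (b (.inr (e.symm j)) i)
  refine ⟨Matrix.of (Fin.cons (l 0) (Fin.cons (l 1) g)), ?_, fun _ => rfl, fun _ => rfl⟩
  rw [← residue_ne_zero_iff_isUnit, RingHom.map_det, ← isUnit_iff_ne_zero,
    ← Matrix.isUnit_iff_isUnit_det, ← Matrix.linearIndependent_rows_iff_isUnit]
  have hli := b.linearIndependent.comp σ hσ
  have he : b ∘ σ = ((residue R).mapMatrix
      (Matrix.of (Fin.cons (l 0) (Fin.cons (l 1) g)))).row := by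
    funext j
    refine Fin.cases ?_ (fun j => Fin.cases ?_ (fun j => ?_) j) j
    · exact hb 0
    · exact hb 1
    · funext i
      exact (hg j i).symm
  rw [he] at hli
  exact hli

end Reduction

section ReductionColumns

variable {R K : Type*} [CommRing R] [IsLocalRing R] [Field K] [Algebra R K]

omit [IsLocalRing R] in
lemma valuation_le_max_of_mem_span_pair {Γ : Type*} [LinearOrderedCommGroupWithZero Γ]
    (v : Valuation R Γ) (hv : ∀ a, v a ≤ 1) {d₀ d₁ z : R} (hz : z ∈ Ideal.span {d₀, d₁}) :
    v z ≤ max (v d₀) (v d₁) := by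
  obtain ⟨a, b, rfl⟩ := Ideal.mem_span_pair.1 hz
  refine v.map_add_le ?_ ?_ <;> rw [map_mul]
  · exact (mul_le_of_le_one_left' (hv a)).trans (le_max_left _ _)
  · exact (mul_le_of_le_one_left' (hv b)).trans (le_max_right _ _)

lemma memIntClosure_span_pair_of_dominates [FaithfulSMul R K] {d₀ d₁ z : R}
    (h : ∀ V : ValuationSubring K, Dominates R V → V.valuation (algebraMap R K z) ≤
      max (V.valuation (algebraMap R K d₀)) (V.valuation (algebraMap R K d₁))) :
    MemIntClosure (Ideal.span {d₀, d₁}) z := by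
  refine memIntClosure_of_dominates (K := K) fun V hV => ?_
  rcases le_max_iff.1 (h V hV) with h | h
  · exact ⟨d₀, Ideal.subset_span (by simp), h⟩
  · exact ⟨d₁, Ideal.subset_span (by simp), h⟩

omit [IsLocalRing R] in
lemma valuation_le_max_of_memIntClosure {V : ValuationSubring K} (hV : ∀ a, algebraMap R K a ∈ V)
    {d₀ d₁ z : R} (h : MemIntClosure (Ideal.span {d₀, d₁}) z) :
    V.valuation (algebraMap R K z) ≤
      max (V.valuation (algebraMap R K d₀)) (V.valuation (algebraMap R K d₁)) := by
  obtain ⟨a, ha, hle⟩ :=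
    exists_le_valuation_of_memIntClosure (V.valuation.comap (algebraMap R K)) h
  exact hle.trans (valuation_le_max_of_mem_span_pair (V.valuation.comap (algebraMap R K))
    (fun a => (V.valuation_le_one_iff _).2 (hV a)) ha)

lemma RegPair.exists_dominates_lt {x y : R} (h : RegPair R x y) [IsFractionRing R K]
    {I : Ideal R} {a b : ℕ} (hx : x ^ a ∈ I) (hy : y ^ b ∈ I) {e : R} (he : e ∈ maximalIdeal R) :
    ∃ V : ValuationSubring K, Dominates R V ∧
      ∃ z ∈ I, V.valuation (algebraMap R K e) < V.valuation (algebraMap R K z) := by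
  have := h.dom
  have hinj := IsFractionRing.injective R K
  by_contra! hcon
  have hdvd : ∀ z ∈ I, e ∣ z := by
    intro z hz
    have hle : ∀ V : ValuationSubring K, (∀ a, algebraMap R K a ∈ V) →
        V.valuation (algebraMap R K z) ≤ V.valuation (algebraMap R K e) := fun V hV => by
      simpa using valuation_le_max_of_memIntClosure hV
        (memIntClosure_span_pair_of_dominates (d₀ := e) (d₁ := e)
          fun V hV => by simpa using hcon V hV z hz)
    rcases eq_or_ne e 0 with rfl | he0
    · have := hle ⊤ fun _ => trivial
      rw [map_zero, map_zero, le_zero_iff, map_eq_zero, map_eq_zero_iff _ hinj] at this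
      simp [this]
    have he0' : algebraMap R K e ≠ 0 := by rwa [Ne, map_eq_zero_iff _ hinj]
    obtain ⟨c, hc⟩ := (h.reg2 K).normal (mem_icl.2 fun V hV => (V.valuation_le_one_iff _).1 (by
      rw [map_div₀]
      exact div_le_one_of_le₀ (hle V fun a => hV ⟨a, rfl⟩) zero_le) :
        algebraMap R K z / algebraMap R K e ∈ _)
    refine ⟨c, hinj ?_⟩
    rw [map_mul, hc]
    field_simp
  obtain ⟨i, -, hi⟩ := (dvd_prime_pow h.x_prime _).1 (hdvd _ hx)
  rcases i with - | i
  · rw [pow_zero, associated_one_iff_isUnit] at hi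
    exact (mem_maximalIdeal _).1 he hi
  · exact h.not_dvd b (((dvd_pow_self x i.succ_ne_zero).trans hi.symm.dvd).trans (hdvd _ hy))

/-- Two coefficient vectors of a generic two-element reduction are independent. -/
lemma linearIndependent_of_reduction {n : ℕ} {D : Fin n → R} {l : Fin 2 → Fin n → R} {e : Fin 2 → R}
    (hl : ∀ a, ∑ j, l a j * D j = e a)
    (hle : ∀ V : ValuationSubring K, Dominates R V → ∀ j, V.valuation (algebraMap R K (D j)) ≤
      max (V.valuation (algebraMap R K (e 0))) (V.valuation (algebraMap R K (e 1))))
    (hnot : ∀ a, ∃ V : ValuationSubring K, Dominates R V ∧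
      ∃ j, V.valuation (algebraMap R K (e a)) < V.valuation (algebraMap R K (D j))) :
    LinearIndependent (ResidueField R) fun a i => residue R (l a i) := by
  have key : ∀ a b : Fin 2, a ≠ b → ∀ s : ResidueField R,
      ∃ j, residue R (l a j) ≠ s * residue R (l b j) := by
    intro a b hab s
    by_contra! hcon
    obtain ⟨s, rfl⟩ := residue_surjective s
    obtain ⟨V, hV, j, hj⟩ := hnot b
    have hmax : ∀ j, V.valuation (algebraMap R K (D j)) ≤
        max (V.valuation (algebraMap R K (e a))) (V.valuation (algebraMap R K (e b))) := by
      obtain ⟨rfl, rfl⟩ | ⟨rfl, rfl⟩ : a = 0 ∧ b = 1 ∨ a = 1 ∧ b = 0 := by omega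
      · exact hle V hV
      · exact fun j => (hle V hV j).trans_eq (max_comm _ _)
    have h1 : V.valuation (algebraMap R K (e b)) < V.valuation (algebraMap R K (e a)) := by
      by_contra! h1
      exact (hj.trans_le (hmax j)).not_ge (max_le h1 le_rfl)
    have h0 : 0 < V.valuation (algebraMap R K (e a)) := zero_le.trans_lt h1
    have h2 : e a = s * e b + ∑ j, (l a j - s * l b j) * D j := by
      simp only [sub_mul, Finset.sum_sub_distrib, ← hl, Finset.mul_sum, mul_assoc]
      ring
    have h3 : V.valuation (algebraMap R K (e a)) < V.valuation (algebraMap R K (e a)) := by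
      conv_lhs => rw [h2, map_add, map_sum]
      refine (V.valuation.map_add _ _).trans_lt (max_lt ?_ ?_)
      · rw [map_mul, map_mul]
        exact (mul_le_of_le_one_left' (hV.le_one s)).trans_lt h1
      · refine V.valuation.map_sum_lt h0.ne' fun j _ => ?_
        rw [map_mul, map_mul]
        have hm : l a j - s * l b j ∈ maximalIdeal R := by
          rw [← residue_eq_zero_iff, map_sub, map_mul, hcon j, sub_self]
        have := hmax j
        rw [max_eq_left h1.le] at this
        exact (mul_le_mul_right this _).trans_lt (mul_lt_of_lt_one_left h0 (hV.lt_one _ hm))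
    exact h3.false
  refine linearIndependent_fin2.2 ⟨fun h0 => ?_, fun a h0 => ?_⟩
  · obtain ⟨j, hj⟩ := key 1 0 (by simp) 0
    exact hj ((congrFun h0 j).trans (by simp))
  · obtain ⟨j, hj⟩ := key 0 1 (by simp) a
    exact hj (congrFun h0 j).symm

omit [IsLocalRing R] in
lemma pow_mem_maxMinors {r : ℕ} {M : Submodule R (Fin r → R)} {q : R}
    (hq : ∀ i, q • Pi.single i (1 : R) ∈ M) : q ^ r ∈ maxMinors M := by
  have := colDet_mem_maxMinors (w := fun j => q • Pi.single j (1 : R)) (M := M) hq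
  rw [colDet_eq_det] at this
  convert this using 1
  have : (Matrix.of fun j => q • Pi.single j (1 : R) : Matrix (Fin r) (Fin r) R) =
      Matrix.diagonal fun _ => q := by
    ext i j
    simp [Matrix.diagonal_apply, Pi.single_apply, eq_comm]
  rw [this]
  simp

/-- Generic columns of `M`: a two-element reduction of the ideal of maximal minors formed by
determinants sharing all but one column. -/
lemma exists_reduction_columns [Infinite (ResidueField R)] [IsFractionRing R K] {x y : R}
    (h : RegPair R x y) (hdim : ringKrullDim R ≤ 2) {k : ℕ} {M : Submodule R (Fin (k + 1) → R)}
    (hM : ∀ v ∈ M, ∀ i, v i ∈ maximalIdeal R) {N : ℕ}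
    (hx : ∀ i, x ^ N • Pi.single i (1 : R) ∈ M) (hy : ∀ i, y ^ N • Pi.single i (1 : R) ∈ M) :
    ∃ (u₀ u₁ : Fin (k + 1) → R) (b : Fin k → Fin (k + 1) → R) (g : Fin k → R),
      u₀ ∈ M ∧ u₁ ∈ M ∧ (∀ j, b j ∈ M) ∧
      colDet (Fin.cons u₀ b : Fin (k + 1) → _) ≠ 0 ∧ colDet (Fin.cons u₁ b : Fin (k + 1) → _) ≠ 0 ∧
      (∀ j, g j ∈ maxMinors M) ∧
      colDet (Fin.cons u₁ b : Fin (k + 1) → _) • u₀ - colDet (Fin.cons u₀ b : Fin (k + 1) → _) • u₁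
        = ∑ j, g j • b j ∧
      ∀ z ∈ maxMinors M, MemIntClosure (Ideal.span
        {colDet (Fin.cons u₀ b : Fin (k + 1) → _),
          colDet (Fin.cons u₁ b : Fin (k + 1) → _)}) z := by
  have := h.dom
  have := h.noeth
  have hinj := IsFractionRing.injective R K
  have hN : N ≠ 0 := by
    rintro rfl
    have := hM _ (hx 0) 0
    simp at this
  have hxI := pow_mem_maxMinors hx
  have hyI := pow_mem_maxMinors hy
  rw [← pow_mul] at hxI hyI
  have hIm : maxMinors M ≤ maximalIdeal R := Ideal.span_le.2 (by
    rintro _ ⟨w, hw, rfl⟩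
    exact colDet_mem_of_forall_mem w (hM _ (hw 0)))
  obtain ⟨c, hcM, hc⟩ := exists_colDet_valuation_le hdim K (pow_ne_zero N h.x_prime.ne_zero)
    (Ideal.pow_mem_of_mem _ h.x_mem _ hN.bot_lt) hx
  set D := signedColDet c with hD
  have hDI : ∀ j, D j ∈ maxMinors M := fun j =>
    Ideal.mul_mem_left _ _ (colDet_mem_maxMinors fun i => hcM _)
  obtain ⟨q, hq, hq0⟩ : ∃ q ∈ Ideal.span (Set.range D), q ≠ 0 := by
    by_contra! hcon
    obtain ⟨V, hV, z, hz, hlt⟩ := h.exists_dominates_lt (K := K) hxI hyI (zero_mem _)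
    obtain ⟨f, hf⟩ := hc V hV
    have := hf z hz
    rw [hcon _ (colDet_comp_mem_span c f)] at this
    exact this.not_gt hlt
  have hDI' : Ideal.span (Set.range D) ≤ maxMinors M := Ideal.span_le.2 (by
    rintro _ ⟨j, rfl⟩
    exact hDI j)
  let L : Submodule R (Fin 1 → R) := Submodule.comap (LinearMap.proj 0 : (Fin 1 → R) →ₗ[R] R)
    (Ideal.span (Set.range D))
  obtain ⟨e, heL, he⟩ := exists_colDet_valuation_le hdim K (M := L) hq0 (hIm (hDI' hq)) (fun i => by
    obtain rfl := Subsingleton.elim i 0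
    simpa [L] using hq)
  have hL : ∀ z ∈ Ideal.span (Set.range D), z ∈ maxMinors L := fun z hz => by
    have := colDet_mem_maxMinors (M := L) (w := fun _ _ => z) (fun _ => hz)
    simpa [colDet] using this
  choose l hl using fun a => Ideal.mem_span_range_iff_exists_fun.1 (heL a)
  have hred : ∀ V : ValuationSubring K, Dominates R V → ∀ z ∈ maxMinors M,
      V.valuation (algebraMap R K z) ≤
      max (V.valuation (algebraMap R K (e 0 0))) (V.valuation (algebraMap R K (e 1 0))) := by
    intro V hV z hz
    obtain ⟨f, hf⟩ := hc V hV
    obtain ⟨f', hf'⟩ := he V hV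
    have := (hf z hz).trans (hf' _ (hL _ (colDet_comp_mem_span c f)))
    simp only [colDet, Matrix.det_fin_one, Matrix.of_apply, Function.comp] at this
    rcases (show ∀ i : Fin 2, i = 0 ∨ i = 1 by decide) (f' 0) with h | h <;> rw [h] at this
    · exact le_max_of_le_left this
    · exact le_max_of_le_right this
  have heI : ∀ a, e a 0 ∈ maxMinors M := fun a => hDI' (heL a)
  have hli : LinearIndependent (ResidueField R) fun a i => residue R (l a i) := by
    refine linearIndependent_of_reduction (K := K) (e := fun a => e a 0) hl
      (fun V hV j => hred V hV _ (hDI j)) fun a => ?_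
    obtain ⟨V, hV, z, hz, hlt⟩ := h.exists_dominates_lt (K := K) hxI hyI (hIm (heI a))
    obtain ⟨f, hf⟩ := hc V hV
    by_contra! hcon
    have h1 : ∀ s ∈ Ideal.span (Set.range D),
        V.valuation (algebraMap R K s) ≤ V.valuation (algebraMap R K (e a 0)) := by
      intro s hs
      obtain ⟨t, rfl⟩ := Ideal.mem_span_range_iff_exists_fun.1 hs
      rw [map_sum]
      refine V.valuation.map_sum_le fun j _ => ?_
      rw [map_mul, map_mul]
      exact (mul_le_of_le_one_left' (hV.le_one _)).trans (hcon V hV j)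
    exact ((hf z hz).trans (h1 _ (colDet_comp_mem_span c f))).not_gt hlt
  obtain ⟨P, hP, hP0, hP1⟩ := exists_isUnit_det_of_linearIndependent hli
  set W := (P.transpose)⁻¹ with hW
  have hWP : W * P.transpose = 1 := Matrix.nonsing_inv_mul _ (by rwa [Matrix.det_transpose])
  have hWu : IsUnit W.det := by
    refine IsUnit.of_mul_eq_one (P.transpose).det ?_
    rw [← Matrix.det_mul, hWP, Matrix.det_one]
  set c' : Fin (k + 2) → Fin (k + 1) → R := fun j => ∑ i, W j i • c i with hc'
  have hc'M : ∀ j, c' j ∈ M := fun j => sum_mem fun i _ => M.smul_mem _ (hcM i)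
  have hcoef : ∀ (a : Fin (k + 2)) (t : Fin (k + 2) → R) (_ : ∀ i, P a i = t i),
      signedColDet c' a = W.det * ∑ j, t j * D j := by
    intro a t ht
    rw [← det_cons_mulVec, show W.mulVec t = Pi.single a 1 by
      funext i
      have := congrFun (congrFun hWP i) a
      rw [Matrix.mul_apply, Matrix.one_apply] at this
      simpa [Matrix.mulVec, dotProduct, ht, Pi.single_apply] using this]
    simp [Pi.single_apply, hc']
  have hD0 : signedColDet c' 0 = W.det * e 0 0 := by rw [hcoef 0 _ hP0, hl 0]; rfl
  have hD1 : signedColDet c' 1 = W.det * e 1 0 := by rw [hcoef 1 _ hP1, hl 1]; rfl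
  have he0 : ∀ a, e a 0 ≠ 0 := by
    intro a ha
    obtain ⟨V, hV, z, hz, hlt⟩ :=
      h.exists_dominates_lt (K := K) hxI hyI (hIm (heI (if a = 0 then 1 else 0)))
    have := hred V hV z hz
    rcases (show ∀ i : Fin 2, i = 0 ∨ i = 1 by decide) a with rfl | rfl <;>
      simp only [ha, map_zero, if_true, one_ne_zero, if_false] at this hlt
    · exact this.not_gt (max_lt (zero_le.trans_lt hlt) hlt)
    · exact this.not_gt (max_lt hlt (zero_le.trans_lt hlt))
  have hd0 : colDet (Fin.cons (c' 1) fun j : Fin k => c' j.succ.succ : Fin (k + 1) → _) =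
      W.det * e 0 0 := by
    rw [← hD0, signedColDet]
    simp only [Fin.val_zero, pow_zero, one_mul]
    congr 1
    funext j
    refine Fin.cases rfl (fun j => rfl) j
  have hd1 : colDet (Fin.cons (c' 0) fun j : Fin k => c' j.succ.succ : Fin (k + 1) → _) =
      -(W.det * e 1 0) := by
    rw [← hD1, signedColDet]
    simp only [Fin.val_one, pow_one, neg_mul, one_mul, neg_neg]
    congr 1
    funext j
    refine Fin.cases rfl (fun j => rfl) j
  refine ⟨c' 1, c' 0, fun j => c' j.succ.succ, fun j => signedColDet c' j.succ.succ, hc'M _, hc'M _,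
    fun j => hc'M _, ?_, ?_, fun j => ?_, ?_, fun z hz => ?_⟩
  · rw [hd0]
    exact mul_ne_zero hWu.ne_zero (he0 0)
  · rw [hd1]
    exact neg_ne_zero.2 (mul_ne_zero hWu.ne_zero (he0 1))
  · exact Ideal.mul_mem_left _ _ (colDet_mem_maxMinors fun i => hc'M _)
  · have := sum_signedColDet_smul c'
    rw [Fin.sum_univ_succ, Fin.sum_univ_succ, hD0, Fin.succ_zero_eq_one, hD1] at this
    rw [hd0, hd1]
    rw [← add_assoc] at this
    rw [← sub_eq_zero, ← neg_eq_zero, ← this]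
    module
  · refine memIntClosure_span_pair_of_dominates (K := K) fun V hV => ?_
    have hW1 : V.valuation (algebraMap R K W.det) = 1 := by
      obtain ⟨w, hw⟩ := hWu.exists_left_inv
      refine le_antisymm (hV.le_one _) ?_
      rw [← map_one V.valuation, ← map_one (algebraMap R K), ← hw, map_mul, map_mul]
      exact mul_le_of_le_one_left' (hV.le_one w)
    rw [hd0, hd1, map_neg, Valuation.map_neg, map_mul, map_mul, map_mul, map_mul, hW1, one_mul,
      one_mul]
    exact hred V hV z hz

end ReductionColumns

section ColDetLinear

variable {R : Type*} [CommRing R]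

lemma colDet_eq_detRowAlternating {r : ℕ} (w : Fin r → Fin r → R) :
    colDet w = Matrix.detRowAlternating w :=
  colDet_eq_det w

lemma colDet_update_sum {r : ℕ} (w : Fin r → Fin r → R) (j : Fin r) {ι : Type*} (s : Finset ι)
    (q : ι → R) (c : ι → Fin r → R) :
    colDet (Function.update w j (∑ i ∈ s, q i • c i)) =
      ∑ i ∈ s, q i * colDet (Function.update w j (c i)) := by
  simp only [colDet_eq_detRowAlternating, AlternatingMap.map_update_sum,
    AlternatingMap.map_update_smul, smul_eq_mul]

/-- The linear form `v ↦ det (v, b₀, b₁, …)`. -/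
def colDetLin {k : ℕ} (b : Fin k → Fin (k + 1) → R) : (Fin (k + 1) → R) →ₗ[R] R :=
  (Matrix.detRowAlternating (n := Fin (k + 1)) (R := R)).toMultilinearMap.toLinearMap
    (Fin.cons 0 b) 0

lemma colDetLin_apply {k : ℕ} (b : Fin k → Fin (k + 1) → R) (v : Fin (k + 1) → R) :
    colDetLin b v = colDet (Fin.cons v b : Fin (k + 1) → Fin (k + 1) → R) := by
  rw [colDet_eq_detRowAlternating]
  exact congrArg Matrix.detRowAlternating
    (Fin.update_cons_zero (α := fun _ => Fin (k + 1) → R) 0 b v)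

lemma algebraMap_colDet_eq_sum {K : Type*} [Field K] [Algebra R K] {r : ℕ}
    (w : Fin r → Fin r → R) (j : Fin r) {ι : Type*} [Fintype ι] (q : ι → K) (c : ι → Fin r → R)
    (h : ∀ i, algebraMap R K (w j i) = ∑ s, q s * algebraMap R K (c s i)) :
    algebraMap R K (colDet w) =
      ∑ s, q s * algebraMap R K (colDet (Function.update w j (c s))) := by
  have key : ∀ w : Fin r → Fin r → R, algebraMap R K (colDet w) =
      colDet fun j i => algebraMap R K (w j i) := fun w => RingHom.map_det _ _
  have e : (fun j i => algebraMap R K (w j i)) =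
      Function.update (fun j i => algebraMap R K (w j i)) j
      (∑ s, q s • fun i => algebraMap R K (c s i)) := by
    refine (Function.update_eq_self_iff.2 ?_).symm
    funext i
    simp [h]
  rw [key, e, colDet_update_sum]
  refine Finset.sum_congr rfl fun s _ => ?_
  rw [key]
  congr 2
  funext l i
  by_cases hl : l = j
  · subst hl
    simp
  · simp [hl]

lemma exists_valuation_colDet_le {K : Type*} [Field K] [Algebra R K] {V : ValuationSubring K}
    {r : ℕ} {M : Submodule R (Fin r → R)} {w : Fin r → Fin r → R} {j : Fin r}
    (hw : ∀ i, i ≠ j → w i ∈ M) {ι : Type*} [Fintype ι] {q : ι → K} (hq : ∀ s, q s ∈ V)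
    {c : ι → Fin r → R} (hc : ∀ s, c s ∈ M)
    (h : ∀ i, algebraMap R K (w j i) = ∑ s, q s * algebraMap R K (c s i)) :
    ∃ a ∈ maxMinors M, V.valuation (algebraMap R K (colDet w)) ≤ V.valuation (algebraMap R K a) := by
  have hmem : ∀ s, colDet (Function.update w j (c s)) ∈ maxMinors M := fun s =>
    colDet_mem_maxMinors fun i => by
      by_cases hi : i = j
      · subst hi
        simpa using hc s
      · simpa [hi] using hw i hi
  by_contra! hcon
  have h0 := hcon 0 (zero_mem _)
  rw [map_zero, map_zero] at h0
  have : V.valuation (algebraMap R K (colDet w)) < V.valuation (algebraMap R K (colDet w)) := by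
    conv_lhs => rw [algebraMap_colDet_eq_sum w j q c h]
    refine V.valuation.map_sum_lt h0.ne' fun s _ => ?_
    rw [map_mul]
    exact (mul_le_of_le_one_left' ((V.valuation_le_one_iff _).2 (hq s))).trans_lt (hcon _ (hmem s))
  exact this.false

end ColDetLinear

section FiniteChains

lemma chainLT_of_length_quotient {A : Type*} [CommRing A] {I : Ideal A}
    (h : Module.length A (A ⧸ I) ≠ ⊤) : ∃ N, ChainLT I N := by
  obtain ⟨n, hn⟩ := ENat.ne_top_iff_exists.1 h
  refine ⟨n + 1, fun p => ?_⟩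
  have := Order.LTSeries.length_le_krullDim (p.map (Submodule.comapMkQRelIso I).symm
    (Submodule.comapMkQRelIso I).symm.strictMono)
  rw [← Module.coe_length, ← hn] at this
  have : p.length ≤ n := by exact_mod_cast this
  omega

variable {R K : Type*} [CommRing R] [Field K] [Algebra R K]

lemma ChainLT.range {I : Ideal R} {N : ℕ} (h : ChainLT I N) {J : Ideal (algebraMap R K).range}
    (hJ : I ≤ J.comap (algebraMap R K).rangeRestrict) : ChainLT J N := by
  intro p
  refine h (p.map (fun L => ⟨L.1.comap (algebraMap R K).rangeRestrict,
    hJ.trans (Ideal.comap_mono L.2)⟩) fun L L' hlt => ?_)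
  refine lt_of_le_of_ne (Ideal.comap_mono hlt.le) fun e => hlt.ne (Subtype.ext ?_)
  exact Ideal.comap_injective_of_surjective _ (RingHom.rangeRestrict_surjective _)
    (Subtype.ext_iff.1 e)

end FiniteChains

section Core

variable {R : Type*} [CommRing R] [IsLocalRing R]

omit [IsLocalRing R] in
lemma MemIntClosure.exists_pow_mem {I : Ideal R} {z : R} (h : MemIntClosure I z) :
    ∃ n, z ^ n ∈ I := by
  obtain ⟨n, -, c, hc, e⟩ := h
  refine ⟨n, ?_⟩
  rw [eq_neg_of_add_eq_zero_left e]
  refine neg_mem (sum_mem fun i hi => Ideal.mul_mem_right _ _ ?_)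
  exact Ideal.pow_le_self (by simp at hi; omega) (hc i hi)

lemma RegPair.length_quotient_ne_top {x y : R} (h : RegPair R x y) {I : Ideal R} {a b : ℕ}
    (hx : x ^ a ∈ I) (hy : y ^ b ∈ I) : Module.length R (R ⧸ I) ≠ ⊤ := by
  have := h.noeth
  obtain ⟨n, hn⟩ := Ideal.exists_pow_le_of_le_radical_of_fg (I := maximalIdeal R) (J := I) (by
    rw [h.max, Ideal.span_le]
    rintro _ (rfl | rfl)
    exacts [⟨_, hx⟩, ⟨_, hy⟩]) (IsNoetherian.noetherian _)
  refine ((length_quotient_anti hn).trans_lt ?_).ne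
  rw [h.length_quotient_pow]
  exact ENat.natCast_lt_top _

/-- The determinant with fixed columns `b` is injective modulo `span b`. -/
lemma RegPair.mem_span_of_colDet_eq_zero {x y : R} (h : RegPair R x y) {k : ℕ}
    {b : Fin k → Fin (k + 1) → R} {u ux uy v : Fin (k + 1) → R} {m n : ℕ}
    (hu : colDetLin b u ≠ 0) (hux : colDetLin b ux = x ^ m) (huy : colDetLin b uy = y ^ n)
    (hv : colDetLin b v = 0) : v ∈ Submodule.span R (Set.range b) := by
  have := h.dom
  set K := FractionRing R
  have hinj := IsFractionRing.injective R K
  set s := fun j => signedColDet (Fin.cons v (Fin.cons u b) : Fin (k + 2) → Fin (k + 1) → R) j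
  have hs : colDetLin b u • v = ∑ j : Fin k, -s j.succ.succ • b j := by
    have := sum_signedColDet_smul (Fin.cons v (Fin.cons u b) : Fin (k + 2) → Fin (k + 1) → R)
    rw [Fin.sum_univ_succ, Fin.sum_univ_succ] at this
    have h0 : signedColDet (Fin.cons v (Fin.cons u b) : Fin (k + 2) → Fin (k + 1) → R) 0 =
        colDetLin b u := by
      rw [colDetLin_apply, signedColDet, Fin.val_zero, pow_zero, one_mul]
      rfl
    have h1 : signedColDet (Fin.cons v (Fin.cons u b) : Fin (k + 2) → Fin (k + 1) → R)
        (Fin.succ 0) = 0 := by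
      rw [signedColDet, show colDet _ = colDetLin b v by
        rw [colDetLin_apply]
        congr 1
        funext j
        refine Fin.cases rfl (fun j => rfl) j, hv, mul_zero]
    rw [h0, h1, zero_smul, zero_add] at this
    simp only [neg_smul, Finset.sum_neg_distrib]
    exact eq_neg_of_add_eq_zero_left this
  have key : ∀ (w : Fin (k + 1) → R) (j : Fin k),
      colDetLin b u * colDet (Function.update (Fin.cons w b : Fin (k + 1) → _) j.succ v)
      = -s j.succ.succ * colDetLin b w := by
    intro w j
    have := colDet_update_sum (Fin.cons w b : Fin (k + 1) → Fin (k + 1) → R) j.succ {()}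
      (fun _ => colDetLin b u) (fun _ => v)
    rw [Finset.sum_singleton, Finset.sum_singleton, hs, colDet_update_sum,
      Finset.sum_eq_single j] at this
    · rw [← this, colDetLin_apply]
      congr 2
      exact Function.update_eq_self j.succ (Fin.cons w b : Fin (k + 1) → _)
    · intro i _ hij
      have h0 : colDet (Function.update (Fin.cons w b : Fin (k + 1) → Fin (k + 1) → R) j.succ (b i))
          = 0 := by
        rw [colDet_eq_detRowAlternating]
        exact AlternatingMap.map_update_self _ (Fin.cons w b : Fin (k + 1) → Fin (k + 1) → R)
          (i := j.succ) (j := i.succ) (by simpa using hij.symm)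
      rw [h0, mul_zero]
    · simp
  have hu' : algebraMap R K (colDetLin b u) ≠ 0 := by rwa [Ne, map_eq_zero_iff _ hinj]
  have hq : ∀ j : Fin k, ∃ c, algebraMap R K (-s j.succ.succ) / algebraMap R K (colDetLin b u) =
      algebraMap R K c := by
    intro j
    have hk : ∀ w, algebraMap R K (colDetLin b w) *
        (algebraMap R K (-s j.succ.succ) / algebraMap R K (colDetLin b u)) =
        algebraMap R K (colDet (Function.update (Fin.cons w b : Fin (k + 1) → _) j.succ v)) := by
      intro w
      rw [mul_div_assoc', div_eq_iff hu', ← map_mul, ← map_mul, mul_comm _ (-s j.succ.succ),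
        ← key, mul_comm]
    exact h.exists_eq_algebraMap (K := K) (n := m) (m := n) (hux ▸ hk ux) (huy ▸ hk uy)
  choose c hc using hq
  have hv' : v = ∑ j, c j • b j := by
    refine smul_right_injective _ hu ?_
    simp only
    rw [hs, Finset.smul_sum]
    refine Finset.sum_congr rfl fun j _ => ?_
    rw [smul_smul]
    congr 1
    refine hinj ?_
    rw [map_mul, ← hc, mul_div_cancel₀ _ hu']
  rw [hv']
  exact sum_mem fun j _ => Submodule.smul_mem _ _ (Submodule.subset_span ⟨j, rfl⟩)

variable {K : Type*} [Field K] [Algebra R K]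

/-- Division by a two-element reduction: an element integral over `(d₀, d₁)` is a determinant
with one column in an integrally closed module. -/
lemma exists_colDetLin_eq [IsFractionRing R K] {x y : R} (h : RegPair R x y) {k : ℕ}
    {M : Submodule R (Fin (k + 1) → R)} (hM : ModIntClosed M) {u₀ u₁ : Fin (k + 1) → R}
    {b : Fin k → Fin (k + 1) → R} {g : Fin k → R} (hu₀ : u₀ ∈ M) (hu₁ : u₁ ∈ M)
    (hb : ∀ j, b j ∈ M) (h₀ : colDetLin b u₀ ≠ 0) (h₁ : colDetLin b u₁ ≠ 0)
    (hg : ∀ j, MemIntClosure (Ideal.span {colDetLin b u₀, colDetLin b u₁}) (g j))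
    (hrel : colDetLin b u₁ • u₀ - colDetLin b u₀ • u₁ = ∑ j, g j • b j) {N : ℕ}
    (hN : ChainLT (Ideal.span {colDetLin b u₀, colDetLin b u₁}) N) {d : R}
    (hd : MemIntClosure (Ideal.span {colDetLin b u₀, colDetLin b u₁}) d) :
    ∃ m ∈ M, colDetLin b m = d := by
  have := h.dom
  have hinj := IsFractionRing.injective R K
  set φ := algebraMap R K with hφ
  set d₀ := colDetLin b u₀
  set d₁ := colDetLin b u₁
  have h₀' : φ d₀ ≠ 0 := by rwa [Ne, map_eq_zero_iff _ hinj]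
  have h₁' : φ d₁ ≠ 0 := by rwa [Ne, map_eq_zero_iff _ hinj]
  have hsplit : Split φ.range (φ d₁ / φ d₀) := by
    refine (h.reg2 K).split (a := φ.rangeRestrict d₀) (b := φ.rangeRestrict d₁) N
      (fun e => h₀' (congrArg Subtype.val e)) (fun e => h₁' (congrArg Subtype.val e)) ?_
    refine hN.range (Ideal.span_le.2 ?_)
    rintro _ (rfl | rfl)
    · exact Ideal.subset_span (Or.inl rfl)
    · exact Ideal.subset_span (Or.inr rfl)
  have hle : ∀ V : ValuationSubring K, (φ.range : Set K) ⊆ V.toSubring → ∀ {z : R},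
      MemIntClosure (Ideal.span {d₀, d₁}) z →
      V.valuation (φ z) ≤ max (V.valuation (φ d₀)) (V.valuation (φ d₁)) :=
    fun V hV z hz => valuation_le_max_of_memIntClosure (fun a => hV ⟨a, rfl⟩) hz
  have hpos₀ (V : ValuationSubring K) : 0 < V.valuation (φ d₀) :=
    zero_lt_iff.2 ((Valuation.ne_zero_iff _).2 h₀')
  have hpos₁ (V : ValuationSubring K) : 0 < V.valuation (φ d₁) :=
    zero_lt_iff.2 ((Valuation.ne_zero_iff _).2 h₁')
  have ht (V : ValuationSubring K) (h : φ d₁ / φ d₀ ∈ V) :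
      V.valuation (φ d₁) ≤ V.valuation (φ d₀) := by
    rwa [← V.valuation_le_one_iff, map_div₀, div_le_one₀ (hpos₀ V)] at h
  have ht' (V : ValuationSubring K) (h : (φ d₁ / φ d₀)⁻¹ ∈ V) :
      V.valuation (φ d₀) ≤ V.valuation (φ d₁) := by
    rwa [← V.valuation_le_one_iff, inv_div, map_div₀, div_le_one₀ (hpos₁ V)] at h
  have hQ₀ : φ d / φ d₀ ∈ icl ({φ d₁ / φ d₀} ∪ φ.range : Set K) := mem_icl.2 fun V hV => by
    have hVt := ht V (hV (Or.inl rfl))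
    rw [← V.valuation_le_one_iff, map_div₀, div_le_one₀ (hpos₀ V)]
    simpa [max_eq_left hVt] using hle V (fun a ha => hV (Or.inr ha)) hd
  have hQ₁ : φ d / φ d₁ ∈ icl ({(φ d₁ / φ d₀)⁻¹} ∪ φ.range : Set K) := mem_icl.2 fun V hV => by
    have hVt := ht' V (hV (Or.inl rfl))
    rw [← V.valuation_le_one_iff, map_div₀, div_le_one₀ (hpos₁ V)]
    simpa [max_eq_right hVt] using hle V (fun a ha => hV (Or.inr ha)) hd
  have hf : ∀ j, φ d * φ (g j) / (φ d₀ * φ d₁) ∈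
      icl ({φ d₁ / φ d₀, (φ d₁ / φ d₀)⁻¹} ∪ φ.range : Set K) := fun j => mem_icl.2 fun V hV => by
    have e := (ht' V (hV (Or.inl (by simp)))).antisymm (ht V (hV (Or.inl (by simp))))
    have hVR : (φ.range : Set K) ⊆ V.toSubring := fun a ha => hV (Or.inr ha)
    rw [← V.valuation_le_one_iff, map_div₀, map_mul, map_mul,
      div_le_one₀ (mul_pos (hpos₀ V) (hpos₁ V))]
    refine mul_le_mul' ?_ ?_
    · simpa [e] using hle V hVR hd
    · simpa [e] using hle V hVR (hg j)
  choose G hG H hH hGH using fun j => hsplit _ (hf j)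
  set Q₀ : Fin (k + 1) → K := Fin.cons (φ d / φ d₀) fun j => -G j with hQ₀'
  set Q₁ : Fin (k + 1) → K := Fin.cons (φ d / φ d₁) H with hQ₁'
  have hQ₀m : ∀ s, Q₀ s ∈ icl ({φ d₁ / φ d₀} ∪ φ.range : Set K) :=
    Fin.cases hQ₀ fun j => neg_mem (hG j)
  have hQ₁m : ∀ s, Q₁ s ∈ icl ({(φ d₁ / φ d₀)⁻¹} ∪ φ.range : Set K) := Fin.cases hQ₁ hH
  set c₀ : Fin (k + 1) → Fin (k + 1) → R := Fin.cons u₀ b with hc₀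
  set c₁ : Fin (k + 1) → Fin (k + 1) → R := Fin.cons u₁ b with hc₁
  have hc₀M : ∀ s, c₀ s ∈ M := Fin.cases hu₀ hb
  have hc₁M : ∀ s, c₁ s ∈ M := Fin.cases hu₁ hb
  have heq : ∀ i, ∑ s, Q₀ s * φ (c₀ s i) = ∑ s, Q₁ s * φ (c₁ s i) := by
    intro i
    have hr := congrArg φ (congrFun hrel i)
    simp only [Pi.sub_apply, Pi.smul_apply, Finset.sum_apply, smul_eq_mul, map_sub, map_mul,
      map_sum] at hr
    simp only [hQ₀', hQ₁', hc₀, hc₁, Fin.sum_univ_succ, Fin.cons_zero, Fin.cons_succ, neg_mul,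
      Finset.sum_neg_distrib]
    have hs : ∑ j, (G j + H j) * φ (b j i) =
        φ d / (φ d₀ * φ d₁) * ∑ j, φ (g j) * φ (b j i) := by
      rw [Finset.mul_sum]
      refine Finset.sum_congr rfl fun j _ => ?_
      rw [← hGH]
      ring
    rw [← hr] at hs
    simp only [add_mul, Finset.sum_add_distrib] at hs
    have hs' : φ d / (φ d₀ * φ d₁) * (φ d₁ * φ (u₀ i) - φ d₀ * φ (u₁ i)) =
        φ d / φ d₀ * φ (u₀ i) - φ d / φ d₁ * φ (u₁ i) := by
      field_simp
    rw [hs'] at hs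
    linear_combination -hs
  have hA : ∀ i, ∃ a, φ a = ∑ s, Q₀ s * φ (c₀ s i) := by
    intro i
    refine (h.reg2 K).normal (mem_icl_of_mem_insert (t := φ d₁ / φ d₀) ?_ ?_)
    · exact sum_mem fun s _ => mul_mem (hQ₀m s) (subset_icl _ (Or.inr ⟨_, rfl⟩))
    · rw [heq]
      exact sum_mem fun s _ => mul_mem (hQ₁m s) (subset_icl _ (Or.inr ⟨_, rfl⟩))
  choose m hm using hA
  refine ⟨m, hM m fun w j hwj hw => ?_, ?_⟩
  · refine memIntClosure_of_dominates (K := K) fun V hV => ?_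
    have hVR : (φ.range : Set K) ⊆ V.toSubring := by
      rintro _ ⟨a, rfl⟩
      exact (V.valuation_le_one_iff _).1 (hV.le_one a)
    rcases V.mem_or_inv_mem (φ d₁ / φ d₀) with ht | ht
    · refine exists_valuation_colDet_le hw (q := Q₀) (c := c₀) (fun s => ?_) hc₀M
        fun i => hwj ▸ hm i
      exact mem_icl.1 (hQ₀m s) V (Set.union_subset (by simpa using ht) hVR)
    · refine exists_valuation_colDet_le hw (q := Q₁) (c := c₁) (fun s => ?_) hc₁M
        fun i => hwj ▸ (hm i).trans (heq i)
      exact mem_icl.1 (hQ₁m s) V (Set.union_subset (by simpa using ht) hVR)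
  · refine hinj ?_
    rw [colDetLin_apply, algebraMap_colDet_eq_sum (K := K) _ 0 Q₀ c₀ (fun i => hm i),
      Finset.sum_eq_single 0]
    · have : Function.update (Fin.cons m b : Fin (k + 1) → Fin (k + 1) → R) 0 (c₀ 0) = c₀ :=
        Fin.update_cons_zero (α := fun _ => Fin (k + 1) → R) m b u₀
      rw [this, hc₀, ← colDetLin_apply]
      exact div_mul_cancel₀ _ h₀'
    · intro s _ hs
      obtain ⟨j, rfl⟩ := Fin.exists_succ_eq.2 hs
      have : colDet (Function.update (Fin.cons m b : Fin (k + 1) → Fin (k + 1) → R) 0 (c₀ j.succ))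
          = 0 := by
        rw [colDet_eq_detRowAlternating]
        exact AlternatingMap.map_update_self _ (Fin.cons m b : Fin (k + 1) → Fin (k + 1) → R)
          (i := 0) (j := j.succ) (Fin.succ_ne_zero j).symm
      rw [this, map_zero, mul_zero]
    · simp

/-- The main structural fact on integrally closed modules over a two-dimensional regular local
ring: the ideal of maximal minors is integrally closed, and its colength exceeds that of the
module by the colength of an ideal generated by determinants. -/
theorem maxMinors_intClosed_and_length [Infinite (ResidueField R)] {x y : R} (h : RegPair R x y)
    (hdim : ringKrullDim R ≤ 2) {k : ℕ} {M : Submodule R (Fin (k + 1) → R)}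
    (hMm : ∀ v ∈ M, ∀ i, v i ∈ maximalIdeal R) (hM : ModIntClosed M) {N : ℕ}
    (hx : ∀ i, x ^ N • Pi.single i (1 : R) ∈ M) (hy : ∀ i, y ^ N • Pi.single i (1 : R) ∈ M) :
    IdealIntClosed (maxMinors M) ∧ ∃ b : Fin k → Fin (k + 1) → R, (∀ j, b j ∈ M) ∧
      maxMinors M ≤ LinearMap.range (colDetLin b) ∧
      Module.length R (R ⧸ maxMinors M) = Module.length R ((Fin (k + 1) → R) ⧸ M) +
        Module.length R (R ⧸ LinearMap.range (colDetLin b)) := by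
  have := h.dom
  obtain ⟨u₀, u₁, b, g, hu₀, hu₁, hb, h₀, h₁, hg, hrel, hred⟩ :=
    exists_reduction_columns (K := FractionRing R) h hdim hMm hx hy
  simp only [← colDetLin_apply] at h₀ h₁ hrel hred
  have hxI := pow_mem_maxMinors hx
  have hyI := pow_mem_maxMinors hy
  rw [← pow_mul] at hxI hyI
  obtain ⟨p, hp⟩ := (hred _ hxI).exists_pow_mem
  obtain ⟨q, hq⟩ := (hred _ hyI).exists_pow_mem
  rw [← pow_mul] at hp hq
  obtain ⟨N', hN'⟩ := chainLT_of_length_quotient (h.length_quotient_ne_top hp hq)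
  have hcon : ∀ v ∈ M, colDetLin b v ∈ maxMinors M := fun v hv => by
    rw [colDetLin_apply]
    exact colDet_mem_maxMinors (Fin.cases hv hb)
  have hspan : Ideal.span {colDetLin b u₀, colDetLin b u₁} ≤ maxMinors M :=
    Ideal.span_le.2 (by rintro _ (rfl | rfl); exacts [hcon _ hu₀, hcon _ hu₁])
  have key : ∀ d, MemIntClosure (Ideal.span {colDetLin b u₀, colDetLin b u₁}) d →
      ∃ m ∈ M, colDetLin b m = d := fun d hd =>
    exists_colDetLin_eq (K := FractionRing R) h hM hu₀ hu₁ hb h₀ h₁ (fun j => hred _ (hg j)) hrel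
      hN' hd
  have hle : maxMinors M ≤ LinearMap.range (colDetLin b) := fun z hz => by
    obtain ⟨m, -, rfl⟩ := key z (hred z hz)
    exact ⟨m, rfl⟩
  refine ⟨fun z hz => ?_, b, hb, hle, ?_⟩
  · obtain ⟨m, hm, rfl⟩ := key z (memIntClosure_span_pair_of_dominates (K := FractionRing R)
      fun V hV => by
        have hVR : ∀ a, algebraMap R (FractionRing R) a ∈ V :=
          fun a => (V.valuation_le_one_iff _).1 (hV.le_one a)
        obtain ⟨a, ha, hle⟩ := exists_le_valuation_of_memIntClosure
          (V.valuation.comap (algebraMap R (FractionRing R))) hz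
        exact hle.trans (valuation_le_max_of_memIntClosure hVR (hred a ha)))
    exact hcon m hm
  · obtain ⟨ux, -, hux⟩ := key _ (hred _ hxI)
    obtain ⟨uy, -, huy⟩ := key _ (hred _ hyI)
    have hcomap : Submodule.comap (colDetLin b) (maxMinors M) = M := by
      refine le_antisymm (fun v hv => ?_) hcon
      obtain ⟨m, hm, e⟩ := key _ (hred _ hv)
      have := h.mem_span_of_colDet_eq_zero h₀ hux huy
        (v := v - m) (by rw [map_sub, e, sub_self])
      have hvm : v - m ∈ M := Submodule.span_le.2 (by rintro _ ⟨j, rfl⟩; exact hb j) this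
      simpa using add_mem hvm hm
    rw [length_quotient_eq_add (colDetLin b) (maxMinors M), hcomap, sup_eq_right.2 hle]

end Core

section Summands

variable {R : Type*} [CommRing R]

lemma mem_maximalIdeal_of_not_hasFreeSummand [IsDomain R] [IsLocalRing R] {r : ℕ}
    {M : Submodule R (Fin r → R)} (hM : ¬ HasFreeSummand M) {v : Fin r → R} (hv : v ∈ M)
    (i : Fin r) : v i ∈ maximalIdeal R := by
  by_contra hi
  rw [mem_maximalIdeal, mem_nonunits_iff, not_not] at hi
  obtain ⟨u, hu⟩ := hi
  have hv0 : v ≠ 0 := by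
    rintro rfl
    exact u.ne_zero hu
  refine hM ⟨Submodule.span R {v}, M ⊓ LinearMap.ker (LinearMap.proj i), ?_, ?_, ?_, ?_⟩
  · refine le_antisymm (sup_le (by simpa using hv) inf_le_left) fun m hm => ?_
    have e : m = (m i * ↑u⁻¹) • v + (m - (m i * ↑u⁻¹) • v) := by abel
    rw [e]
    refine Submodule.add_mem_sup (Submodule.smul_mem _ _ (Submodule.mem_span_singleton_self v))
      ⟨sub_mem hm (Submodule.smul_mem _ _ hv), ?_⟩
    simp [← hu, mul_assoc]
  · rw [eq_bot_iff]
    rintro w ⟨hw, -, hw'⟩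
    obtain ⟨a, rfl⟩ := Submodule.mem_span_singleton.1 hw
    have : a * v i = 0 := by simpa using hw'
    rw [← hu, Units.mul_left_eq_zero] at this
    simp [this]
  · simpa using hv0
  · exact Module.Free.of_equiv (LinearEquiv.toSpanNonzeroSingleton R _ v hv0)

lemma exists_pow_smul_eq_zero {Q : Type*} [AddCommGroup Q] [Module R Q] [IsLocalRing R]
    [IsArtinian R Q] {x : R} (hx : x ∈ maximalIdeal R) (q : Q) : ∃ n, x ^ n • q = 0 := by
  obtain ⟨n, ⟨w, hw⟩, hn⟩ := IsArtinian.exists_pow_succ_smul_dvd (M := Submodule.span R {q}) x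
    ⟨q, Submodule.mem_span_singleton_self q⟩
  obtain ⟨c, rfl⟩ := Submodule.mem_span_singleton.1 hw
  refine ⟨n, ?_⟩
  have hn' : x ^ n.succ • c • q = x ^ n • q := congrArg Subtype.val hn
  have hu : IsUnit (1 - x * c) := by
    by_contra h
    have := add_mem ((mem_maximalIdeal _).2 h) (Ideal.mul_mem_right c _ hx)
    rw [sub_add_cancel] at this
    exact (Ideal.ne_top_iff_one _).1 (maximalIdeal.isMaximal R).ne_top this
  refine (hu.smul_eq_zero).1 ?_
  rw [sub_smul, one_smul, sub_eq_zero]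
  conv_lhs => rw [← hn']
  rw [smul_smul, smul_smul]
  rw [pow_succ]
  congr 1
  ring

lemma FinColength.exists_pow_smul_mem [IsLocalRing R] {r : ℕ} {M : Submodule R (Fin r → R)}
    (hM : FinColength M) {x : R} (hx : x ∈ maximalIdeal R) :
    ∃ N, ∀ n, N ≤ n → ∀ v : Fin r → R, x ^ n • v ∈ M := by
  have := (isFiniteLength_iff_isNoetherian_isArtinian.1 hM).2
  choose m hm using fun i => exists_pow_smul_eq_zero hx (M.mkQ (Pi.single i (1 : R)))
  refine ⟨Finset.univ.sup m, fun n hn v => ?_⟩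
  rw [pi_eq_sum_univ' v, Finset.smul_sum]
  refine sum_mem fun i _ => ?_
  rw [smul_comm]
  refine Submodule.smul_mem _ _ ?_
  have hi : m i ≤ n := (Finset.le_sup (Finset.mem_univ i)).trans hn
  rw [← Nat.sub_add_cancel hi, pow_add, mul_smul]
  refine Submodule.smul_mem _ _ ?_
  have := hm i
  rw [← map_smul, Submodule.mkQ_apply, Submodule.Quotient.mk_eq_zero] at this
  convert this using 2

/-- Homomorphisms into a free module extend from a submodule of finite colength. -/
lemma RegPair.exists_extension [IsLocalRing R] {x y : R} (h : RegPair R x y) {s t : ℕ}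
    {N : Submodule R (Fin s → R)} (hN : FinColength N) (f : N →ₗ[R] (Fin t → R)) :
    ∃ F : (Fin s → R) →ₗ[R] (Fin t → R), ∀ v : N, F v = f v := by
  have := h.dom
  obtain ⟨a, ha⟩ := hN.exists_pow_smul_mem h.x_mem
  obtain ⟨b, hb⟩ := hN.exists_pow_smul_mem h.y_mem
  have hx0 : x ^ a ≠ 0 := pow_ne_zero _ h.x_prime.ne_zero
  set K := FractionRing R
  have hinj := IsFractionRing.injective R K
  have hx0' : algebraMap R K (x ^ a) ≠ 0 := by rwa [Ne, map_eq_zero_iff _ hinj]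
  set X : Fin s → N := fun i => ⟨x ^ a • Pi.single i 1, ha a le_rfl _⟩ with hX
  set Y : Fin s → N := fun i => ⟨y ^ b • Pi.single i 1, hb b le_rfl _⟩ with hY
  have hXY : ∀ i, y ^ b • f (X i) = x ^ a • f (Y i) := by
    intro i
    rw [← map_smul, ← map_smul]
    congr 1
    ext1
    exact smul_comm _ _ _
  have hc : ∀ i j, ∃ c, x ^ a * c = f (X i) j := by
    intro i j
    obtain ⟨c, hc⟩ := h.exists_eq_algebraMap (K := K) (n := a) (m := b)
      (q := algebraMap R K (f (X i) j) / algebraMap R K (x ^ a)) (a := f (X i) j) (b := f (Y i) j)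
      (mul_div_cancel₀ _ hx0') (by
        have := congrArg (algebraMap R K) (congrFun (hXY i) j)
        simp only [Pi.smul_apply, smul_eq_mul, map_mul] at this
        rw [mul_div_assoc', div_eq_iff hx0', this, mul_comm])
    refine ⟨c, hinj ?_⟩
    rw [map_mul, ← hc, mul_div_cancel₀ _ hx0']
  choose c hc using hc
  refine ⟨Fintype.linearCombination R c, fun v => ?_⟩
  refine smul_right_injective _ hx0 ?_
  simp only
  have e : x ^ a • v = ∑ i, (v : Fin s → R) i • X i := by
    ext1
    simp only [Submodule.coe_smul, Submodule.coe_sum, hX]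
    conv_lhs => rw [pi_eq_sum_univ' (v : Fin s → R), Finset.smul_sum]
    refine Finset.sum_congr rfl fun i _ => ?_
    rw [smul_comm]
  rw [← map_smul f, e, map_sum, Fintype.linearCombination_apply, Finset.smul_sum]
  refine Finset.sum_congr rfl fun i _ => ?_
  rw [map_smul, smul_comm]
  congr 1
  funext j
  exact hc i j

lemma linearMap_ext_of_finColength [IsLocalRing R] [IsDomain R] {r t : ℕ}
    {M : Submodule R (Fin r → R)} (hM : FinColength M) {x : R} (hx : x ∈ maximalIdeal R)
    (hx0 : x ≠ 0) {f g : (Fin r → R) →ₗ[R] (Fin t → R)} (hfg : ∀ v ∈ M, f v = g v) : f = g := by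
  obtain ⟨a, ha⟩ := hM.exists_pow_smul_mem hx
  refine LinearMap.ext fun v => ?_
  refine smul_right_injective _ (pow_ne_zero a hx0) ?_
  simp only
  rw [← map_smul, ← map_smul]
  exact hfg _ (ha a le_rfl v)

/-- A direct sum decomposition of a module of finite colength extends to its double dual. -/
lemma RegPair.exists_linearEquiv_prod [IsLocalRing R] {x y : R} (h : RegPair R x y) {r r₁ r₂ : ℕ}
    {M P₁ P₂ : Submodule R (Fin r → R)} (hM : FinColength M) (hdisj : P₁ ⊓ P₂ = ⊥)
    (hsup : P₁ ⊔ P₂ = M) {N₁ : Submodule R (Fin r₁ → R)} {N₂ : Submodule R (Fin r₂ → R)}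
    (hN₁ : FinColength N₁) (hN₂ : FinColength N₂) (e₁ : P₁ ≃ₗ[R] N₁) (e₂ : P₂ ≃ₗ[R] N₂) :
    ∃ E : ((Fin r₁ → R) × (Fin r₂ → R)) ≃ₗ[R] (Fin r → R),
      (N₁.prod N₂).map E.toLinearMap = M := by
  have := h.dom
  have hx0 := h.x_prime.ne_zero
  obtain ⟨A₁, hA₁⟩ := h.exists_extension hN₁ (P₁.subtype ∘ₗ e₁.symm.toLinearMap)
  obtain ⟨A₂, hA₂⟩ := h.exists_extension hN₂ (P₂.subtype ∘ₗ e₂.symm.toLinearMap)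
  have hA₁' : ∀ p : P₁, A₁ (e₁ p) = p := fun p => by simp [hA₁]
  have hA₂' : ∀ p : P₂, A₂ (e₂ p) = p := fun p => by simp [hA₂]
  set A := A₁.coprod A₂ with hA
  have hmap : (N₁.prod N₂).map A = M := by
    rw [← hsup]
    apply le_antisymm
    · rintro _ ⟨⟨v, w⟩, ⟨hv, hw⟩, rfl⟩
      rw [hA, LinearMap.coprod_apply, hA₁ ⟨v, hv⟩, hA₂ ⟨w, hw⟩]
      exact Submodule.add_mem_sup (Subtype.prop _) (Subtype.prop _)
    · refine sup_le (fun p hp => ?_) fun p hp => ?_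
      · exact ⟨(e₁ ⟨p, hp⟩, 0), ⟨Subtype.prop _, zero_mem _⟩, by simp [hA, hA₁']⟩
      · exact ⟨(0, e₂ ⟨p, hp⟩), ⟨zero_mem _, Subtype.prop _⟩, by simp [hA, hA₂']⟩
  have hker : ∀ v ∈ N₁, ∀ w ∈ N₂, A (v, w) = 0 → v = 0 ∧ w = 0 := by
    intro v hv w hw h0
    rw [hA, LinearMap.coprod_apply, hA₁ ⟨v, hv⟩, hA₂ ⟨w, hw⟩] at h0
    simp only [LinearMap.comp_apply, Submodule.subtype_apply, LinearEquiv.coe_coe] at h0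
    have h1 : ((e₁.symm ⟨v, hv⟩ : P₁) : Fin r → R) ∈ P₁ ⊓ P₂ := by
      refine ⟨Subtype.prop _, ?_⟩
      rw [eq_neg_of_add_eq_zero_left h0]
      exact neg_mem (Subtype.prop _)
    rw [hdisj, Submodule.mem_bot] at h1
    rw [h1, zero_add] at h0
    simp only [ZeroMemClass.coe_eq_zero, LinearEquiv.map_eq_zero_iff, Submodule.mk_eq_zero] at h0 h1
    exact ⟨h1, h0⟩
  have hinj : Function.Injective A := by
    obtain ⟨a, ha⟩ := hN₁.exists_pow_smul_mem h.x_mem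
    obtain ⟨b, hb⟩ := hN₂.exists_pow_smul_mem h.x_mem
    rw [injective_iff_map_eq_zero]
    rintro ⟨v, w⟩ h0
    have hc : x ^ (a + b) ≠ 0 := pow_ne_zero _ hx0
    obtain ⟨h1, h2⟩ := hker _ (ha (a + b) (by omega) v) _ (hb (a + b) (by omega) w) (by
      rw [← Prod.smul_mk, map_smul, h0, smul_zero])
    rw [smul_eq_zero_iff_right hc] at h1 h2
    rw [h1, h2, Prod.mk_zero_zero]
  have hproj : ∀ v : M, ∃ p : N₁ × N₂, A (p.1, p.2) = v := by
    rintro ⟨v, hv⟩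
    rw [← hmap] at hv
    obtain ⟨⟨a, b⟩, ⟨ha, hb⟩, e⟩ := hv
    exact ⟨(⟨a, ha⟩, ⟨b, hb⟩), e⟩
  choose p hp using hproj
  have huniq : ∀ {q q' : N₁ × N₂}, A (q.1, q.2) = A (q'.1, q'.2) → q = q' := fun e => by
    have := hinj e
    simp only [Prod.mk.injEq, SetLike.coe_eq_coe] at this
    exact Prod.ext this.1 this.2
  let p' : M →ₗ[R] N₁ × N₂ :=
    { toFun := p
      map_add' := fun v w => huniq (by
        rw [hp]
        simp only [Prod.fst_add, Prod.snd_add, Submodule.coe_add, ← Prod.mk_add_mk, map_add, hp])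
      map_smul' := fun a v => huniq (by
        rw [hp]
        simp only [Prod.smul_fst, Prod.smul_snd, Submodule.coe_smul, ← Prod.smul_mk, map_smul, hp,
          RingHom.id_apply]) }
  obtain ⟨B₁, hB₁⟩ := h.exists_extension hM (N₁.subtype ∘ₗ LinearMap.fst R N₁ N₂ ∘ₗ p')
  obtain ⟨B₂, hB₂⟩ := h.exists_extension hM (N₂.subtype ∘ₗ LinearMap.snd R N₁ N₂ ∘ₗ p')
  have hsec : A ∘ₗ B₁.prod B₂ = LinearMap.id :=
    linearMap_ext_of_finColength hM h.x_mem hx0 fun v hv => by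
      change A (B₁ v, B₂ v) = v
      rw [hB₁ ⟨v, hv⟩, hB₂ ⟨v, hv⟩]
      exact hp ⟨v, hv⟩
  exact ⟨LinearEquiv.ofBijective A ⟨hinj, fun v => ⟨_, LinearMap.congr_fun hsec v⟩⟩, hmap⟩

lemma HasFreeSummand.prod_left {r r₁ r₂ : ℕ} {N₁ : Submodule R (Fin r₁ → R)}
    {N₂ : Submodule R (Fin r₂ → R)} (E : ((Fin r₁ → R) × (Fin r₂ → R)) ≃ₗ[R] (Fin r → R))
    (h : HasFreeSummand N₁) :
    HasFreeSummand ((N₁.prod N₂).map E.toLinearMap) := by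
  obtain ⟨L, P, hsup, hinf, hne, hfree⟩ := h
  refine ⟨(L.prod ⊥).map E.toLinearMap, (P.prod N₂).map E.toLinearMap,
    ?_, ?_, ?_, ?_⟩
  · rw [← Submodule.map_sup, Submodule.prod_sup_prod, hsup, bot_sup_eq]
  · rw [← Submodule.map_inf _ E.injective, Submodule.prod_inf_prod, hinf, bot_inf_eq,
      Submodule.prod_bot, Submodule.map_bot]
  · obtain ⟨v, hv, hv0⟩ := Submodule.exists_mem_ne_zero_of_ne_bot hne
    rw [Submodule.ne_bot_iff]
    refine ⟨E (v, 0), ⟨_, ⟨hv, zero_mem _⟩, rfl⟩, ?_⟩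
    simpa using hv0
  · have e : (L.prod ⊥).map E.toLinearMap =
        L.map (E.toLinearMap ∘ₗ LinearMap.inl R _ _) := by
      rw [Submodule.map_comp, Submodule.map_inl]
    rw [e]
    exact Module.Free.of_equiv (Submodule.equivMapOfInjective
      (E.toLinearMap ∘ₗ LinearMap.inl R (Fin r₁ → R) (Fin r₂ → R))
      (E.injective.comp LinearMap.inl_injective) L)

end Summands

section Blocks

variable {R : Type*} [CommRing R]

/-- A determinant lies in any ideal containing all products of complementary minors of two
complementary blocks of rows. -/
lemma Matrix.det_mem_of_blocks {m n : Type*} [Fintype m] [Fintype n] [DecidableEq m]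
    [DecidableEq n] {S : Ideal R} (A : Matrix (m ⊕ n) (m ⊕ n) R)
    (hS : ∀ σ : Equiv.Perm (m ⊕ n),
      (Matrix.of fun i i' : m => A (σ (.inl i)) (.inl i')).det *
        (Matrix.of fun i i' : n => A (σ (.inr i)) (.inr i')).det ∈ S) : A.det ∈ S := by
  classical
  set P : m ⊕ n → m ⊕ n → R := fun j => Sum.elim (fun i => A j (.inl i)) 0 with hP
  set Q : m ⊕ n → m ⊕ n → R := fun j => Sum.elim 0 (fun i => A j (.inr i)) with hQ
  have hA : A.det = Matrix.detRowAlternating.toMultilinearMap (P + Q) := by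
    change _ = Matrix.det (Matrix.of (P + Q))
    congr 1
    ext j (i | i) <;> simp [hP, hQ]
  rw [hA, MultilinearMap.map_add_univ]
  refine sum_mem fun s _ => ?_
  change Matrix.det (Matrix.of (s.piecewise P Q)) ∈ S
  by_cases hs : ∃ σ : Equiv.Perm (m ⊕ n), ∀ j, j ∈ s ↔ (σ.symm j).isLeft
  · obtain ⟨σ, hσ⟩ := hs
    have h1 : (Matrix.of (s.piecewise P Q)).submatrix σ id = Matrix.fromBlocks
        (Matrix.of fun i i' : m => A (σ (.inl i)) (.inl i')) 0 0
        (Matrix.of fun i i' : n => A (σ (.inr i)) (.inr i')) := by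
      ext (j | j) i
      · have : σ (.inl j) ∈ s := by simp [hσ]
        rw [Matrix.submatrix_apply, Matrix.of_apply, s.piecewise_eq_of_mem _ _ this]
        rcases i with i | i <;> simp [hP]
      · have : σ (.inr j) ∉ s := by simp [hσ]
        rw [Matrix.submatrix_apply, Matrix.of_apply, s.piecewise_eq_of_notMem _ _ this]
        rcases i with i | i <;> simp [hQ]
    have h2 := Matrix.det_permute σ (Matrix.of (s.piecewise P Q))
    rw [h1, Matrix.det_fromBlocks_zero₂₁] at h2
    have h3 : (Matrix.of (s.piecewise P Q)).det = ((Equiv.Perm.sign σ : ℤˣ) : ℤ) *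
        ((Matrix.of fun i i' : m => A (σ (.inl i)) (.inl i')).det *
        (Matrix.of fun i i' : n => A (σ (.inr i)) (.inr i')).det) := by
      rw [h2, ← mul_assoc, ← Int.cast_mul, ← Units.val_mul, Int.units_mul_self]
      simp
    rw [h3]
    exact Ideal.mul_mem_left _ _ (hS σ)
  · rw [Matrix.det_apply]
    refine sum_mem fun τ _ => ?_
    have : ∏ i, Matrix.of (s.piecewise P Q) (τ i) i = 0 := by
      by_contra hne
      refine hs ⟨τ, fun j => ?_⟩
      have hj := fun h0 => hne (Finset.prod_eq_zero (Finset.mem_univ (τ.symm j)) h0)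
      rw [Equiv.apply_symm_apply, Matrix.of_apply] at hj
      by_cases hjs : j ∈ s
      · rw [s.piecewise_eq_of_mem _ _ hjs] at hj
        rcases h : τ.symm j with i | i
        · simp [hjs]
        · simp [h, hP] at hj
      · rw [s.piecewise_eq_of_notMem _ _ hjs] at hj
        rcases h : τ.symm j with i | i
        · simp [h, hQ] at hj
        · simp [hjs]
    rw [this, smul_zero]
    exact zero_mem _

lemma colDet_mem_of_blocks {r₁ r₂ : ℕ} {S : Ideal R} (w : Fin (r₁ + r₂) → Fin (r₁ + r₂) → R)
    (hS : ∀ σ : Fin r₁ ⊕ Fin r₂ ≃ Fin (r₁ + r₂),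
      colDet (fun i i' => w (σ (.inl i)) (Fin.castAdd r₂ i')) *
        colDet (fun i i' => w (σ (.inr i)) (Fin.natAdd r₁ i')) ∈ S) : colDet w ∈ S := by
  rw [colDet_eq_det, ← Matrix.det_submatrix_equiv_self finSumFinEquiv]
  refine Matrix.det_mem_of_blocks _ fun σ => ?_
  have := hS (σ.trans finSumFinEquiv)
  rw [colDet_eq_det, colDet_eq_det] at this
  exact this

/-- The decomposition `R^(r₁ + r₂) = R^r₁ × R^r₂`. -/
def splitEquiv (R : Type*) [CommRing R] (r₁ r₂ : ℕ) :
    (Fin (r₁ + r₂) → R) ≃ₗ[R] (Fin r₁ → R) × (Fin r₂ → R) :=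
  (LinearEquiv.funCongrLeft R R finSumFinEquiv).trans
    (LinearEquiv.sumArrowLequivProdArrow (Fin r₁) (Fin r₂) R R)

/-- The direct sum of two submodules of free modules, as a submodule of `R^(r₁ + r₂)`. -/
def appendSub {r₁ r₂ : ℕ} (N₁ : Submodule R (Fin r₁ → R)) (N₂ : Submodule R (Fin r₂ → R)) :
    Submodule R (Fin (r₁ + r₂) → R) :=
  (N₁.prod N₂).comap (splitEquiv R r₁ r₂).toLinearMap

lemma mem_appendSub {r₁ r₂ : ℕ} {N₁ : Submodule R (Fin r₁ → R)} {N₂ : Submodule R (Fin r₂ → R)}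
    {v : Fin (r₁ + r₂) → R} : v ∈ appendSub N₁ N₂ ↔
      (fun i => v (Fin.castAdd r₂ i)) ∈ N₁ ∧ (fun i => v (Fin.natAdd r₁ i)) ∈ N₂ := Iff.rfl

lemma maxMinors_appendSub {r₁ r₂ : ℕ} (N₁ : Submodule R (Fin r₁ → R))
    (N₂ : Submodule R (Fin r₂ → R)) :
    maxMinors (appendSub N₁ N₂) = maxMinors N₁ * maxMinors N₂ := by
  apply le_antisymm
  · refine Ideal.span_le.2 ?_
    rintro _ ⟨w, hw, rfl⟩
    exact colDet_mem_of_blocks w fun σ => Ideal.mul_mem_mul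
      (colDet_mem_maxMinors fun j => (mem_appendSub.1 (hw _)).1)
      (colDet_mem_maxMinors fun j => (mem_appendSub.1 (hw _)).2)
  · unfold maxMinors
    rw [Ideal.span_mul_span']
    refine Ideal.span_le.2 ?_
    rintro _ ⟨_, ⟨p, hp, rfl⟩, _, ⟨q, hq, rfl⟩, rfl⟩
    have : colDet p * colDet q = colDet fun j => (splitEquiv R r₁ r₂).symm
        (Sum.elim (fun j => (p j, 0)) (fun j => (0, q j)) (finSumFinEquiv.symm j)) := by
      simp only [colDet_eq_det]
      rw [← Matrix.det_fromBlocks_zero₂₁ (Matrix.of p) 0 (Matrix.of q),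
        ← Matrix.det_submatrix_equiv_self finSumFinEquiv (Matrix.of fun j => _)]
      congr 1
      ext (j | j) (i | i) <;> simp [splitEquiv, LinearEquiv.funCongrLeft]
    simp only [SetLike.mem_coe]
    rw [this]
    refine colDet_mem_maxMinors fun j => ?_
    change splitEquiv R r₁ r₂ _ ∈ N₁.prod N₂
    rw [LinearEquiv.apply_symm_apply]
    rcases finSumFinEquiv.symm j with i | i
    · exact ⟨hp i, zero_mem _⟩
    · exact ⟨zero_mem _, hq i⟩

lemma colDet_comp_linearMap {r : ℕ} (T : (Fin r → R) →ₗ[R] (Fin r → R)) (w : Fin r → Fin r → R) :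
    colDet (fun j => T (w j)) = LinearMap.det T * colDet w := by
  simp only [colDet_eq_detRowAlternating, ← Pi.basisFun_det]
  exact Module.Basis.det_comp _ T w

lemma maxMinors_map_equiv {r : ℕ} (T : (Fin r → R) ≃ₗ[R] (Fin r → R))
    (M : Submodule R (Fin r → R)) : maxMinors (M.map T.toLinearMap) = maxMinors M := by
  have key : ∀ (T : (Fin r → R) ≃ₗ[R] (Fin r → R)) (M : Submodule R (Fin r → R)),
      maxMinors (M.map T.toLinearMap) ≤ maxMinors M := fun T M => by
    refine Ideal.span_le.2 ?_
    rintro _ ⟨w, hw, rfl⟩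
    choose u hu e using hw
    have : w = fun j => T.toLinearMap (u j) := funext fun j => (e j).symm
    rw [this, SetLike.mem_coe, colDet_comp_linearMap]
    exact Ideal.mul_mem_left _ _ (colDet_mem_maxMinors hu)
  refine (key T M).antisymm ?_
  have := key T.symm (M.map T.toLinearMap)
  rwa [← Submodule.map_comp, LinearEquiv.comp_coe, LinearEquiv.self_trans_symm,
    LinearEquiv.refl_toLinearMap, Submodule.map_id] at this

end Blocks

section IntegralTransfer

variable {R : Type*} [CommRing R] [IsLocalRing R] {K : Type*} [Field K] [Algebra R K]

/-- An element integral over a module is, over every dominating valuation ring, a combination of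
elements of the module. -/
lemma IntegralOverMod.exists_combination [IsNoetherianRing R] [FaithfulSMul R K] {r : ℕ}
    {N : Submodule R (Fin r → R)} (hN : maxMinors N ≠ ⊥) {v : Fin r → R}
    (hv : IntegralOverMod N v) {V : ValuationSubring K} (hV : Dominates R V) :
    ∃ (q : Fin r → K) (c : Fin r → Fin r → R), (∀ s, q s ∈ V) ∧ (∀ s, c s ∈ N) ∧
      ∀ i, algebraMap R K (v i) = ∑ s, q s * algebraMap R K (c s i) := by
  obtain ⟨D, hD, he⟩ := (Submodule.fg_span_iff_fg_span_finset_subset _).1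
    (IsNoetherian.noetherian (maxMinors N))
  replace he : maxMinors N = Ideal.span D := he
  have hDne : D.Nonempty := by
    rw [Finset.nonempty_iff_ne_empty]
    rintro rfl
    simp [he] at hN
  obtain ⟨d, hdD, hmax⟩ := D.exists_max_image (fun d => V.valuation (algebraMap R K d)) hDne
  have hle : ∀ z ∈ maxMinors N, V.valuation (algebraMap R K z) ≤ V.valuation (algebraMap R K d) := by
    intro z hz
    rw [he] at hz
    induction hz using Submodule.span_induction with
    | mem z hz => exact hmax z hz
    | zero => simp
    | add a b _ _ ha hb =>
      rw [map_add]
      exact (V.valuation.map_add _ _).trans (max_le ha hb)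
    | smul a z _ hz =>
      rw [smul_eq_mul, map_mul, map_mul]
      exact (mul_le_of_le_one_left' (hV.le_one a)).trans hz
  have hd0 : algebraMap R K d ≠ 0 := by
    intro h0
    refine hN (eq_bot_iff.2 fun z hz => ?_)
    have := hle z hz
    rw [h0, map_zero, le_zero_iff, map_eq_zero,
      map_eq_zero_iff _ (FaithfulSMul.algebraMap_injective R K)] at this
    simpa using this
  obtain ⟨c, hc, rfl⟩ := hD hdD
  refine ⟨fun s => algebraMap R K (colDet (Function.update c s v)) / algebraMap R K (colDet c), c,
    fun s => ?_, hc, fun i => ?_⟩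
  · obtain ⟨a, ha, hva⟩ := exists_le_valuation_of_memIntClosure
      (V.valuation.comap (algebraMap R K)) (hv (Function.update c s v) s (by simp) fun j hj => by
        simpa [hj] using hc j)
    rw [← V.valuation_le_one_iff, map_div₀,
      div_le_one₀ (zero_lt_iff.2 ((Valuation.ne_zero_iff _).2 hd0))]
    exact hva.trans (hle a ha)
  · have h1 := congrFun (Matrix.mulVec_cramer (Matrix.of fun i j => c j i) v) i
    have h2 : ∀ s, Matrix.cramer (Matrix.of fun i j => c j i) v s =
        colDet (Function.update c s v) := by
      intro s
      rw [Matrix.cramer_apply, colDet]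
      congr 1
      ext a b
      by_cases hb : b = s
      · subst hb; simp
      · simp [hb]
    simp only [Matrix.mulVec, dotProduct, h2, Matrix.of_apply, Pi.smul_apply, smul_eq_mul] at h1
    replace h1 := congrArg (algebraMap R K) h1
    rw [map_sum] at h1
    simp only [map_mul] at h1
    rw [← mul_right_inj' hd0, Finset.mul_sum]
    refine h1.symm.trans (Finset.sum_congr rfl fun s _ => ?_)
    field_simp

/-- Integral closedness descends along a linear map that pulls `M` back to `N`. -/
lemma ModIntClosed.of_comap [IsNoetherianRing R] [IsDomain R] {s r : ℕ}
    {M : Submodule R (Fin r → R)} (hM : ModIntClosed M) (A : (Fin s → R) →ₗ[R] (Fin r → R))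
    (hN : maxMinors (M.comap A) ≠ ⊥) : ModIntClosed (M.comap A) := by
  intro v hv
  refine hM _ fun w j hwj hw => ?_
  refine memIntClosure_of_dominates (K := FractionRing R) fun V hV => ?_
  obtain ⟨q, c, hq, hc, e⟩ := hv.exists_combination hN hV
  refine exists_valuation_colDet_le hw hq (c := fun s => A (c s)) hc fun i => ?_
  have hA : ∀ u : Fin s → R, A u i = ∑ k, u k * A (Pi.single k 1) i := fun u => by
    conv_lhs => rw [pi_eq_sum_univ' u]
    simp [map_sum]
  simp only [hwj, hA v, fun s => hA (c s), map_sum, map_mul, e, Finset.sum_mul, Finset.mul_sum]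
  rw [Finset.sum_comm]
  simp only [mul_assoc]

end IntegralTransfer

section ProductLengths

variable {R : Type*} [CommRing R]

lemma length_quotient_comap_of_surjective {F G : Type*} [AddCommGroup F] [AddCommGroup G]
    [Module R F] [Module R G] {f : F →ₗ[R] G} (hf : Function.Surjective f) (N : Submodule R G) :
    Module.length R (F ⧸ N.comap f) = Module.length R (G ⧸ N) := by
  have h0 : Module.length R (G ⧸ N ⊔ LinearMap.range f) = 0 := by
    rw [Module.length_eq_zero_iff, Submodule.Quotient.subsingleton_iff, LinearMap.range_eq_top.2 hf,
      sup_top_eq]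
  rw [length_quotient_eq_add f N, h0, add_zero]

lemma length_quotient_prod {F G : Type*} [AddCommGroup F] [AddCommGroup G] [Module R F] [Module R G]
    (N : Submodule R F) (P : Submodule R G) :
    Module.length R ((F × G) ⧸ N.prod P) = Module.length R (F ⧸ N) + Module.length R (G ⧸ P) := by
  have h1 : N.prod P ⊔ LinearMap.range (LinearMap.inl R F G) = P.comap (LinearMap.snd R F G) := by
    apply le_antisymm
    · rw [sup_le_iff]
      refine ⟨fun v hv => hv.2, ?_⟩
      rintro _ ⟨v, rfl⟩
      simp
    · rintro ⟨v, w⟩ hw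
      rw [← add_zero v, ← zero_add w, ← Prod.mk_add_mk, add_comm]
      exact Submodule.add_mem_sup ⟨zero_mem _, hw⟩ ⟨v, rfl⟩
  have h2 : (N.prod P).comap (LinearMap.inl R F G) = N := by
    ext a
    simp
  rw [length_quotient_eq_add (LinearMap.inl R F G) (N.prod P), h1, h2,
    length_quotient_comap_of_surjective LinearMap.snd_surjective]

lemma length_quotient_appendSub {r₁ r₂ : ℕ} (N₁ : Submodule R (Fin r₁ → R))
    (N₂ : Submodule R (Fin r₂ → R)) :
    Module.length R ((Fin (r₁ + r₂) → R) ⧸ appendSub N₁ N₂) =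
      Module.length R ((Fin r₁ → R) ⧸ N₁) + Module.length R ((Fin r₂ → R) ⧸ N₂) := by
  rw [← length_quotient_prod]
  exact length_quotient_comap_of_surjective (splitEquiv R r₁ r₂).surjective _

end ProductLengths

section Orders

variable {R : Type*} [CommRing R] [IsLocalRing R]

lemma ordEQ.unique {I : Ideal R} {m n : ℕ} (hm : ordEQ I m) (hn : ordEQ I n) : m = n := by
  by_contra hne
  rcases lt_or_gt_of_ne hne with h | h
  · exact hm.2 (hn.1.trans (Ideal.pow_le_pow_right h))
  · exact hn.2 (hm.1.trans (Ideal.pow_le_pow_right h))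

lemma RegPair.ordEQ_mul {x y : R} (h : RegPair R x y) {I J : Ideal R} {m n : ℕ} (hI : ordEQ I m)
    (hJ : ordEQ J n) : ordEQ (I * J) (m + n) := by
  refine ⟨(Ideal.mul_mono hI.1 hJ.1).trans (pow_add _ _ _).ge, fun hle => ?_⟩
  obtain ⟨a, ha, ha'⟩ := Set.not_subset.1 hI.2
  obtain ⟨b, hb, hb'⟩ := Set.not_subset.1 hJ.2
  exact (h.mem_or_mem_pow_succ (hI.1 ha) (hJ.1 hb) (hle (Ideal.mul_mem_mul ha hb))).elim ha' hb'

omit [IsLocalRing R] in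
lemma colDet_mem_pow_card {r : ℕ} {I : Ideal R} (w : Fin r → Fin r → R) (T : Finset (Fin r))
    (hw : ∀ j ∈ T, ∀ i, w j i ∈ I) : colDet w ∈ I ^ T.card := by
  rw [colDet, Matrix.det_apply]
  refine sum_mem fun σ _ => ?_
  rw [Units.smul_def]
  refine zsmul_mem ?_ _
  rw [← Finset.prod_mul_prod_compl T]
  refine Ideal.mul_mem_right _ _ ?_
  have := Ideal.prod_mem_prod (s := T) (I := fun _ => I)
    (x := fun j => Matrix.of (fun i j => w j i) (σ j) j) fun j hj => hw j hj _
  simpa using this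

omit [IsLocalRing R] in
lemma maxMinors_le_pow {r : ℕ} {I : Ideal R} {M : Submodule R (Fin r → R)}
    (hM : ∀ v ∈ M, ∀ i, v i ∈ I) : maxMinors M ≤ I ^ r := by
  refine Ideal.span_le.2 ?_
  rintro _ ⟨w, hw, rfl⟩
  simpa using colDet_mem_pow_card w Finset.univ fun j _ => hM _ (hw j)

omit [IsLocalRing R] in
lemma range_colDetLin_le_pow {k : ℕ} {I : Ideal R} {b : Fin k → Fin (k + 1) → R}
    (hb : ∀ j i, b j i ∈ I) : LinearMap.range (colDetLin b) ≤ I ^ k := by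
  rintro _ ⟨v, rfl⟩
  rw [colDetLin_apply]
  have := colDet_mem_pow_card (Fin.cons v b : Fin (k + 1) → Fin (k + 1) → R)
    (Finset.univ.erase 0) (I := I) (fun j hj => by
      obtain ⟨j, rfl⟩ := Fin.exists_succ_eq.2 (Finset.ne_of_mem_erase hj)
      exact hb j)
  simpa using this

omit [IsLocalRing R] in
lemma range_linearMap_eq_span {ι : Type*} [Fintype ι] [DecidableEq ι] (f : (ι → R) →ₗ[R] R) :
    LinearMap.range f = Ideal.span (Set.range fun i => f (Pi.single i 1)) := by
  apply le_antisymm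
  · rintro _ ⟨v, rfl⟩
    rw [pi_eq_sum_univ' v, map_sum]
    refine sum_mem fun i _ => ?_
    rw [map_smul]
    exact Ideal.mul_mem_left _ _ (Ideal.subset_span ⟨i, rfl⟩)
  · refine Ideal.span_le.2 ?_
    rintro _ ⟨i, rfl⟩
    exact ⟨_, rfl⟩

/-- If a linear form has all its values on the standard basis in `𝔪^k` and image `𝔪^k`, where
`k + 1` is the number of variables, no basis vector is sent to `𝔪^(k+1)`. -/
lemma RegPair.notMem_pow_succ {x y : R} (h : RegPair R x y) {k : ℕ} (f : (Fin (k + 1) → R) →ₗ[R] R)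
    (hf : LinearMap.range f = maximalIdeal R ^ k) (i : Fin (k + 1)) :
    f (Pi.single i 1) ∉ maximalIdeal R ^ (k + 1) := by
  intro hi
  have := h.succ_le_card_of_pow_le (d := k) (Finset.univ.erase i) (fun i => f (Pi.single i 1))
    (fun j _ => hf ▸ ⟨_, rfl⟩) (by
      rw [← hf, range_linearMap_eq_span, Ideal.span_le]
      rintro _ ⟨j, rfl⟩
      by_cases hj : j = i
      · subst hj
        exact Ideal.mem_sup_right hi
      · exact Ideal.mem_sup_left (Ideal.subset_span ⟨j, by simpa using hj, rfl⟩))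
  simp at this

omit [IsLocalRing R] in
/-- A determinant with one column supported in the first block. -/
lemma colDet_mem_of_left {a b : ℕ} {𝔞 : Ideal R} {N₁ : Submodule R (Fin (a + 1) → R)}
    {N₂ : Submodule R (Fin b → R)} (hN₁ : ∀ v ∈ N₁, ∀ i, v i ∈ 𝔞)
    (w : Fin (a + 1 + b) → Fin (a + 1 + b) → R) (j₀ : Fin (a + 1 + b))
    (hw : ∀ j, j ≠ j₀ → w j ∈ appendSub N₁ N₂) (h0 : ∀ i, w j₀ (Fin.natAdd (a + 1) i) = 0) :
    colDet w ∈ 𝔞 ^ a * maxMinors N₂ := by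
  refine colDet_mem_of_blocks w fun σ => ?_
  rcases hσ : σ.symm j₀ with i₀ | i₀
  · refine Ideal.mul_mem_mul ?_ (colDet_mem_maxMinors fun j => (mem_appendSub.1 (hw _ ?_)).2)
    · have := colDet_mem_pow_card (I := 𝔞)
        (fun i i' => w (σ (.inl i)) (Fin.castAdd b i')) (Finset.univ.erase i₀) fun j hj i => by
          refine hN₁ _ (mem_appendSub.1 (hw (σ (.inl j)) ?_)).1 i
          rintro rfl
          simp at hσ
          simp [hσ] at hj
      simpa using this
    · rintro rfl
      simp at hσ
  · have : colDet (fun i i' => w (σ (.inr i)) (Fin.natAdd (a + 1) i')) ∈ (⊥ : Ideal R) :=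
      colDet_mem_of_forall_mem (j := i₀) _ fun i => by
        rw [← hσ, Equiv.apply_symm_apply, h0]
        exact zero_mem _
    rw [(Submodule.mem_bot R).1 this, mul_zero]
    exact zero_mem _

omit [IsLocalRing R] in
/-- A determinant with one column supported in the second block. -/
lemma colDet_mem_of_right {a b : ℕ} {𝔞 : Ideal R} {N₁ : Submodule R (Fin a → R)}
    {N₂ : Submodule R (Fin (b + 1) → R)} (hN₂ : ∀ v ∈ N₂, ∀ i, v i ∈ 𝔞)
    (w : Fin (a + (b + 1)) → Fin (a + (b + 1)) → R) (j₀ : Fin (a + (b + 1)))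
    (hw : ∀ j, j ≠ j₀ → w j ∈ appendSub N₁ N₂) (h0 : ∀ i, w j₀ (Fin.castAdd (b + 1) i) = 0) :
    colDet w ∈ 𝔞 ^ b * maxMinors N₁ := by
  refine colDet_mem_of_blocks w fun σ => ?_
  rw [mul_comm (colDet _)]
  rcases hσ : σ.symm j₀ with i₀ | i₀
  · have : colDet (fun i i' => w (σ (.inl i)) (Fin.castAdd (b + 1) i')) ∈ (⊥ : Ideal R) :=
      colDet_mem_of_forall_mem (j := i₀) _ fun i => by
        rw [← hσ, Equiv.apply_symm_apply, h0]
        exact zero_mem _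
    rw [(Submodule.mem_bot R).1 this, mul_zero]
    exact zero_mem _
  · refine Ideal.mul_mem_mul ?_ (colDet_mem_maxMinors fun j => (mem_appendSub.1 (hw _ ?_)).1)
    · have := colDet_mem_pow_card (I := 𝔞)
        (fun i i' => w (σ (.inr i)) (Fin.natAdd a i')) (Finset.univ.erase i₀) fun j hj i => by
          refine hN₂ _ (mem_appendSub.1 (hw (σ (.inr j)) ?_)).2 i
          rintro rfl
          simp at hσ
          simp [hσ] at hj
      simpa using this
    · rintro rfl
      simp at hσ

end Orders

section IdealPairs

variable {R : Type*} [CommRing R]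

/-- The direct sum of two ideals as a submodule of `R²`. -/
def pairSub (I J : Ideal R) : Submodule R (Fin 2 → R) :=
  (Submodule.prod I J).comap (LinearEquiv.finTwoArrow R R).toLinearMap

lemma mem_pairSub {I J : Ideal R} {v : Fin 2 → R} : v ∈ pairSub I J ↔ v 0 ∈ I ∧ v 1 ∈ J := Iff.rfl

lemma mul_le_maxMinors_pairSub (I J : Ideal R) : I * J ≤ maxMinors (pairSub I J) := by
  refine Ideal.mul_le.2 fun a ha b hb => ?_
  have : a * b = colDet ![![a, 0], ![0, b]] := by
    rw [colDet_eq_det, Matrix.det_fin_two]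
    simp
  rw [this]
  refine colDet_mem_maxMinors fun j => ?_
  fin_cases j <;> simp [mem_pairSub, ha, hb]

lemma length_quotient_pairSub (I J : Ideal R) : Module.length R ((Fin 2 → R) ⧸ pairSub I J) =
    Module.length R (R ⧸ I) + Module.length R (R ⧸ J) := by
  rw [← length_quotient_prod]
  exact length_quotient_comap_of_surjective (LinearEquiv.finTwoArrow R R).surjective _

variable [IsLocalRing R]

lemma modIntClosed_pairSub [IsNoetherianRing R] [IsDomain R] {I J : Ideal R}
    (hI : IdealIntClosed I) (hJ : IdealIntClosed J) (hI0 : I ≠ ⊥) (hJ0 : J ≠ ⊥) :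
    ModIntClosed (pairSub I J) := by
  intro v hv
  have h0 : maxMinors (pairSub I J) ≠ ⊥ := fun h =>
    mul_ne_zero hI0 hJ0 (eq_bot_iff.2 (h ▸ mul_le_maxMinors_pairSub I J))
  have key : ∀ (L : Ideal R) (i : Fin 2), (∀ u ∈ pairSub I J, u i ∈ L) → MemIntClosure L (v i) := by
    intro L i hL
    refine memIntClosure_of_dominates (K := FractionRing R) fun V hV => ?_
    obtain ⟨q, c, hq, hc, e⟩ := hv.exists_combination (K := FractionRing R) h0 hV
    by_contra! hcon
    have hz := hcon 0 (zero_mem _)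
    rw [map_zero, map_zero] at hz
    refine (lt_irrefl (V.valuation (algebraMap R (FractionRing R) (v i)))) ?_
    conv_lhs => rw [e]
    refine V.valuation.map_sum_lt hz.ne' fun s _ => ?_
    rw [map_mul]
    exact (mul_le_of_le_one_left' ((V.valuation_le_one_iff _).2 (hq s))).trans_lt
      (hcon _ (hL _ (hc s)))
  exact mem_pairSub.2 ⟨hI _ (key I 0 fun u hu => hu.1), hJ _ (key J 1 fun u hu => hu.2)⟩

/-- The core inequality between the colengths of an integrally closed module and of its ideal of
maximal minors. -/
lemma RegPair.length_add_le_length_maxMinors [Infinite (ResidueField R)] {x y : R}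
    (h : RegPair R x y) (hdim : ringKrullDim R ≤ 2) {k : ℕ} {M : Submodule R (Fin (k + 1) → R)}
    (hMm : ∀ v ∈ M, ∀ i, v i ∈ maximalIdeal R) (hM : ModIntClosed M) {N : ℕ}
    (hx : ∀ i, x ^ N • Pi.single i (1 : R) ∈ M) (hy : ∀ i, y ^ N • Pi.single i (1 : R) ∈ M) :
    Module.length R ((Fin (k + 1) → R) ⧸ M) + ((k * (k + 1) / 2 : ℕ) : ℕ∞) ≤
      Module.length R (R ⧸ maxMinors M) := by
  obtain ⟨-, b, hb, -, e⟩ := maxMinors_intClosed_and_length h hdim hMm hM hx hy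
  rw [e, ← h.length_quotient_pow]
  gcongr
  exact length_quotient_anti (range_colDetLin_le_pow fun j => hMm _ (hb j))

lemma RegPair.length_add_le_length_quotient_mul [Infinite (ResidueField R)] {x y : R}
    (h : RegPair R x y) (hdim : ringKrullDim R ≤ 2) {I J : Ideal R} {m n : ℕ}
    (hI : IdealIntClosed I) (hJ : IdealIntClosed J) (hIm : I ≤ maximalIdeal R ^ (m + 1))
    (hJn : J ≤ maximalIdeal R ^ (n + 1)) {N : ℕ} (hxI : x ^ N ∈ I) (hyI : y ^ N ∈ I)
    (hxJ : x ^ N ∈ J) (hyJ : y ^ N ∈ J) :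
    Module.length R (R ⧸ I) + Module.length R (R ⧸ J) + (((m + 1) * (n + 1) : ℕ) : ℕ∞) ≤
      Module.length R (R ⧸ I * J) := by
  have := h.noeth
  have := h.dom
  have hne : ∀ {L : Ideal R}, x ^ N ∈ L → L ≠ ⊥ := fun hL h0 => by
    rw [h0, Submodule.mem_bot] at hL
    exact pow_ne_zero _ h.x_prime.ne_zero hL
  have hsingle : ∀ {a : R}, a ∈ I → a ∈ J → ∀ i, a • Pi.single i (1 : R) ∈ pairSub I J := by
    intro a haI haJ i
    fin_cases i <;> simp [mem_pairSub, haI, haJ]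
  obtain ⟨-, b, hb, -, e⟩ := maxMinors_intClosed_and_length h hdim (k := 1) (M := pairSub I J)
    (fun v hv i => by
      fin_cases i
      · exact Ideal.pow_le_self (Nat.succ_ne_zero m) (hIm hv.1)
      · exact Ideal.pow_le_self (Nat.succ_ne_zero n) (hJn hv.2))
    (modIntClosed_pairSub hI hJ (hne hxI) (hne hxJ)) (hsingle hxI hxJ) (hsingle hyI hyJ)
  have hrange : LinearMap.range (colDetLin b) ≤ Ideal.span {b 0 0, b 0 1} := by
    rintro _ ⟨v, rfl⟩
    rw [colDetLin_apply, colDet_eq_det, Matrix.det_fin_two]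
    refine sub_mem ?_ ?_
    · exact Ideal.mul_mem_left _ _ (Ideal.subset_span (Or.inr rfl))
    · exact Ideal.mul_mem_left _ _ (Ideal.subset_span (Or.inl rfl))
  refine le_trans ?_ (length_quotient_anti (mul_le_maxMinors_pairSub I J))
  rw [e, length_quotient_pairSub]
  gcongr
  exact (h.mul_le_length_quotient_span_pair (hIm (hb 0).1) (hJn (hb 0).2)).trans
    (length_quotient_anti hrange)

end IdealPairs

section DirectSum

variable {R : Type*} [CommRing R] [IsLocalRing R]

lemma succ_mul_div_two (a b : ℕ) : (a + 1 + b) * (a + 1 + b + 1) / 2 =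
    a * (a + 1) / 2 + b * (b + 1) / 2 + (a + 1) * (b + 1) := by
  obtain ⟨c, hc⟩ := Nat.even_mul_succ_self a
  obtain ⟨d, hd⟩ := Nat.even_mul_succ_self b
  have e : (a + 1 + b) * (a + 1 + b + 1) = 2 * (c + d + (a + 1) * (b + 1)) := by
    nlinarith
  omega

omit [IsLocalRing R] in
lemma appendSub_mem_ideal {r₁ r₂ : ℕ} {I : Ideal R} {N₁ : Submodule R (Fin r₁ → R)}
    {N₂ : Submodule R (Fin r₂ → R)} (h₁ : ∀ v ∈ N₁, ∀ i, v i ∈ I) (h₂ : ∀ v ∈ N₂, ∀ i, v i ∈ I) :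
    ∀ v ∈ appendSub N₁ N₂, ∀ i, v i ∈ I := fun v hv i => by
  refine Fin.addCases (fun i => ?_) (fun i => ?_) i
  · exact h₁ _ hv.1 i
  · exact h₂ _ hv.2 i

/-- The structure of extremal direct sums, in normalized form. -/
theorem extremal_appendSub [Infinite (ResidueField R)] {x y : R}
    (h : RegPair R x y) (hdim : ringKrullDim R ≤ 2) {a b : ℕ}
    {N₁ : Submodule R (Fin (a + 1) → R)} {N₂ : Submodule R (Fin (b + 1) → R)}
    (hm₁ : ∀ v ∈ N₁, ∀ i, v i ∈ maximalIdeal R) (hm₂ : ∀ v ∈ N₂, ∀ i, v i ∈ maximalIdeal R)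
    (hc₁ : ModIntClosed N₁) (hc₂ : ModIntClosed N₂) (hc : ModIntClosed (appendSub N₁ N₂)) {N : ℕ}
    (hx₁ : ∀ v, x ^ N • v ∈ N₁) (hy₁ : ∀ v, y ^ N • v ∈ N₁)
    (hx₂ : ∀ v, x ^ N • v ∈ N₂) (hy₂ : ∀ v, y ^ N • v ∈ N₂)
    (hfin₁ : FinColength N₁) (hfin₂ : FinColength N₂)
    (hext : Module.length R (R ⧸ maxMinors (appendSub N₁ N₂)) =
      Module.length R ((Fin (a + 1 + (b + 1)) → R) ⧸ appendSub N₁ N₂) +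
        (((a + 1 + b) * (a + 1 + b + 1) / 2 : ℕ) : ℕ∞)) :
    (ordEQ (maxMinors N₁) (a + 1) ∧ ordEQ (maxMinors N₂) (b + 1)) ∧
    (Module.length R (R ⧸ maxMinors N₁) =
        Module.length R ((Fin (a + 1) → R) ⧸ N₁) + ((a * (a + 1) / 2 : ℕ) : ℕ∞) ∧
      Module.length R (R ⧸ maxMinors N₂) =
        Module.length R ((Fin (b + 1) → R) ⧸ N₂) + ((b * (b + 1) / 2 : ℕ) : ℕ∞)) ∧
    Module.length R (R ⧸ maxMinors (appendSub N₁ N₂)) = Module.length R (R ⧸ maxMinors N₁) +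
      Module.length R (R ⧸ maxMinors N₂) + (((a + 1) * (b + 1) : ℕ) : ℕ∞) ∧
    maximalIdeal R ^ (a + 1 + b) =
      maximalIdeal R ^ b * maxMinors N₁ + maximalIdeal R ^ a * maxMinors N₂ := by
  have hle₁ := maxMinors_le_pow hm₁
  have hle₂ := maxMinors_le_pow hm₂
  have hm := appendSub_mem_ideal hm₁ hm₂
  have hf₁ := Module.length_ne_top_iff.2 hfin₁
  have hf₂ := Module.length_ne_top_iff.2 hfin₂
  obtain ⟨-, c, hcM, -, e⟩ := maxMinors_intClosed_and_length h hdim (k := a + 1 + b)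
    (M := @appendSub R _ (a + 1) (b + 1) N₁ N₂) hm hc (N := N)
    (fun i => ⟨hx₁ _, hx₂ _⟩) (fun i => ⟨hy₁ _, hy₂ _⟩)
  have hrange : LinearMap.range (colDetLin c) = maximalIdeal R ^ (a + 1 + b) := by
    refine eq_of_length_quotient_eq (range_colDetLin_le_pow fun j => hm _ (hcM j)) ?_ ?_
    · rw [h.length_quotient_pow]
      exact ENat.natCast_ne_top _
    · rw [h.length_quotient_pow]
      rw [e] at hext
      refine (WithTop.add_left_inj ?_).1 hext
      exact (length_quotient_appendSub N₁ N₂).trans_ne (WithTop.add_ne_top.2 ⟨hf₁, hf₂⟩)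
  have hleft : ∀ v : Fin (a + 1 + (b + 1)) → R, (∀ i, v (Fin.natAdd (a + 1) i) = 0) →
      colDetLin c v ∈ maximalIdeal R ^ a * maxMinors N₂ := fun v hv => by
    rw [colDetLin_apply]
    refine colDet_mem_of_left hm₁ _ (0 : Fin (a + 1 + b + 1)) (fun j hj => ?_) hv
    obtain ⟨j, rfl⟩ := Fin.exists_succ_eq.2 hj
    exact hcM j
  have hright : ∀ v : Fin (a + 1 + (b + 1)) → R, (∀ i, v (Fin.castAdd (b + 1) i) = 0) →
      colDetLin c v ∈ maximalIdeal R ^ b * maxMinors N₁ := fun v hv => by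
    rw [colDetLin_apply]
    refine colDet_mem_of_right hm₂ _ (0 : Fin (a + 1 + b + 1)) (fun j hj => ?_) hv
    obtain ⟨j, rfl⟩ := Fin.exists_succ_eq.2 hj
    exact hcM j
  have hpow₁ : ∀ {p : ℕ} {I : Ideal R}, I ≤ maximalIdeal R ^ p → ∀ q,
      maximalIdeal R ^ q * I ≤ maximalIdeal R ^ (q + p) := fun hI q => by
    rw [pow_add]
    exact Ideal.mul_mono_right hI
  have hne : ∀ (i : Fin (a + 1)) (j : Fin (b + 1)), Fin.castAdd (b + 1) i ≠ Fin.natAdd (a + 1) j :=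
    fun i j h => by
      have := congrArg Fin.val h
      rw [Fin.val_castAdd, Fin.val_natAdd] at this
      omega
  have hsingle₁ : colDetLin c (Pi.single
      (show Fin (a + 1 + (b + 1)) from Fin.castAdd (b + 1) (0 : Fin (a + 1))) 1) ∈
      maximalIdeal R ^ a * maxMinors N₂ := hleft _ fun i => Pi.single_eq_of_ne (hne _ _).symm _
  have hsingle₂ : colDetLin c (Pi.single
      (show Fin (a + 1 + (b + 1)) from Fin.natAdd (a + 1) (0 : Fin (b + 1))) 1) ∈
      maximalIdeal R ^ b * maxMinors N₁ := hright _ fun i => Pi.single_eq_of_ne (hne _ _) _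
  have hord₁ : ordEQ (maxMinors N₁) (a + 1) := ⟨hle₁, fun hle =>
    h.notMem_pow_succ (colDetLin c) hrange _
      (show _ ∈ maximalIdeal R ^ (a + 1 + b + 1) by
        have := hpow₁ hle b hsingle₂
        rwa [show b + (a + 1 + 1) = a + 1 + b + 1 by omega] at this)⟩
  have hord₂ : ordEQ (maxMinors N₂) (b + 1) := ⟨hle₂, fun hle =>
    h.notMem_pow_succ (colDetLin c) hrange _
      (show _ ∈ maximalIdeal R ^ (a + 1 + b + 1) by
        have := hpow₁ hle a hsingle₁
        rwa [show a + (b + 1 + 1) = a + 1 + b + 1 by omega] at this)⟩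
  obtain ⟨hcl₁, -⟩ := maxMinors_intClosed_and_length h hdim hm₁ hc₁ (N := N)
    (fun i => hx₁ _) (fun i => hy₁ _)
  obtain ⟨hcl₂, -⟩ := maxMinors_intClosed_and_length h hdim hm₂ hc₂ (N := N)
    (fun i => hx₂ _) (fun i => hy₂ _)
  have hineq₁ := h.length_add_le_length_maxMinors hdim hm₁ hc₁ (N := N)
    (fun i => hx₁ _) (fun i => hy₁ _)
  have hineq₂ := h.length_add_le_length_maxMinors hdim hm₂ hc₂ (N := N)
    (fun i => hx₂ _) (fun i => hy₂ _)
  have hpow : ∀ {z : R} {r : ℕ} {L : Submodule R (Fin (r + 1) → R)}, (∀ v, z ^ N • v ∈ L) → ∀ q,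
      r + 1 ≤ q → z ^ (N * q) ∈ maxMinors L := fun {z r L} hL q hq => by
    have := pow_mem_maxMinors (q := z ^ N) fun i => hL (Pi.single i 1)
    rw [pow_mul]
    exact Ideal.pow_mem_of_pow_mem _ this hq
  have hprod := h.length_add_le_length_quotient_mul hdim hcl₁ hcl₂ hle₁ hle₂
    (N := N * (a + 1 + (b + 1))) (hpow hx₁ _ (by omega)) (hpow hy₁ _ (by omega))
    (hpow hx₂ _ (by omega)) (hpow hy₂ _ (by omega))
  have hfI₁ := h.length_quotient_ne_top (hpow hx₁ _ le_rfl) (hpow hy₁ _ le_rfl)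
  have hfI₂ := h.length_quotient_ne_top (hpow hx₂ _ le_rfl) (hpow hy₂ _ le_rfl)
  rw [← maxMinors_appendSub, hext] at hprod
  refine ⟨⟨hord₁, hord₂⟩, ?_⟩
  rw [← and_assoc]
  refine ⟨?_, le_antisymm ?_ ?_⟩
  · rw [hext]
    rw [length_quotient_appendSub, succ_mul_div_two] at hprod ⊢
    generalize Module.length R (R ⧸ maxMinors N₁) = p at *
    generalize Module.length R (R ⧸ maxMinors N₂) = q at *
    generalize Module.length R ((Fin (a + 1) → R) ⧸ N₁) = s at *
    generalize Module.length R ((Fin (b + 1) → R) ⧸ N₂) = t at *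
    clear hext e
    generalize a * (a + 1) / 2 = A at *
    generalize b * (b + 1) / 2 = B at *
    generalize (a + 1) * (b + 1) = C at *
    lift p to ℕ using hfI₁
    lift q to ℕ using hfI₂
    lift s to ℕ using hf₁
    lift t to ℕ using hf₂
    norm_cast at *
    omega
  · rw [← hrange]
    rintro _ ⟨v, rfl⟩
    rw [← (splitEquiv R (a + 1) (b + 1)).symm_apply_apply v]
    obtain ⟨p, q⟩ := splitEquiv R (a + 1) (b + 1) v
    rw [← add_zero p, ← zero_add q, ← Prod.mk_add_mk, map_add, map_add,
      add_comm (colDetLin c _)]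
    refine Submodule.add_mem_sup (hright _ fun i => ?_) (hleft _ fun i => ?_)
    · exact congrFun (congrArg Prod.fst
        ((splitEquiv R (a + 1) (b + 1)).apply_symm_apply (0, q))) i
    · exact congrFun (congrArg Prod.snd
        ((splitEquiv R (a + 1) (b + 1)).apply_symm_apply (p, 0))) i
  · refine sup_le ?_ ?_
    · exact (hpow₁ hle₁ b).trans (Ideal.pow_le_pow_right (by omega))
    · exact (hpow₁ hle₂ a).trans (Ideal.pow_le_pow_right (by omega))

end DirectSum

section Transfer

lemma modLength_eq_length (R M : Type*) [CommRing R] [AddCommGroup M] [Module R M] :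
    modLength R M = (Module.length R M : WithBot ℕ∞) := (Module.coe_length R M).symm

variable {R : Type*} [CommRing R]

lemma modLength_eq_add_iff {A B : Type*} [AddCommGroup A] [AddCommGroup B]
    [Module R A] [Module R B] {k : ℕ} :
    modLength R A = modLength R B + (k : WithBot ℕ∞) ↔
      Module.length R A = Module.length R B + (k : ℕ∞) := by
  rw [modLength_eq_length, modLength_eq_length]
  norm_cast

lemma modLength_eq_add_add_iff {A B C : Type*} [AddCommGroup A] [AddCommGroup B] [AddCommGroup C]
    [Module R A] [Module R B] [Module R C] {k : ℕ} :
    modLength R A = modLength R B + modLength R C + (k : WithBot ℕ∞) ↔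
      Module.length R A = Module.length R B + Module.length R C + (k : ℕ∞) := by
  rw [modLength_eq_length, modLength_eq_length, modLength_eq_length]
  norm_cast

lemma pos_of_ne_bot_of_linearEquiv {M : Type*} [AddCommGroup M] [Module R M] {P : Submodule R M}
    (hP : P ≠ ⊥) {s : ℕ} {N : Submodule R (Fin s → R)} (e : P ≃ₗ[R] N) : ∃ a, s = a + 1 := by
  refine Nat.exists_eq_succ_of_ne_zero fun hs => hP ?_
  subst hs
  have : Subsingleton P := e.toEquiv.subsingleton
  exact Submodule.subsingleton_iff_eq_bot.1 this

variable [IsLocalRing R]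

lemma ModIntClosed.of_comap_eq {x y : R} (h : RegPair R x y) {r s t : ℕ}
    {M : Submodule R (Fin r → R)} (hM : ModIntClosed M) {N : Submodule R (Fin s → R)}
    (A : (Fin s → R) →ₗ[R] (Fin r → R)) (hA : M.comap A = N) (hN : ∀ v, x ^ t • v ∈ N) :
    ModIntClosed N := by
  have := h.noeth
  have := h.dom
  rw [← hA] at hN ⊢
  refine hM.of_comap A fun h0 => ?_
  have := pow_mem_maxMinors (q := x ^ t) fun i => hN (Pi.single i 1)
  rw [h0, Submodule.mem_bot] at this
  exact pow_ne_zero _ (pow_ne_zero _ h.x_prime.ne_zero) this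

end Transfer

/-- if an extremal module `M` of rank `r` with `I(M) = I` of order `n`
decomposes as `P₁ ⊕ P₂`, with `P_i` of rank `r_i` isomorphic to a full submodule `N_i` of
`R^(r_i)` and `I(P_i) = I_i` of order `n_i`, then (1) `n₁ = r₁`, `n₂ = r₂`, `n = r`;
(2) `P₁, P₂` are extremal; (3) `λ(R/I) = λ(R/I₁) + λ(R/I₂) + r₁r₂`;
(4) `𝔪^(r-1) = 𝔪^(r₂-1) I₁ + 𝔪^(r₁-1) I₂`. -/
theorem statement10 (R : Type*) [CommRing R] [IsLocalRing R]
    (hreg : IsTwoDimRegularLocal R) [Infinite (IsLocalRing.ResidueField R)]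
    (r n : ℕ) (M : Submodule R (Fin r → R))
    (hM : IsExtremal M) (hord : ordEQ (maxMinors M) n)
    (P₁ P₂ : Submodule R (Fin r → R))
    (hdisj : P₁ ⊓ P₂ = ⊥) (hsup : P₁ ⊔ P₂ = M) (hne₁ : P₁ ≠ ⊥) (hne₂ : P₂ ≠ ⊥)
    (r₁ r₂ n₁ n₂ : ℕ)
    (N₁ : Submodule R (Fin r₁ → R)) (N₂ : Submodule R (Fin r₂ → R))
    (hN₁ : FinColength N₁) (hN₂ : FinColength N₂)
    (e₁ : Nonempty (↥P₁ ≃ₗ[R] ↥N₁)) (e₂ : Nonempty (↥P₂ ≃ₗ[R] ↥N₂))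
    (ho₁ : ordEQ (maxMinors N₁) n₁) (ho₂ : ordEQ (maxMinors N₂) n₂) :
    (n₁ = r₁ ∧ n₂ = r₂ ∧ n = r) ∧
    (IsExtremal N₁ ∧ IsExtremal N₂) ∧
    modLength R (R ⧸ maxMinors M) =
      modLength R (R ⧸ maxMinors N₁) + modLength R (R ⧸ maxMinors N₂) +
        ((r₁ * r₂ : ℕ) : WithBot ℕ∞) ∧
    maximalIdeal R ^ (r - 1) =
      maximalIdeal R ^ (r₂ - 1) * maxMinors N₁ +
        maximalIdeal R ^ (r₁ - 1) * maxMinors N₂ := by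
  obtain ⟨x, y, h⟩ := hreg.exists_regPair
  have hdim : ringKrullDim R ≤ 2 := hreg.2.1.le
  have := h.dom
  obtain ⟨e₁⟩ := e₁
  obtain ⟨e₂⟩ := e₂
  obtain ⟨hMfin, hMcl, hMfree, hMlen⟩ := hM
  obtain ⟨E, hE⟩ := h.exists_linearEquiv_prod hMfin hdisj hsup hN₁ hN₂ e₁ e₂
  obtain ⟨a, rfl⟩ := pos_of_ne_bot_of_linearEquiv hne₁ e₁
  obtain ⟨b, rfl⟩ := pos_of_ne_bot_of_linearEquiv hne₂ e₂
  obtain rfl : a + 1 + (b + 1) = r := by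
    simpa using LinearEquiv.finrank_eq E
  clear hdisj hsup hne₁ hne₂ e₁ e₂
  have hmem : ∀ p, E p ∈ M ↔ p.1 ∈ N₁ ∧ p.2 ∈ N₂ := fun p => by
    rw [← hE]
    exact E.injective.mem_set_image
  have hfree₁ : ¬ HasFreeSummand N₁ := fun hf => hMfree (hE ▸ hf.prod_left E)
  have hfree₂ : ¬ HasFreeSummand N₂ := fun hf => hMfree <| by
    have hf' := hf.prod_left (N₂ := N₁) ((LinearEquiv.prodComm R _ _).trans E)
    convert hf' using 1
    ext v
    obtain ⟨p, rfl⟩ := E.surjective v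
    exact (hmem p).trans (and_comm.trans
      (((LinearEquiv.prodComm R _ _).trans E).injective.mem_set_image (s := N₂.prod N₁)
        (a := p.swap)).symm)
  obtain ⟨k₁, hk₁⟩ := hN₁.exists_pow_smul_mem h.x_mem
  obtain ⟨k₂, hk₂⟩ := hN₁.exists_pow_smul_mem h.y_mem
  obtain ⟨k₃, hk₃⟩ := hN₂.exists_pow_smul_mem h.x_mem
  obtain ⟨k₄, hk₄⟩ := hN₂.exists_pow_smul_mem h.y_mem
  replace hk₁ := hk₁ (k₁ + k₂ + k₃ + k₄) (by omega)
  replace hk₂ := hk₂ (k₁ + k₂ + k₃ + k₄) (by omega)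
  replace hk₃ := hk₃ (k₁ + k₂ + k₃ + k₄) (by omega)
  replace hk₄ := hk₄ (k₁ + k₂ + k₃ + k₄) (by omega)
  set T := (splitEquiv R (a + 1) (b + 1)).trans E with hT
  have hMT : M.comap T.toLinearMap = appendSub N₁ N₂ := by
    ext v
    exact hmem _
  have hminors : maxMinors M = maxMinors (appendSub N₁ N₂) := by
    rw [← maxMinors_map_equiv T (appendSub N₁ N₂), ← hMT,
      Submodule.map_comap_eq_of_surjective T.surjective]
  have hcl₁ : ModIntClosed N₁ := hMcl.of_comap_eq h (E.toLinearMap ∘ₗ LinearMap.inl R _ _)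
    (by ext v; exact (hmem _).trans (by simp)) hk₁
  have hcl₂ : ModIntClosed N₂ := hMcl.of_comap_eq h (E.toLinearMap ∘ₗ LinearMap.inr R _ _)
    (by ext v; exact (hmem _).trans (by simp)) hk₃
  have hcl : ModIntClosed (appendSub N₁ N₂) := hMcl.of_comap_eq h T.toLinearMap hMT
    fun v => ⟨hk₁ _, hk₃ _⟩
  rw [modLength_eq_add_iff, hminors, ← length_quotient_comap_of_surjective T.surjective,
    hMT] at hMlen
  obtain ⟨⟨h₁, h₂⟩, ⟨hlen₁, hlen₂⟩, hlen, hpow⟩ := extremal_appendSub h hdim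
    (fun v hv => mem_maximalIdeal_of_not_hasFreeSummand hfree₁ hv)
    (fun v hv => mem_maximalIdeal_of_not_hasFreeSummand hfree₂ hv)
    hcl₁ hcl₂ hcl hk₁ hk₂ hk₃ hk₄ hN₁ hN₂
    (by rw [hMlen, mul_comm (a + 1 + (b + 1))]; rfl)
  refine ⟨⟨ho₁.unique h₁, ho₂.unique h₂, ?_⟩, ⟨⟨hN₁, hcl₁, hfree₁, ?_⟩, ⟨hN₂, hcl₂, hfree₂, ?_⟩⟩,
    ?_, hpow⟩
  · rw [hminors, maxMinors_appendSub] at hord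
    exact hord.unique (h.ordEQ_mul h₁ h₂)
  · rw [modLength_eq_add_iff, hlen₁, mul_comm (a + 1)]
    rfl
  · rw [modLength_eq_add_iff, hlen₂, mul_comm (b + 1)]
    rfl
  · rw [modLength_eq_add_add_iff, hminors, hlen]
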